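/- Let A = ℂQ/⟨R⟩ be a connected, acyclic, tame bound quiver algebra and α ∈ ℕ^{Q_0} with P_A(α) ≠ ∅. If C(α) = closure(C(α_1) ⊕ … ⊕ C(α_l)) is the generic decomposition of C(α), then for any integer n > 0 the generic decomposition of C(nα) is C(nα) = closure(C(α_1)^{⊕n} ⊕ … ⊕ C(α_l)^{⊕n}). -/

import Mathlib

open Matrix
noncomputable section

/-- A (finite-vertex) quiver: vertices, arrows, tail and head maps. -/
structure Quiv where
  V : Type
  A : Type
  t : A → V
  h : A → V
  [fV : Fintype V]
  [dV : DecidableEq V]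

attribute [instance] Quiv.fV Quiv.dV

/-- The `Quiver` structure on the vertices of `Q`: an arrow from `x` to `y` is an
arrow of `Q` with tail `x` and head `y`.  This gives us `Quiver.Path x y`, the type of
oriented paths from `x` to `y` in `Q`. -/
instance quivToQuiver (Q : Quiv) : Quiver Q.V := ⟨fun x y => {a : Q.A // Q.t a = x ∧ Q.h a = y}⟩

/-- The space of matrix representations of `Q` of dimension vector `β`, with entries in a
commutative ring `R`. -/
def RepR (Q : Quiv) (R : Type) (β : Q.V → ℕ) := ∀ a : Q.A, Matrix (Fin (β (Q.h a))) (Fin (β (Q.t a))) R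

/-- The representation space `rep(Q,β) = ∏_{a ∈ Q₁} ℂ^{β(ha) × β(ta)}`. -/
abbrev QRep (Q : Quiv) (β : Q.V → ℕ) := RepR Q ℂ β

/-- Transport of a rectangular matrix along equalities of its sizes. -/
def castM {R : Type} {m n m' n' : ℕ} (hm : m = m') (hn : n = n')
    (M : Matrix (Fin m) (Fin n) R) : Matrix (Fin m') (Fin n') R :=
  M.submatrix (Fin.cast hm.symm) (Fin.cast hn.symm)

/-- The value `W(p)` of a representation `W` on an oriented path `p` (the product of the
matrices attached to the arrows of `p`; the trivial path gives the identity matrix). -/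
def evalPath {Q : Quiv} {R : Type} [CommRing R] {β : Q.V → ℕ} (W : RepR Q R β) :
    ∀ {x y : Q.V}, Quiver.Path x y → Matrix (Fin (β y)) (Fin (β x)) R
  | _, _, Quiver.Path.nil => 1
  | _, _, Quiver.Path.cons p e =>
      (castM (congrArg β e.2.2) (congrArg β e.2.1) (W e.1)) * evalPath W p
variable (Q : Quiv)

/-- A formal (finite) linear combination of parallel oriented paths in `Q`, together with its
endpoints: the element of the path algebra it represents lives in `e_y · ℂQ · e_x`. -/
def FormalRel := Σ (x : Q.V) (y : Q.V), (Quiver.Path x y →₀ ℂ)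

variable {Q}

/-- Evaluation of a representation on a formal linear combination of parallel paths. -/
def evalLin {β : Q.V → ℕ} (W : QRep Q β) {x y : Q.V} (c : Quiver.Path x y →₀ ℂ) :
    Matrix (Fin (β y)) (Fin (β x)) ℂ :=
  c.sum fun p k => k • evalPath W p

/-- Evaluation of a representation over `ℂ[x]` on a formal linear combination of paths. -/
def evalLinP {β : Q.V → ℕ} (W : RepR Q (Polynomial ℂ) β) {x y : Q.V}
    (c : Quiver.Path x y →₀ ℂ) : Matrix (Fin (β y)) (Fin (β x)) (Polynomial ℂ) :=
  c.sum fun p k => (Polynomial.C k) • evalPath W p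

/-- The module variety `mod(A,β)` of the algebra `A = ℂQ/⟨S⟩`: all `β`-dimensional
representations of `Q` annihilating every relation in `S`. -/
def modSet (S : Set (FormalRel Q)) (β : Q.V → ℕ) : Set (QRep Q β) :=
  {W | ∀ r ∈ S, evalLin W r.2.2 = 0}

/-- A set of relations is admissible if every path occurring in it has length at least two. -/
def AdmissibleRels (S : Set (FormalRel Q)) : Prop :=
  ∀ r ∈ S, ∀ p ∈ r.2.2.support, 2 ≤ p.length

/-- The base change group `GL(β) = ∏_x GL(β(x),ℂ)`. -/
abbrev GLb (β : Q.V → ℕ) := ∀ x : Q.V, Matrix.GeneralLinearGroup (Fin (β x)) ℂ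

/-- The action of `GL(β)` on `rep(Q,β)` by simultaneous conjugation. -/
def gAct {β : Q.V → ℕ} (g : GLb β) (W : QRep Q β) : QRep Q β :=
  fun a => ((g (Q.h a)).val) * W a * (((g (Q.t a))⁻¹).val)

/-- The character of `GL(β)` induced by the weight `σ`: `g ↦ ∏_x det(g(x))^{σ(x)}`.  -/
def chi {β : Q.V → ℕ} (σ : Q.V → ℤ) (g : GLb β) : ℂ :=
  ∏ x : Q.V, ((g x).val.det) ^ (σ x)

/-- Index type of the coordinates on `rep(Q,β)`. -/
def RepCoord (β : Q.V → ℕ) := Σ a : Q.A, Fin (β (Q.h a)) × Fin (β (Q.t a))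

/-- The coordinates of a point of `rep(Q,β)`. -/
def repCoords {β : Q.V → ℕ} (W : QRep Q β) : RepCoord (Q := Q) β → ℂ :=
  fun c => W c.1 c.2.1 c.2.2

/-- `F` is a polynomial function on `rep(Q,β)`. -/
def IsPolyFun {β : Q.V → ℕ} (F : QRep Q β → ℂ) : Prop :=
  ∃ P : MvPolynomial (RepCoord (Q := Q) β) ℂ, ∀ W, F W = MvPolynomial.eval (repCoords W) P

/-- `F` is a semi-invariant of weight `σ` on `rep(Q,β)`. -/
def IsSemiInvariant {β : Q.V → ℕ} (σ : Q.V → ℤ) (F : QRep Q β → ℂ) : Prop :=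
  IsPolyFun F ∧ ∀ (g : GLb β) (W : QRep Q β), F (gAct g W) = chi σ g * F W

/-- The orbit semigroup `S_Q(W)` of a representation `W ∈ rep(Q,β)`: all weights `σ` admitting
a semi-invariant of weight `σ` not vanishing at `W`. -/
def OrbitSemigroup {β : Q.V → ℕ} (W : QRep Q β) : Set (Q.V → ℤ) :=
  {σ | ∃ F : QRep Q β → ℂ, IsSemiInvariant σ F ∧ F W ≠ 0}

/-- `W` is `σ`-semi-stable: some positive multiple of `σ` lies in the orbit semigroup. -/
def SemiStable {β : Q.V → ℕ} (σ : Q.V → ℤ) (W : QRep Q β) : Prop :=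
  ∃ n : ℕ, 1 ≤ n ∧ (fun x => (n : ℤ) * σ x) ∈ OrbitSemigroup W

/-- The weight `σ` is `W`-saturated: if `nσ` lies in the orbit semigroup of `W` for some
integer `n ≥ 1`, then so does `σ`. -/
def WSaturated {β : Q.V → ℕ} (W : QRep Q β) (σ : Q.V → ℤ) : Prop :=
  (∃ n : ℕ, 1 ≤ n ∧ (fun x => (n : ℤ) * σ x) ∈ OrbitSemigroup W) → σ ∈ OrbitSemigroup W

/-- `Q` is connected: any two vertices are joined by an unoriented walk. -/
def QConnected (Q : Quiv) : Prop :=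
  ∀ x y : Q.V, Relation.ReflTransGen
    (fun u v => ∃ a : Q.A, (Q.t a = u ∧ Q.h a = v) ∨ (Q.t a = v ∧ Q.h a = u)) x y

/-- `Q` is acyclic: the only oriented path from a vertex to itself is the trivial one. -/
def QAcyclic (Q : Quiv) : Prop := ∀ (x : Q.V) (p : Quiver.Path x x), p = Quiver.Path.nil
section Capacity

variable (Q : Quiv) (β : Q.V → ℕ) (σ : Q.V → ℤ)

/-- Vertices where the weight `σ` is positive. -/
abbrev PosV := {x : Q.V // 0 < σ x}

/-- Vertices where the weight `σ` is negative. -/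
abbrev NegV := {x : Q.V // σ x < 0}

/-- `σ₊` at a positive vertex. -/
abbrev posP (i : PosV Q σ) : ℕ := (σ i.1).toNat

/-- `σ₋` at a negative vertex. -/
abbrev negP (j : NegV Q σ) : ℕ := (-σ j.1).toNat

/-- Row index type of the `N × N` block matrices: block rows are indexed by pairs `(j,q)`
with `q ∈ I_j⁻`, each of height `β(w_j)`; so `N = Σ_j σ₋(w_j)β(w_j)` rows in total. -/
abbrev RowT := Σ j : NegV Q σ, Fin (negP Q σ j) × Fin (β j.1)

/-- Column index type of the `N × N` block matrices: block columns indexed by pairs `(i,r)`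
with `r ∈ I_i⁺`, each of width `β(v_i)`; so `N = Σ_i σ₊(v_i)β(v_i)` columns in total. -/
abbrev ColT := Σ i : PosV Q σ, Fin (posP Q σ i) × Fin (β i.1)

/-- The index set `I_σ = {(i,j,p,q,r)}`. -/
structure BIdx where
  i : PosV Q σ
  j : NegV Q σ
  p : Quiver.Path i.1 j.1
  q : Fin (negP Q σ j)
  r : Fin (posP Q σ i)

variable {Q β σ}

/-- The block matrix `W^{i,j,p}_{q,r}`: its `(q,r)` block entry is `W(p)` and all other
entries vanish. -/
def blockMat (W : QRep Q β) (d : BIdx Q σ) : Matrix (RowT Q β σ) (ColT Q β σ) ℂ :=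
  fun s u =>
    if hj : s.1 = d.j then
      if hi : u.1 = d.i then
        if Fin.cast (congrArg (negP Q σ) hj) s.2.1 = d.q ∧
           Fin.cast (congrArg (posP Q σ) hi) u.2.1 = d.r then
          evalPath W d.p (Fin.cast (congrArg (fun z => β z.1) hj) s.2.2)
            (Fin.cast (congrArg (fun z => β z.1) hi) u.2.2)
        else 0
      else 0
    else 0

/-- The Brascamp–Lieb (completely positive) operator `T_{W,σ}` associated to the quiver
datum `(W,σ)`, with Kraus operators the block matrices `W^{i,j,p}_{q,r}`. -/
def BLop (W : QRep Q β) (X : Matrix (RowT Q β σ) (RowT Q β σ) ℂ) :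
    Matrix (ColT Q β σ) (ColT Q β σ) ℂ :=
  ∑ᶠ d : BIdx Q σ, (blockMat W d)ᵀ * X * blockMat W d

/-- The capacity `cap_Q(W,σ)` of the quiver datum `(W,σ)`: the infimum of
`Det (T_{W,σ}(X))` over real positive definite matrices `X` with `Det X = 1`. -/
def capQ (W : QRep Q β) : ℝ :=
  sInf {r : ℝ | ∃ X : Matrix (RowT Q β σ) (RowT Q β σ) ℝ, X.PosDef ∧ X.det = 1 ∧
    r = ((BLop (σ := σ) W (X.map Complex.ofReal)).det).re}

/-- `Span_ℂ(W^{i,j,p}_{q,r} : (i,j,p,q,r) ∈ I_σ)` contains a non-singular `N × N` matrix. -/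
def SpanNonsingular (W : QRep Q β) (σ : Q.V → ℤ) : Prop :=
  ∃ M ∈ Submodule.span ℂ (Set.range (blockMat (σ := σ) W)),
    Function.Bijective (Matrix.mulVecLin M)

end Capacity
section HomExt

variable {Q : Quiv}

/-- The space of morphisms of representations `Hom(V,W)`, as a subspace of
`∏_x Hom(V(x),W(x))` (in matrix form). -/
def HomS {α γ : Q.V → ℕ} (V : QRep Q α) (W : QRep Q γ) :
    Submodule ℂ (∀ x : Q.V, Matrix (Fin (γ x)) (Fin (α x)) ℂ) where
  carrier := {φ | ∀ a : Q.A, φ (Q.h a) * V a = W a * φ (Q.t a)}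
  add_mem' := by
    intro φ ψ hφ hψ a
    simp only [Pi.add_apply, Matrix.add_mul, Matrix.mul_add, hφ a, hψ a]
  zero_mem' := by intro a; simp
  smul_mem' := by
    intro c φ hφ a
    simp only [Pi.smul_apply, Matrix.smul_mul, Matrix.mul_smul, hφ a]

/-- `dim_ℂ Hom(V,W)`. -/
def dimHom {α γ : Q.V → ℕ} (V : QRep Q α) (W : QRep Q γ) : ℕ :=
  Module.finrank ℂ (HomS V W)

/-- A family of matrices is componentwise surjective (as linear maps). -/
def MorSurj {α γ : Q.V → ℕ} (φ : ∀ x : Q.V, Matrix (Fin (γ x)) (Fin (α x)) ℂ) : Prop :=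
  ∀ x, Function.Surjective (Matrix.mulVecLin (φ x))

/-- A family of matrices is componentwise injective (as linear maps). -/
def MorInj {α γ : Q.V → ℕ} (φ : ∀ x : Q.V, Matrix (Fin (γ x)) (Fin (α x)) ℂ) : Prop :=
  ∀ x, Function.Injective (Matrix.mulVecLin (φ x))

/-- Isomorphism of representations (possibly of different dimension vectors). -/
def RIso {α γ : Q.V → ℕ} (V : QRep Q α) (W : QRep Q γ) : Prop :=
  ∃ u : ∀ x : Q.V, ((Fin (α x) → ℂ) ≃ₗ[ℂ] (Fin (γ x) → ℂ)),
    ∀ a : Q.A, (u (Q.h a)).toLinearMap ∘ₗ (V a).mulVecLin =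
      (W a).mulVecLin ∘ₗ (u (Q.t a)).toLinearMap

/-- The space of `1`-cochains from `V` to `W`: families `φ(a) : V(ta) → W(ha)`. -/
abbrev C1sp (α γ : Q.V → ℕ) := ∀ a : Q.A, Matrix (Fin (γ (Q.h a))) (Fin (α (Q.t a))) ℂ

/-- The derivative (Leibniz rule) of a path with respect to a `1`-cochain `φ`:
`D_{a_s ⋯ a_1}(φ) = Σ_k W(a_s ⋯ a_{k+1}) φ(a_k) V(a_{k-1} ⋯ a_1)`. -/
def der {α γ : Q.V → ℕ} (V : QRep Q α) (W : QRep Q γ) (φ : C1sp (Q := Q) α γ) :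
    ∀ {x y : Q.V}, Quiver.Path x y → Matrix (Fin (γ y)) (Fin (α x)) ℂ
  | _, _, Quiver.Path.nil => 0
  | _, _, Quiver.Path.cons p e =>
      castM (congrArg γ e.2.2) (congrArg α e.2.1) (φ e.1) * evalPath V p
      + castM (congrArg γ e.2.2) (congrArg γ e.2.1) (W e.1) * der V W φ p

lemma der_add {α γ : Q.V → ℕ} (V : QRep Q α) (W : QRep Q γ) (φ ψ : C1sp (Q := Q) α γ)
    {x y : Q.V} (p : Quiver.Path x y) :
    der V W (φ + ψ) p = der V W φ p + der V W ψ p := by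
  induction p with
  | nil => simp [der]
  | cons p e ih =>
      simp only [der, ih, Pi.add_apply, castM, Matrix.submatrix_add, Matrix.add_mul,
        Matrix.mul_add]
      abel

lemma der_smul {α γ : Q.V → ℕ} (V : QRep Q α) (W : QRep Q γ) (c : ℂ) (φ : C1sp (Q := Q) α γ)
    {x y : Q.V} (p : Quiver.Path x y) :
    der V W (c • φ) p = c • der V W φ p := by
  induction p with
  | nil => simp [der]
  | cons p e ih =>
      simp only [der, ih, Pi.smul_apply, castM, Matrix.submatrix_smul, Matrix.smul_mul,
        Matrix.mul_smul, smul_add]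

lemma der_zero {α γ : Q.V → ℕ} (V : QRep Q α) (W : QRep Q γ)
    {x y : Q.V} (p : Quiver.Path x y) :
    der V W (0 : C1sp (Q := Q) α γ) p = 0 := by
  induction p with
  | nil => simp [der]
  | cons p e ih =>
      simp [der, ih, castM]

/-- The derivative of a formal linear combination of parallel paths. -/
def derRel {α γ : Q.V → ℕ} (V : QRep Q α) (W : QRep Q γ) (φ : C1sp (Q := Q) α γ)
    {x y : Q.V} (c : Quiver.Path x y →₀ ℂ) : Matrix (Fin (γ y)) (Fin (α x)) ℂ :=
  c.sum fun p k => k • der V W φ p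

/-- The space of `1`-cocycles relative to the set of relations `S`: cochains whose
derivative kills every relation in `S`. -/
def Z1 (S : Set (FormalRel Q)) {α γ : Q.V → ℕ} (V : QRep Q α) (W : QRep Q γ) :
    Submodule ℂ (C1sp (Q := Q) α γ) where
  carrier := {φ | ∀ r ∈ S, derRel V W φ r.2.2 = 0}
  add_mem' := by
    intro φ ψ hφ hψ r hr
    have : derRel V W (φ + ψ) r.2.2 = derRel V W φ r.2.2 + derRel V W ψ r.2.2 := by
      simp only [derRel, der_add, smul_add]
      exact Finsupp.sum_add
    rw [this, hφ r hr, hψ r hr, add_zero]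
  zero_mem' := by
    intro r hr
    simp [derRel, der_zero]
  smul_mem' := by
    intro c φ hφ r hr
    have : derRel V W (c • φ) r.2.2 = c • derRel V W φ r.2.2 := by
      simp only [derRel, der_smul, Finsupp.smul_sum, smul_comm c]
    rw [this, hφ r hr, smul_zero]

/-- The coboundary map `d⁰ : ∏_x Hom(V(x),W(x)) → C¹`,
`f ↦ (a ↦ f(ha) V(a) − W(a) f(ta))`. -/
def d0map {α γ : Q.V → ℕ} (V : QRep Q α) (W : QRep Q γ) :
    (∀ x : Q.V, Matrix (Fin (γ x)) (Fin (α x)) ℂ) →ₗ[ℂ] C1sp (Q := Q) α γ where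
  toFun f := fun a => f (Q.h a) * V a - W a * f (Q.t a)
  map_add' f g := by
    funext a
    simp only [Pi.add_apply, Matrix.add_mul, Matrix.mul_add]
    abel
  map_smul' c f := by
    funext a
    simp only [Pi.smul_apply, Matrix.smul_mul, Matrix.mul_smul, smul_sub, RingHom.id_apply]

/-- The space of `1`-coboundaries. -/
def B1 {α γ : Q.V → ℕ} (V : QRep Q α) (W : QRep Q γ) : Submodule ℂ (C1sp (Q := Q) α γ) :=
  LinearMap.range (d0map V W)

/-- `dim_ℂ Ext¹(V,W)` over the algebra `ℂQ/⟨S⟩`, computed as the dimension of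
`Z¹/B¹` (for modules, `B¹ ⊆ Z¹`, so this is `dim Z¹ − dim B¹`). -/
def dimExt1 (S : Set (FormalRel Q)) {α γ : Q.V → ℕ} (V : QRep Q α) (W : QRep Q γ) : ℕ :=
  Module.finrank ℂ (Z1 S V W) - Module.finrank ℂ ↥((B1 V W) ⊓ (Z1 S V W))

end HomExt
section ProjPdim

variable {Q : Quiv}

/-- `P` is a projective module over `ℂQ/⟨S⟩` (in matrix-representation form):
every morphism from `P` to the target of a surjection of modules lifts. -/
def IsProjRep (S : Set (FormalRel Q)) {γ : Q.V → ℕ} (P : QRep Q γ) : Prop :=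
  ∀ (δ ε : Q.V → ℕ) (M : QRep Q δ) (N : QRep Q ε), M ∈ modSet S δ → N ∈ modSet S ε →
    ∀ g ∈ HomS M N, MorSurj g → ∀ f ∈ HomS P N,
      ∃ h ∈ HomS P M, ∀ x, g x * h x = f x

/-- `V` has projective dimension at most one over `ℂQ/⟨S⟩`: there is a short exact
sequence `0 → P₁ → P₀ → V → 0` with `P₀, P₁` projective. -/
def PdimLE1 (S : Set (FormalRel Q)) {β : Q.V → ℕ} (V : QRep Q β) : Prop :=
  ∃ (γ₀ γ₁ : Q.V → ℕ) (P₀ : QRep Q γ₀) (P₁ : QRep Q γ₁),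
    P₀ ∈ modSet S γ₀ ∧ P₁ ∈ modSet S γ₁ ∧ IsProjRep S P₀ ∧ IsProjRep S P₁ ∧
    ∃ i ∈ HomS P₁ P₀, ∃ p ∈ HomS P₀ V, MorInj i ∧ MorSurj p ∧
      ∀ x, LinearMap.range (Matrix.mulVecLin (i x)) = LinearMap.ker (Matrix.mulVecLin (p x))

/-- The set `P_A(α) = {V ∈ mod(A,α) : pdim_A V ≤ 1}` where `A = ℂQ/⟨S⟩`. -/
def PAset (S : Set (FormalRel Q)) (α : Q.V → ℕ) : Set (QRep Q α) :=
  {V | V ∈ modSet S α ∧ PdimLE1 S V}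

end ProjPdim

section Zariski

/-- The Zariski topology on the affine space `ι → ℂ`: generated by the complements of
hypersurfaces. -/
def zarPi (ι : Type) : TopologicalSpace (ι → ℂ) :=
  TopologicalSpace.generateFrom
    {U | ∃ p : MvPolynomial ι ℂ, U = {w | MvPolynomial.eval w p ≠ 0}}

variable {Q : Quiv}

/-- The Zariski topology on `rep(Q,β)`. -/
def zarTop (β : Q.V → ℕ) : TopologicalSpace (QRep Q β) :=
  TopologicalSpace.induced (repCoords (β := β)) (zarPi _)

/-- Zariski closure in `rep(Q,β)`. -/
def zclosure {β : Q.V → ℕ} (s : Set (QRep Q β)) : Set (QRep Q β) :=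
  @closure _ (zarTop β) s

/-- Zariski-open. -/
def zIsOpen {β : Q.V → ℕ} (s : Set (QRep Q β)) : Prop := @IsOpen _ (zarTop β) s

/-- Zariski-closed. -/
def zIsClosed {β : Q.V → ℕ} (s : Set (QRep Q β)) : Prop := @IsClosed _ (zarTop β) s

/-- Irreducibility in the Zariski topology. -/
def zIrred {β : Q.V → ℕ} (s : Set (QRep Q β)) : Prop := @IsIrreducible _ (zarTop β) s

/-- Dimension of a subset of `rep(Q,β)`: the topological Krull dimension in the
(subspace) Zariski topology. -/
def zdim {β : Q.V → ℕ} (s : Set (QRep Q β)) : WithBot ℕ∞ :=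
  @topologicalKrullDim s (TopologicalSpace.induced Subtype.val (zarTop β))

/-- `C(α)`: the closure of `P_A(α)`. -/
def Cset (S : Set (FormalRel Q)) (α : Q.V → ℕ) : Set (QRep Q α) := zclosure (PAset S α)

/-- `C` is an irreducible component of `M` (for `M` closed in `rep(Q,α)`): a maximal
irreducible closed subset of `M`. -/
def IsIrrCompOf {β : Q.V → ℕ} (C M : Set (QRep Q β)) : Prop :=
  zIrred C ∧ zIsClosed C ∧ C ⊆ M ∧
    ∀ C' : Set (QRep Q β), zIrred C' → zIsClosed C' → C' ⊆ M → C ⊆ C' → C' = C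

/-- `V` is an indecomposable representation: it is nonzero and its endomorphism algebra
has no idempotents other than `0` and `1`. -/
def IsIndecRep {α : Q.V → ℕ} (V : QRep Q α) : Prop :=
  (∃ x, α x ≠ 0) ∧
  ∀ φ ∈ HomS V V, (∀ x, φ x * φ x = φ x) → φ = 0 ∨ φ = fun x => (1 : Matrix _ _ ℂ)

/-- `C` is an indecomposable irreducible component of `M`: an irreducible component
containing a dense open subset of indecomposable representations. -/
def IsIndecComp {β : Q.V → ℕ} (C M : Set (QRep Q β)) : Prop :=
  IsIrrCompOf C M ∧
  ∃ U : Set (QRep Q β), zIsOpen U ∧ C ⊆ zclosure (C ∩ U) ∧ ∀ V ∈ C ∩ U, IsIndecRep V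

/-- The `GL(α)`-orbit of `V`. -/
def orbitOf {α : Q.V → ℕ} (V : QRep Q α) : Set (QRep Q α) := {W | ∃ g : GLb α, gAct g V = W}

/-- `C` is an orbit closure `closure(GL(α)·V)` of some module `V ∈ mod(A,α)`. -/
def IsOrbitClosure (S : Set (FormalRel Q)) {α : Q.V → ℕ} (C : Set (QRep Q α)) : Prop :=
  ∃ V ∈ modSet S α, C = zclosure (orbitOf V)

/-- The coordinates on `∏_x ℂ^{α(x) × α(x)}`, the ambient space of `GL(α)`. -/
def glCoords {α : Q.V → ℕ} (g : ∀ x : Q.V, Matrix (Fin (α x)) (Fin (α x)) ℂ) :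
    (Σ x : Q.V, Fin (α x) × Fin (α x)) → ℂ := fun c => g c.1 c.2.1 c.2.2

/-- The Zariski topology on `∏_x ℂ^{α(x) × α(x)}`. -/
def glTop (Q : Quiv) (α : Q.V → ℕ) :
    TopologicalSpace (∀ x : Q.V, Matrix (Fin (α x)) (Fin (α x)) ℂ) :=
  TopologicalSpace.induced glCoords (zarPi _)

/-- `GL(α)` as a (quasi-affine) subset of `∏_x ℂ^{α(x) × α(x)}`. -/
def glSet (Q : Quiv) (α : Q.V → ℕ) : Set (∀ x : Q.V, Matrix (Fin (α x)) (Fin (α x)) ℂ) :=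
  {g | ∀ x, IsUnit (g x)}

/-- The dimension of the group variety `GL(α)`. -/
def glDim (Q : Quiv) (α : Q.V → ℕ) : WithBot ℕ∞ :=
  @topologicalKrullDim (glSet Q α) (TopologicalSpace.induced Subtype.val (glTop Q α))

end Zariski
section Sums

variable {Q : Quiv}

/-- `W` is a direct sum of the representations `V i` (up to isomorphism of the underlying
block-diagonal structure). -/
def IsSumOf {ι : Type} [Fintype ι] [DecidableEq ι] {αs : ι → Q.V → ℕ} {δ : Q.V → ℕ}
    (W : QRep Q δ) (V : ∀ i, QRep Q (αs i)) : Prop :=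
  ∃ u : ∀ x : Q.V, ((Fin (δ x) → ℂ) ≃ₗ[ℂ] ((Σ i, Fin (αs i x)) → ℂ)),
    ∀ a : Q.A, (u (Q.h a)).toLinearMap ∘ₗ (W a).mulVecLin =
      (Matrix.blockDiagonal' (fun i => V i a)).mulVecLin ∘ₗ (u (Q.t a)).toLinearMap

/-- The constructible subset `C₁ ⊕ ⋯ ⊕ C_l ⊆ rep(Q,δ)`: representations isomorphic to a
direct sum `V₁ ⊕ ⋯ ⊕ V_l` with `V_i ∈ C_i`. -/
def sumSet {ι : Type} [Fintype ι] [DecidableEq ι] (αs : ι → Q.V → ℕ)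
    (Cs : ∀ i, Set (QRep Q (αs i))) (δ : Q.V → ℕ) : Set (QRep Q δ) :=
  {W | ∃ V : ∀ i, QRep Q (αs i), (∀ i, V i ∈ Cs i) ∧ IsSumOf W V}

/-- The generic `Ext¹` between two subsets:
`ext¹(C,D) = min {dim Ext¹(X,Y) : (X,Y) ∈ C × D}`. -/
def genExt1 (S : Set (FormalRel Q)) {α α' : Q.V → ℕ}
    (C : Set (QRep Q α)) (D : Set (QRep Q α')) : ℕ :=
  sInf {n : ℕ | ∃ X ∈ C, ∃ Y ∈ D, n = dimExt1 S X Y}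

end Sums

section ExtHigher

variable {Q : Quiv}

/-- A representation of `Q` packaged with its dimension vector. -/
def PRp (Q : Quiv) := Σ γ : Q.V → ℕ, QRep Q γ

instance : Inhabited (PRp Q) := ⟨⟨fun _ => 0, fun _ => 0⟩⟩

/-- `K` is a (first) syzygy of `M` over `ℂQ/⟨S⟩`: there is a short exact sequence
`0 → K → P → M → 0` with `P` a projective module. -/
def IsSyzOf (S : Set (FormalRel Q)) (K M : PRp Q) : Prop :=
  K.2 ∈ modSet S K.1 ∧ ∃ (γP : Q.V → ℕ) (P : QRep Q γP), P ∈ modSet S γP ∧ IsProjRep S P ∧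
    ∃ i ∈ HomS K.2 P, ∃ p ∈ HomS P M.2, MorInj i ∧ MorSurj p ∧
      ∀ x, LinearMap.range (Matrix.mulVecLin (i x)) = LinearMap.ker (Matrix.mulVecLin (p x))

/-- A chosen syzygy of `M` over `ℂQ/⟨S⟩`. -/
def syz (S : Set (FormalRel Q)) (M : PRp Q) : PRp Q :=
  Classical.epsilon (fun K => IsSyzOf S K M)

/-- `dim_ℂ Ext^l (M,N)` over `ℂQ/⟨S⟩`, via dimension shifting along syzygies:
`Ext⁰ = Hom`, `Ext¹` is computed by cochains, and `Ext^{l+2}(M,N) = Ext^{l+1}(ΩM,N)`. -/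
def dimExtN (S : Set (FormalRel Q)) : ℕ → PRp Q → PRp Q → ℕ
  | 0, M, N => dimHom M.2 N.2
  | 1, M, N => dimExt1 S M.2 N.2
  | (l+2), M, N => dimExtN S (l+1) (syz S M) N

/-- The simple representation `S_x` concentrated at the vertex `x`. -/
def simplePR (Q : Quiv) (x0 : Q.V) : PRp Q :=
  ⟨fun z => if z = x0 then 1 else 0, fun _ => 0⟩

/-- The Euler form pairing `⟨α, dim S_y⟩_B` of the algebra `B = ℂQ/⟨S⟩`:
`Σ_{l ≥ 0} (−1)^l Σ_x dim Ext^l_B(S_x,S_y) · α(x)`.  The weight `⟨α,−⟩_B` is the function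
`y ↦ eulerPair S α y`. -/
def eulerPair (S : Set (FormalRel Q)) (α : Q.V → ℕ) (y : Q.V) : ℤ :=
  ∑ᶠ l : ℕ, (-1 : ℤ)^l *
    ∑ x : Q.V, (α x : ℤ) * (dimExtN S l (simplePR Q x) (simplePR Q y) : ℤ)

/-- The set of relations annihilating `W`: the annihilator `Ann_{ℂQ}(W)`, so that
`B = ℂQ/Ann_{ℂQ}(W)`. -/
def annRel {β : Q.V → ℕ} (W : QRep Q β) : Set (FormalRel Q) :=
  {r | evalLin W r.2.2 = 0}

/-- The weight semigroup `L_W` of `W`: weights `σ` with `σ|_{supp β} = ⟨α,−⟩_B` for some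
dimension vector `α ∈ ℕ^{supp β}` with `P_B(α) ≠ ∅`, where `B = ℂQ/Ann_{ℂQ}(W)`. -/
def weightSgrp {β : Q.V → ℕ} (W : QRep Q β) : Set (Q.V → ℤ) :=
  {σ | ∃ α : Q.V → ℕ, (∀ x, β x = 0 → α x = 0) ∧ (PAset (annRel W) α).Nonempty ∧
    ∀ y, β y ≠ 0 → σ y = eulerPair (annRel W) α y}

end ExtHigher

section Tame

variable {Q : Quiv}

/-- Specialization of a representation over `ℂ[x]` at `λ ∈ ℂ`, i.e.
`M ⊗_{ℂ[x]} ℂ[x]/(x−λ)`. -/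
def polyEvalAt {γ : Q.V → ℕ} (M : RepR Q (Polynomial ℂ) γ) (lam : ℂ) : QRep Q γ :=
  fun a => (M a).map (fun p => Polynomial.eval lam p)

/-- The algebra `A = ℂQ/⟨S⟩` is tame: for every dimension `d` there are finitely many
`A`–`ℂ[x]`-bimodules `M₁,…,M_s`, free of finite rank over `ℂ[x]` (i.e. matrix
representations over `ℂ[x]` satisfying the relations), such that all but finitely many
isomorphism classes of `d`-dimensional indecomposable `A`-modules are of the form
`M_i ⊗_{ℂ[x]} ℂ[x]/(x−λ)`. -/
def IsTame (S : Set (FormalRel Q)) : Prop :=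
  ∀ d : ℕ, ∃ (s : ℕ) (γs : Fin s → (Q.V → ℕ)) (M : ∀ i, RepR Q (Polynomial ℂ) (γs i)),
    (∀ i, ∀ r ∈ S, evalLinP (M i) r.2.2 = 0) ∧
    ∃ (t : ℕ) (βs : Fin t → (Q.V → ℕ)) (E : ∀ k, QRep Q (βs k)),
      ∀ (α : Q.V → ℕ) (V : QRep Q α), V ∈ modSet S α → (∑ x, α x) = d → IsIndecRep V →
        (∃ k, RIso (E k) V) ∨ (∃ i lam, RIso (polyEvalAt (M i) lam) V)

end Tame

section Stability

variable {Q : Quiv}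

/-- `U` is a subrepresentation of `V` (a family of subspaces preserved by the structure
maps). -/
def SubRep {α : Q.V → ℕ} (V : QRep Q α) (U : ∀ x : Q.V, Submodule ℂ (Fin (α x) → ℂ)) : Prop :=
  ∀ a : Q.A, (U (Q.t a)).map (Matrix.mulVecLin (V a)) ≤ U (Q.h a)

/-- `V` is `θ`-stable: `V ≠ 0`, `θ · dim V = 0`, and `θ · dim V' < 0` for every proper
nonzero subrepresentation `V'` of `V`. -/
def ThetaStable {α : Q.V → ℕ} (θ : Q.V → ℤ) (V : QRep Q α) : Prop :=
  (∃ x, α x ≠ 0) ∧ (∑ x, θ x * (α x : ℤ)) = 0 ∧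
  ∀ U : ∀ x : Q.V, Submodule ℂ (Fin (α x) → ℂ), SubRep V U →
    (∃ x, U x ≠ ⊥) → (∃ x, U x ≠ ⊤) →
      (∑ x, θ x * (Module.finrank ℂ (U x) : ℤ)) < 0

/-- The morphism with components `f` from `P` is essential onto its image: any
subrepresentation of `P` mapping onto the image of `f` is all of `P`. -/
def IsEssentialTo {γ δ : Q.V → ℕ} (P : QRep Q γ)
    (f : ∀ x : Q.V, Matrix (Fin (δ x)) (Fin (γ x)) ℂ) : Prop :=
  ∀ U : ∀ x : Q.V, Submodule ℂ (Fin (γ x) → ℂ), SubRep P U →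
    (∀ x, (U x).map (Matrix.mulVecLin (f x)) = LinearMap.range (Matrix.mulVecLin (f x))) →
      ∀ x, U x = ⊤

end Stability

section Ideal

variable {Q : Quiv}

/-- The `(x,y)`-component of the two-sided ideal `⟨S⟩` of `ℂQ` generated by the
relations in `S`: the span of the translates `q·r·p` of relations `r ∈ S` by paths. -/
def idealComp (S : Set (FormalRel Q)) (x y : Q.V) : Submodule ℂ (Quiver.Path x y →₀ ℂ) :=
  Submodule.span ℂ {c | ∃ r ∈ S, ∃ (p : Quiver.Path x r.1) (q : Quiver.Path r.2.1 y),
    c = Finsupp.mapDomain (fun s => (p.comp s).comp q) r.2.2}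

/-- `W` is a faithful module over `A = ℂQ/⟨S⟩`: every element of `ℂQ` annihilating `W`
lies in the ideal `⟨S⟩`. -/
def FaithfulOver (S : Set (FormalRel Q)) {β : Q.V → ℕ} (W : QRep Q β) : Prop :=
  ∀ (x y : Q.V) (c : Quiver.Path x y →₀ ℂ), evalLin W c = 0 → c ∈ idealComp S x y

end Ideal
section Precomp

variable {Q : Quiv}

/-- Precomposition with a morphism `f : L → M` of representations, as a linear map
`Hom(M,N) → Hom(L,N)`, `φ ↦ φ ∘ f`. -/
def precompMap {γ₁ γ₀ δ : Q.V → ℕ} (L : QRep Q γ₁) (M : QRep Q γ₀) (N : QRep Q δ)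
    (f : ∀ x : Q.V, Matrix (Fin (γ₀ x)) (Fin (γ₁ x)) ℂ) (hf : f ∈ HomS L M) :
    (HomS M N) →ₗ[ℂ] (HomS L N) where
  toFun φ := ⟨fun x => φ.1 x * f x, by
    intro a
    have h1 : φ.1 (Q.h a) * M a = N a * φ.1 (Q.t a) := φ.2 a
    have h2 : f (Q.h a) * L a = M a * f (Q.t a) := hf a
    calc (φ.1 (Q.h a) * f (Q.h a)) * L a
        = φ.1 (Q.h a) * (f (Q.h a) * L a) := by rw [Matrix.mul_assoc]
      _ = φ.1 (Q.h a) * (M a * f (Q.t a)) := by rw [h2]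
      _ = (φ.1 (Q.h a) * M a) * f (Q.t a) := by rw [Matrix.mul_assoc]
      _ = (N a * φ.1 (Q.t a)) * f (Q.t a) := by rw [h1]
      _ = N a * (φ.1 (Q.t a) * f (Q.t a)) := by rw [Matrix.mul_assoc]⟩
  map_add' φ ψ := by
    apply Subtype.ext
    funext x
    simp [Matrix.add_mul]
  map_smul' c φ := by
    apply Subtype.ext
    funext x
    simp [Matrix.smul_mul]

end Precomp

section BipartiteQsig

variable (Q : Quiv) (β : Q.V → ℕ) (σ : Q.V → ℤ)

/-- The bipartite quiver `Q^σ`: its vertices are the vertices of `Q` where `σ` is positive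
together with those where `σ` is negative, and it has one arrow `a_p : v_i → w_j` for every
oriented path `p` in `Q` from `v_i` to `w_j`. -/
def Qsig : Quiv where
  V := PosV Q σ ⊕ NegV Q σ
  A := Σ (i : PosV Q σ) (j : NegV Q σ), Quiver.Path i.1 j.1
  t := fun a => Sum.inl a.1
  h := fun a => Sum.inr a.2.1
  fV := inferInstance
  dV := inferInstance

/-- The dimension vector `β` restricted to `Q^σ`. -/
def betaSig : (Qsig Q σ).V → ℕ := Sum.elim (fun i => β i.1) (fun j => β j.1)

/-- The weight `σ` restricted to `Q^σ`. -/
def sigSig : (Qsig Q σ).V → ℤ := Sum.elim (fun i => σ i.1) (fun j => σ j.1)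

/-- The morphism `φ : rep(Q,β) → rep(Q^σ,β)` given by `φ(W)(a_p) = W(p)`. -/
def phiSig (W : QRep Q β) : QRep (Qsig Q σ) (betaSig Q β σ) :=
  fun a => evalPath W a.2.2

end BipartiteQsig

namespace GenDec

/-- A coordinate-free representation of the quiver `Q` over `ℂ`. -/
structure LRep (Q : Quiv) where
  X : Q.V → Type
  [ac : ∀ x, AddCommGroup (X x)]
  [md : ∀ x, Module ℂ (X x)]
  ρ : ∀ {x y : Q.V}, (x ⟶ y) → (X x →ₗ[ℂ] X y)

attribute [instance] LRep.ac LRep.md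

/-- The action of a path on a representation. -/
def ev (M : LRep Q) : ∀ {x y : Q.V}, Quiver.Path x y → (M.X x →ₗ[ℂ] M.X y)
  | _, _, Quiver.Path.nil => LinearMap.id
  | _, _, Quiver.Path.cons p e => M.ρ e ∘ₗ ev M p

/-- The action of a linear combination of parallel paths. -/
def evL (M : LRep Q) {x y : Q.V} : (Quiver.Path x y →₀ ℂ) →ₗ[ℂ] (M.X x →ₗ[ℂ] M.X y) :=
  Finsupp.linearCombination ℂ (fun p => ev M p)

/-- `M` satisfies the relations in `S`. -/
def IsMod (S : Set (FormalRel Q)) (M : LRep Q) : Prop := ∀ r ∈ S, evL M r.2.2 = 0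

/-- Morphisms of representations. -/
def IsHom (M N : LRep Q) (φ : ∀ x, M.X x →ₗ[ℂ] N.X x) : Prop :=
  ∀ ⦃x y : Q.V⦄ (e : x ⟶ y) (m : M.X x), φ y (M.ρ e m) = N.ρ e (φ x m)

@[simp] lemma ev_nil (M : LRep Q) (x : Q.V) (m : M.X x) :
    ev M (Quiver.Path.nil : Quiver.Path x x) m = m := by rw [ev]; rfl

@[simp] lemma ev_cons (M : LRep Q) {x y z : Q.V} (p : Quiver.Path x y) (e : y ⟶ z)
    (m : M.X x) : ev M (p.cons e) m = M.ρ e (ev M p m) := by rw [ev]; rfl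

lemma ev_comp (M : LRep Q) {x y z : Q.V} (p : Quiver.Path x y) (q : Quiver.Path y z)
    (m : M.X x) : ev M (p.comp q) m = ev M q (ev M p m) := by
  induction q with
  | nil => simp
  | cons q e ih => simp [ih]

@[simp] lemma evL_single (M : LRep Q) {x y : Q.V} (p : Quiver.Path x y) (k : ℂ) :
    evL M (Finsupp.single p k) = k • ev M p := by
  simp [evL]

lemma IsHom.ev {M N : LRep Q} {φ : ∀ x, M.X x →ₗ[ℂ] N.X x} (h : IsHom M N φ) {x y : Q.V}
    (p : Quiver.Path x y) (m : M.X x) : φ y (ev M p m) = GenDec.ev N p (φ x m) := by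
  induction p with
  | nil => simp
  | cons p e ih => simp [h e, ih]

lemma IsHom.evL {M N : LRep Q} {φ : ∀ x, M.X x →ₗ[ℂ] N.X x} (h : IsHom M N φ) {x y : Q.V}
    (c : Quiver.Path x y →₀ ℂ) (m : M.X x) :
    φ y (evL M c m) = GenDec.evL N c (φ x m) := by
  induction c using Finsupp.induction_linear with
  | zero => simp
  | add a b ha hb => simp [ha, hb]
  | single p k => simp [h.ev]

lemma IsHom.id (M : LRep Q) : IsHom M M (fun _ => LinearMap.id) := fun _ _ _ _ => rfl

lemma IsHom.comp {M N L : LRep Q} {φ : ∀ x, M.X x →ₗ[ℂ] N.X x} {ψ : ∀ x, N.X x →ₗ[ℂ] L.X x}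
    (hψ : IsHom N L ψ) (hφ : IsHom M N φ) : IsHom M L (fun x => ψ x ∘ₗ φ x) := by
  intro x y e m
  simp [hφ e, hψ e]

lemma IsHom.symm {M N : LRep Q} {φ : ∀ x, M.X x ≃ₗ[ℂ] N.X x}
    (h : IsHom M N (fun x => (φ x).toLinearMap)) :
    IsHom N M (fun x => (φ x).symm.toLinearMap) := by
  intro x y e m
  apply (φ y).injective
  have := h e ((φ x).symm m)
  simp at this
  simp [this]

lemma evL_mapDomain_comp (M : LRep Q) {x y z w : Q.V} (p : Quiver.Path x y)
    (q : Quiver.Path z w) (c : Quiver.Path y z →₀ ℂ) (m : M.X x) :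
    evL M (Finsupp.mapDomain (fun s => (p.comp s).comp q) c) m =
      ev M q (evL M c (ev M p m)) := by
  induction c using Finsupp.induction_linear with
  | zero => simp
  | add a b ha hb => rw [Finsupp.mapDomain_add, map_add, map_add, LinearMap.add_apply, ha, hb]; simp
  | single s k => simp [Finsupp.mapDomain_single, ev_comp]

lemma evL_ideal {S : Set (FormalRel Q)} {M : LRep Q} (hM : IsMod S M) {x y : Q.V}
    {c : Quiver.Path x y →₀ ℂ} (hc : c ∈ idealComp S x y) : evL M c = 0 := by
  unfold idealComp at hc
  induction hc using Submodule.span_induction with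
  | mem c h =>
    obtain ⟨r, hr, p, q, rfl⟩ := h
    ext m
    rw [evL_mapDomain_comp, hM r hr]
    simp
  | zero => simp
  | add a b _ _ ha hb => simp [ha, hb]
  | smul k a _ ha => simp [ha]

/-- The coordinate-free representation attached to a matrix representation. -/
@[reducible] def ofQ {β : Q.V → ℕ} (W : QRep Q β) : LRep Q where
  X x := Fin (β x) → ℂ
  ρ e := (castM (congrArg β e.2.2) (congrArg β e.2.1) (W e.1)).mulVecLin

lemma ev_ofQ {β : Q.V → ℕ} (W : QRep Q β) {x y : Q.V} (p : Quiver.Path x y) :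
    ev (ofQ W) p = (evalPath W p).mulVecLin := by
  induction p with
  | nil => ext; simp [ev, evalPath]
  | cons p e ih => simp [ev, evalPath, ih, Matrix.mulVecLin_mul]

lemma evL_ofQ {β : Q.V → ℕ} (W : QRep Q β) {x y : Q.V} (c : Quiver.Path x y →₀ ℂ) :
    evL (ofQ W) c = (evalLin W c).mulVecLin := by
  have hadd (a b : Quiver.Path x y →₀ ℂ) : evalLin W (a + b) = evalLin W a + evalLin W b :=
    Finsupp.sum_add_index' (by simp) (by intros; simp [add_smul])
  induction c using Finsupp.induction_linear with
  | zero => simp [evalLin]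
  | add a b ha hb => rw [map_add, ha, hb, hadd, Matrix.mulVecLin_add]
  | single p k =>
    rw [evL_single, ev_ofQ]
    ext
    simp [evalLin]

lemma isMod_ofQ {S : Set (FormalRel Q)} {β : Q.V → ℕ} (W : QRep Q β) :
    IsMod S (ofQ W) ↔ W ∈ modSet S β := by
  refine forall₂_congr fun r _ => ?_
  rw [evL_ofQ]
  constructor
  · intro h
    have := congrArg LinearMap.toMatrix' h
    simpa [← Matrix.toLin'_apply'] using this
  · intro h
    simp [h]

lemma isHom_ofQ_iff {β γ : Q.V → ℕ} (V : QRep Q β) (W : QRep Q γ)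
    (φ : ∀ x, (Fin (β x) → ℂ) →ₗ[ℂ] (Fin (γ x) → ℂ)) :
    IsHom (ofQ V) (ofQ W) φ ↔
      ∀ a : Q.A, φ (Q.h a) ∘ₗ (V a).mulVecLin = (W a).mulVecLin ∘ₗ φ (Q.t a) := by
  constructor
  · intro h a
    ext1 v
    exact LinearMap.ext fun m => h (x := Q.t a) (y := Q.h a) ⟨a, rfl, rfl⟩ _
  · rintro h x y ⟨a, rfl, rfl⟩ m
    exact LinearMap.congr_fun (h a) m

lemma mem_HomS_iff {β γ : Q.V → ℕ} (V : QRep Q β) (W : QRep Q γ)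
    (φ : ∀ x, Matrix (Fin (γ x)) (Fin (β x)) ℂ) :
    φ ∈ HomS V W ↔ IsHom (ofQ V) (ofQ W) (fun x => (φ x).mulVecLin) := by
  rw [isHom_ofQ_iff]
  refine forall_congr' fun a => ?_
  rw [← Matrix.mulVecLin_mul, ← Matrix.mulVecLin_mul]
  constructor
  · intro h; rw [h]
  · intro h
    have := congrArg LinearMap.toMatrix' h
    simpa only [← Matrix.toLin'_apply', LinearMap.toMatrix'_comp,
      LinearMap.toMatrix'_toLin'] using this

lemma toMatrix'_mem_HomS {β γ : Q.V → ℕ} {V : QRep Q β} {W : QRep Q γ}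
    {φ : ∀ x, (Fin (β x) → ℂ) →ₗ[ℂ] (Fin (γ x) → ℂ)} (h : IsHom (ofQ V) (ofQ W) φ) :
    (fun x => LinearMap.toMatrix' (φ x)) ∈ HomS V W := by
  rw [mem_HomS_iff]
  have h' : (fun x => (LinearMap.toMatrix' (φ x)).mulVecLin) = φ := by
    funext x
    rw [← Matrix.toLin'_apply', Matrix.toLin'_toMatrix']
  rw [h']
  exact h

/-- The matrix representation obtained from linear coordinates on a representation. -/
def toQ (M : LRep Q) {β : Q.V → ℕ} (c : ∀ x, M.X x ≃ₗ[ℂ] (Fin (β x) → ℂ)) : QRep Q β :=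
  fun a => LinearMap.toMatrix' ((c (Q.h a)).toLinearMap ∘ₗ
    M.ρ (x := Q.t a) (y := Q.h a) ⟨a, rfl, rfl⟩ ∘ₗ (c (Q.t a)).symm.toLinearMap)

lemma toQ_hom (M : LRep Q) {β : Q.V → ℕ} (c : ∀ x, M.X x ≃ₗ[ℂ] (Fin (β x) → ℂ)) :
    IsHom M (ofQ (toQ M c)) (fun x => (c x).toLinearMap) := by
  rintro x y ⟨a, rfl, rfl⟩ m
  change _ = (toQ M c a).mulVecLin _
  simp [toQ, ← Matrix.toLin'_apply']

lemma isMod_of_injective {S : Set (FormalRel Q)} {M N : LRep Q}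
    {φ : ∀ x, M.X x →ₗ[ℂ] N.X x} (h : IsHom M N φ) (hφ : ∀ x, Function.Injective (φ x))
    (hN : IsMod S N) : IsMod S M := by
  intro r hr
  ext m
  apply hφ
  rw [h.evL, hN r hr]
  simp

lemma isMod_of_surjective {S : Set (FormalRel Q)} {M N : LRep Q}
    {φ : ∀ x, M.X x →ₗ[ℂ] N.X x} (h : IsHom M N φ) (hφ : ∀ x, Function.Surjective (φ x))
    (hM : IsMod S M) : IsMod S N := by
  intro r hr
  ext m
  obtain ⟨m, rfl⟩ := hφ _ m
  rw [← h.evL, hM r hr]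
  simp

/-! ### Finiteness of the set of paths -/

section Paths

/-- There is a nontrivial path from `x` to `y`. -/
def Below (x y : Q.V) : Prop := ∃ p : Quiver.Path x y, 0 < p.length

lemma below_of_arrow {x y : Q.V} (e : x ⟶ y) : Below x y :=
  ⟨e.toPath, by simp [Quiver.Hom.toPath]⟩

lemma below_wf [hac : Fact (QAcyclic Q)] : WellFounded (Below (Q := Q)) := by
  have : IsTrans Q.V Below := ⟨fun x y z ⟨p, hp⟩ ⟨q, _⟩ => ⟨p.comp q, by simp; omega⟩⟩
  have : Std.Irrefl (Below (Q := Q)) := ⟨fun x ⟨p, hp⟩ => by simp [hac.out x p] at hp⟩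
  exact Finite.wellFounded_of_trans_of_irrefl _

instance finite_path [Fintype Q.A] [hac : Fact (QAcyclic Q)] (x y : Q.V) :
    Finite (Quiver.Path x y) := by
  refine below_wf.induction (C := fun y => Finite (Quiver.Path x y)) y fun y ih => ?_
  have : ∀ e : {a : Q.A // Q.h a = y}, Finite (Quiver.Path x (Q.t e.1)) :=
    fun e => ih _ (below_of_arrow ⟨e.1, rfl, e.2⟩)
  let F : Option (PLift (x = y)) ⊕
      (Σ e : {a : Q.A // Q.h a = y}, Quiver.Path x (Q.t e.1)) → Option (Quiver.Path x y) :=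
    Sum.elim
      (fun o => o.map (fun h => by cases h with | up h => exact h ▸ Quiver.Path.nil))
      (fun s => some (s.2.cons ⟨s.1.1, rfl, s.1.2⟩))
  have hF : ∀ p : Quiver.Path x y, ∃ s, F s = some p := by
    intro p
    cases p with
    | nil => exact ⟨Sum.inl (some ⟨rfl⟩), rfl⟩
    | cons p e =>
      obtain ⟨a, rfl, rfl⟩ := e
      exact ⟨Sum.inr ⟨⟨a, rfl⟩, p⟩, rfl⟩
  choose s hs using hF
  exact Finite.of_injective s fun p q h => by
    have := hs p; rw [h, hs q] at this; exact (Option.some.inj this).symm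

end Paths

/-! ### The bound quiver algebra in coordinates, and its projective modules -/

section PathAlgebra

variable [Fintype Q.A] [hac : Fact (QAcyclic Q)] (S : Set (FormalRel Q))

/-- The dimension of `e_y A e_x`. -/
def dA (x y : Q.V) : ℕ := Module.finrank ℂ ((Quiver.Path x y →₀ ℂ) ⧸ idealComp S x y)

/-- Coordinates on `e_y A e_x`. -/
def quotEquiv (x y : Q.V) :
    ((Quiver.Path x y →₀ ℂ) ⧸ idealComp S x y) ≃ₗ[ℂ] (Fin (dA S x y) → ℂ) :=
  (Module.finBasis ℂ ((Quiver.Path x y →₀ ℂ) ⧸ idealComp S x y)).equivFun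

/-- The class of a combination of paths in `e_y A e_x`, in coordinates. -/
def cls (x y : Q.V) : (Quiver.Path x y →₀ ℂ) →ₗ[ℂ] (Fin (dA S x y) → ℂ) :=
  (quotEquiv S x y).toLinearMap ∘ₗ (idealComp S x y).mkQ

lemma cls_surj (x y : Q.V) : Function.Surjective (cls S x y) :=
  (quotEquiv S x y).surjective.comp (Submodule.mkQ_surjective (idealComp S x y))

lemma cls_eq_zero {x y : Q.V} {c : Quiver.Path x y →₀ ℂ} :
    cls S x y c = 0 ↔ c ∈ idealComp S x y := by
  rw [cls, LinearMap.comp_apply, LinearEquiv.coe_coe, LinearEquiv.map_eq_zero_iff,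
    Submodule.mkQ_apply, Submodule.Quotient.mk_eq_zero]

/-- A linear section of `cls`. -/
def sec (x y : Q.V) : (Fin (dA S x y) → ℂ) →ₗ[ℂ] (Quiver.Path x y →₀ ℂ) :=
  (LinearMap.exists_rightInverse_of_surjective (cls S x y)
    (LinearMap.range_eq_top.2 (cls_surj S x y))).choose

@[simp] lemma cls_sec {x y : Q.V} (a : Fin (dA S x y) → ℂ) : cls S x y (sec S x y a) = a :=
  LinearMap.congr_fun (LinearMap.exists_rightInverse_of_surjective (cls S x y)
    (LinearMap.range_eq_top.2 (cls_surj S x y))).choose_spec a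

/-- The action of `e_y A e_x` on a representation. -/
def act (M : LRep Q) {x y : Q.V} : (Fin (dA S x y) → ℂ) →ₗ[ℂ] (M.X x →ₗ[ℂ] M.X y) :=
  evL M ∘ₗ sec S x y

variable {S}

lemma act_cls {M : LRep Q} (hM : IsMod S M) {x y : Q.V} (c : Quiver.Path x y →₀ ℂ) :
    act S M (cls S x y c) = evL M c := by
  have : sec S x y (cls S x y c) - c ∈ idealComp S x y := by
    rw [← cls_eq_zero]; simp
  have h := evL_ideal hM this
  rw [map_sub, sub_eq_zero] at h
  exact h

lemma IsHom.act {M N : LRep Q} {φ : ∀ x, M.X x →ₗ[ℂ] N.X x} (h : IsHom M N φ) {x y : Q.V}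
    (c : Fin (dA S x y) → ℂ) (m : M.X x) :
    φ y (act S M c m) = GenDec.act S N c (φ x m) := h.evL _ _

variable (S)

/-- Left multiplication by an arrow on `A e_x`. -/
def mulA (x : Q.V) {y z : Q.V} (e : y ⟶ z) : (Fin (dA S x y) → ℂ) →ₗ[ℂ] (Fin (dA S x z) → ℂ) :=
  cls S x z ∘ₗ Finsupp.lmapDomain ℂ ℂ (fun p => p.cons e) ∘ₗ sec S x y

variable {S}

lemma mapDomain_cons_mem {x y z : Q.V} (e : y ⟶ z) {c : Quiver.Path x y →₀ ℂ}
    (hc : c ∈ idealComp S x y) :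
    Finsupp.mapDomain (fun p => p.cons e) c ∈ idealComp S x z := by
  change Finsupp.lmapDomain ℂ ℂ (fun p => p.cons e) c ∈ _
  unfold idealComp at hc
  induction hc using Submodule.span_induction with
  | mem c h =>
    obtain ⟨r, hr, p, q, rfl⟩ := h
    refine Submodule.subset_span ⟨r, hr, p, q.cons e, ?_⟩
    simp only [Finsupp.lmapDomain_apply]
    rw [← Finsupp.mapDomain_comp]
    rfl
  | zero => simp
  | add a b _ _ ha hb => rw [map_add]; exact add_mem ha hb
  | smul k a _ ha => rw [map_smul]; exact Submodule.smul_mem _ _ ha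

lemma mulA_cls {x y z : Q.V} (e : y ⟶ z) (c : Quiver.Path x y →₀ ℂ) :
    mulA S x e (cls S x y c) = cls S x z (Finsupp.mapDomain (fun p => p.cons e) c) := by
  have : sec S x y (cls S x y c) - c ∈ idealComp S x y := by
    rw [← cls_eq_zero]; simp
  have h := (cls_eq_zero S).2 (mapDomain_cons_mem e this)
  change cls S x z (Finsupp.lmapDomain ℂ ℂ _ _) = 0 at h
  rw [map_sub, map_sub, sub_eq_zero] at h
  exact h

lemma act_mulA {M : LRep Q} (hM : IsMod S M) {x y z : Q.V} (e : y ⟶ z)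
    (a : Fin (dA S x y) → ℂ) (m : M.X x) :
    act S M (mulA S x e a) m = M.ρ e (act S M a m) := by
  obtain ⟨c, rfl⟩ := cls_surj S x y a
  rw [mulA_cls, act_cls hM, act_cls hM]
  induction c using Finsupp.induction_linear with
  | zero => simp
  | add a b ha hb => simp [Finsupp.mapDomain_add, ha, hb]
  | single s k => simp [Finsupp.mapDomain_single]

variable (S)

/-- The components of the projective module with `γ x` generators at `x`. -/
abbrev PX (γ : Q.V → ℕ) (y : Q.V) : Type := ∀ x, Fin (γ x) → Fin (dA S x y) → ℂ

/-- The projective module `⊕_x (A e_x)^{γ x}`. -/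
@[reducible] def P (γ : Q.V → ℕ) : LRep Q where
  X y := PX S γ y
  ρ e := LinearMap.pi fun x => LinearMap.pi fun k =>
    mulA S x e ∘ₗ LinearMap.proj (φ := fun _ : Fin (γ x) => _) k ∘ₗ LinearMap.proj x

/-- The trivial path in `A e_x`. -/
def gA (x : Q.V) : Fin (dA S x x) → ℂ := cls S x x (Finsupp.single Quiver.Path.nil 1)

/-- Homomorphisms `P κ → M`, given by the images of the generators. -/
abbrev Y (κ : Q.V → ℕ) (M : LRep Q) : Type := ∀ x, Fin (κ x) → M.X x

/-- The generators of `P γ`. -/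
def gen (γ : Q.V → ℕ) : Y γ (P S γ) := fun x k => Pi.single x (Pi.single k (gA S x))

variable {S}

lemma P_ev {γ : Q.V → ℕ} {x y : Q.V} (p : Quiver.Path x y) (u : PX S γ x) (z : Q.V)
    (k : Fin (γ z)) (c : Quiver.Path z x →₀ ℂ) (hc : u z k = cls S z x c) :
    ev (P S γ) p u z k = cls S z y (Finsupp.mapDomain (fun q => q.comp p) c) := by
  induction p with
  | nil =>
    rw [ev_nil, hc]
    exact congrArg (cls S z x) Finsupp.mapDomain_id.symm
  | cons p e ih =>
    rw [ev_cons]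
    change mulA S z e (ev (P S γ) p u z k) = _
    rw [ih, mulA_cls, ← Finsupp.mapDomain_comp]
    rfl

/-- Right multiplication by a combination of paths, on combinations of paths. -/
def rmul {x y : Q.V} (z : Q.V) : (Quiver.Path x y →₀ ℂ) →ₗ[ℂ]
    ((Quiver.Path z x →₀ ℂ) →ₗ[ℂ] (Quiver.Path z y →₀ ℂ)) :=
  Finsupp.linearCombination ℂ (fun p => Finsupp.lmapDomain ℂ ℂ (fun q => q.comp p))

lemma rmul_single {x y z : Q.V} (c : Quiver.Path x y →₀ ℂ) (b : Quiver.Path z x) (t : ℂ) :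
    rmul z c (Finsupp.single b t) = t • Finsupp.mapDomain (fun p => b.comp p) c := by
  induction c using Finsupp.induction_linear with
  | zero => simp
  | add f g hf hg => rw [map_add, LinearMap.add_apply, hf, hg, Finsupp.mapDomain_add, smul_add]
  | single p k => simp [rmul, Finsupp.mapDomain_single, mul_comm]

lemma evL_P {γ : Q.V → ℕ} {x y : Q.V} (c : Quiver.Path x y →₀ ℂ) (u : PX S γ x) (z : Q.V)
    (k : Fin (γ z)) (b : Quiver.Path z x →₀ ℂ) (hb : u z k = cls S z x b) :
    evL (P S γ) c u z k = cls S z y (rmul z c b) := by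
  induction c using Finsupp.induction_linear with
  | zero => simp; rfl
  | add f g hf hg =>
    rw [map_add, LinearMap.add_apply, map_add, LinearMap.add_apply, map_add, ← hf, ← hg]
    rfl
  | single p t =>
    rw [evL_single, LinearMap.smul_apply]
    change t • ev (P S γ) p u z k = _
    rw [P_ev p u z k b hb]
    simp [rmul]

lemma isMod_P (γ : Q.V → ℕ) : IsMod S (P S γ) := by
  intro r hr
  refine LinearMap.ext fun u => ?_
  funext z k
  obtain ⟨c, hc⟩ := cls_surj S z r.1 (u z k)
  rw [evL_P r.2.2 u z k c hc.symm]
  refine (cls_eq_zero S).2 ?_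
  induction c using Finsupp.induction_linear generalizing u with
  | zero => simp
  | add f g hf hg =>
    rw [map_add]
    exact add_mem (hf (fun x _ => cls S x _ (if h : x = z then h ▸ f else 0)) (by simp))
      (hg (fun x _ => cls S x _ (if h : x = z then h ▸ g else 0)) (by simp))
  | single b t =>
    rw [rmul_single]
    exact Submodule.smul_mem _ _ (Submodule.subset_span ⟨r, hr, b, Quiver.Path.nil, rfl⟩)

end PathAlgebra

section Lft

variable [Fintype Q.A] [hac : Fact (QAcyclic Q)] (S : Set (FormalRel Q))

/-- Homomorphisms `P κ → P δ`. -/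
abbrev H (κ δ : Q.V → ℕ) : Type := ∀ x, Fin (κ x) → PX S δ x

/-- The homomorphism `P κ → M` with given values on the generators, bilinearly. -/
def lftL (M : LRep Q) (κ : Q.V → ℕ) (y : Q.V) : Y κ M →ₗ[ℂ] (PX S κ y →ₗ[ℂ] M.X y) :=
  LinearMap.mk₂ ℂ (fun m u => ∑ x, ∑ k, act S M (u x k) (m x k))
    (by intros; simp [Finset.sum_add_distrib])
    (by intros; simp [Finset.smul_sum])
    (by intros; simp [Finset.sum_add_distrib])
    (by intros; simp [Finset.smul_sum])

/-- The homomorphism `P κ → M` with given values on the generators. -/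
def lft (M : LRep Q) {κ : Q.V → ℕ} (m : Y κ M) (y : Q.V) : PX S κ y →ₗ[ℂ] M.X y :=
  lftL S M κ y m

variable {S}

lemma lft_apply (M : LRep Q) {κ : Q.V → ℕ} (m : Y κ M) {y : Q.V} (u : PX S κ y) :
    lft S M m y u = ∑ x, ∑ k, act S M (u x k) (m x k) := rfl

lemma lft_hom {M : LRep Q} (hM : IsMod S M) {κ : Q.V → ℕ} (m : Y κ M) :
    IsHom (P S κ) M (lft S M m) := by
  intro x y e u
  simp only [lft_apply, map_sum]
  exact Finset.sum_congr rfl fun z _ => Finset.sum_congr rfl fun k _ => act_mulA hM _ _ _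

lemma act_gA {M : LRep Q} (hM : IsMod S M) (x : Q.V) (m : M.X x) :
    act S M (gA S x) m = m := by
  simp [gA, act_cls hM]

lemma lft_single (M : LRep Q) {κ : Q.V → ℕ} (m : Y κ M) {x y : Q.V} (k : Fin (κ x))
    (c : Fin (dA S x y) → ℂ) :
    lft S M m y (Pi.single x (Pi.single k c)) = act S M c (m x k) := by
  rw [lft_apply, Finset.sum_eq_single x, Finset.sum_eq_single k]
  · simp
  · intro j _ hj
    simp [hj]
  · simp
  · intro z _ hz
    simp [hz]
  · simp

lemma lft_gen {M : LRep Q} (hM : IsMod S M) {κ : Q.V → ℕ} (m : Y κ M) (x : Q.V)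
    (k : Fin (κ x)) : lft S M m x (gen S κ x k) = m x k := by
  rw [gen, lft_single, act_gA hM]

lemma act_P_gen {κ : Q.V → ℕ} {x y : Q.V} (k : Fin (κ x)) (c : Fin (dA S x y) → ℂ) :
    act S (P S κ) c (gen S κ x k) = Pi.single x (Pi.single k c) := by
  obtain ⟨c, rfl⟩ := cls_surj S x y c
  rw [act_cls (isMod_P κ)]
  have key : ∀ z (j : Fin (κ z)) (b : Quiver.Path z x →₀ ℂ), gen S κ x k z j = cls S z x b →
      evL (P S κ) c (gen S κ x k) z j = cls S z y (rmul z c b) := fun z j b hb =>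
    evL_P c _ z j b hb
  funext z j
  by_cases hz : z = x
  · subst hz
    by_cases hj : j = k
    · subst hj
      rw [key z j (Finsupp.single Quiver.Path.nil 1) (by simp [gen, gA]), rmul_single]
      simp only [Quiver.Path.nil_comp, one_smul, Pi.single_eq_same]
      exact congrArg (cls S z y) Finsupp.mapDomain_id
    · rw [key z j 0 (by simp [gen, hj])]
      simp [hj]
  · rw [key z j 0 (by simp [gen, hz])]
    simp [hz]

lemma lft_gen_self {κ : Q.V → ℕ} {y : Q.V} (u : PX S κ y) :
    lft S (P S κ) (gen S κ) y u = u := by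
  rw [lft_apply]
  have : ∀ x, ∑ k, act S (P S κ) (u x k) (gen S κ x k) = Pi.single x (u x) := by
    intro x
    refine (Finset.sum_congr rfl fun k _ => act_P_gen k (u x k)).trans ?_
    conv_rhs => rw [← Finset.univ_sum_single (u x)]
    exact (map_sum (LinearMap.single ℂ (fun x => Fin (κ x) → Fin (dA S x y) → ℂ) x) _ _).symm
  simp only [this]
  exact Finset.univ_sum_single u

lemma IsHom.lft {M N : LRep Q} {φ : ∀ x, M.X x →ₗ[ℂ] N.X x} (h : IsHom M N φ) {κ : Q.V → ℕ}
    (m : Y κ M) {y : Q.V} (u : PX S κ y) :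
    φ y (GenDec.lft S M m y u) = GenDec.lft S N (fun x k => φ x (m x k)) y u := by
  simp only [lft_apply, map_sum, h.act]

lemma hom_eq_lft {M : LRep Q} {κ : Q.V → ℕ} {φ : ∀ x, PX S κ x →ₗ[ℂ] M.X x}
    (h : IsHom (P S κ) M φ) {y : Q.V} (u : PX S κ y) :
    φ y u = lft S M (fun x k => φ x (gen S κ x k)) y u := by
  conv_lhs => rw [← lft_gen_self u]
  exact h.lft _ _

variable (S)

/-- Composition `m ∘ f`, bilinearly. -/
def cmpL (M : LRep Q) (κ γ : Q.V → ℕ) : H S κ γ →ₗ[ℂ] (Y γ M →ₗ[ℂ] Y κ M) :=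
  LinearMap.mk₂ ℂ (fun f m => fun x k => lft S M m x (f x k))
    (by intros; funext x k; simp)
    (by intros; funext x k; simp)
    (by intros; funext x k; simp [lft])
    (by intros; funext x k; simp [lft])

/-- Composition `m ∘ f`. -/
def cmp (M : LRep Q) {κ γ : Q.V → ℕ} (f : H S κ γ) (m : Y γ M) : Y κ M :=
  fun x k => lft S M m x (f x k)

variable {S}

lemma cmpL_apply (M : LRep Q) {κ γ : Q.V → ℕ} (f : H S κ γ) (m : Y γ M) :
    cmpL S M κ γ f m = cmp S M f m := rfl

lemma lft_cmp {M : LRep Q} (hM : IsMod S M) {κ γ : Q.V → ℕ} (f : H S κ γ) (m : Y γ M)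
    {y : Q.V} (u : PX S κ y) :
    lft S M (cmp S M f m) y u = lft S M m y (lft S (P S γ) f y u) := by
  rw [(lft_hom hM m).lft]
  rfl

lemma cmp_assoc {M : LRep Q} (hM : IsMod S M) {κ γ δ : Q.V → ℕ} (f : H S κ γ) (g : H S γ δ)
    (m : Y δ M) : cmp S M (cmp S (P S δ) f g) m = cmp S M f (cmp S M g m) := by
  funext x k
  exact (lft_cmp hM g m (f x k)).symm

lemma cmp_gen_left {M : LRep Q} (hM : IsMod S M) {κ : Q.V → ℕ} (m : Y κ M) :
    cmp S M (gen S κ) m = m := by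
  funext x k
  exact lft_gen hM m x k

lemma cmp_gen_right {κ γ : Q.V → ℕ} (f : H S κ γ) : cmp S (P S γ) f (gen S γ) = f := by
  funext x k
  exact lft_gen_self _

end Lft

section Projective

/-- `K` has the lifting property against surjections of finite-dimensional modules. -/
def IsProj (S : Set (FormalRel Q)) (K : LRep Q) : Prop :=
  ∀ (M N : LRep Q) [∀ x, Module.Finite ℂ (M.X x)] [∀ x, Module.Finite ℂ (N.X x)],
    IsMod S M → IsMod S N → ∀ g : ∀ x, M.X x →ₗ[ℂ] N.X x, IsHom M N g →
    (∀ x, Function.Surjective (g x)) → ∀ f : ∀ x, K.X x →ₗ[ℂ] N.X x, IsHom K N f →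
    ∃ h : ∀ x, K.X x →ₗ[ℂ] M.X x, IsHom K M h ∧ ∀ x m, g x (h x m) = f x m

/-- Coordinates on a finite-dimensional representation. -/
def coord (M : LRep Q) [∀ x, Module.Finite ℂ (M.X x)] (x : Q.V) :
    M.X x ≃ₗ[ℂ] (Fin (Module.finrank ℂ (M.X x)) → ℂ) :=
  (Module.finBasis ℂ (M.X x)).equivFun

lemma isProj_ofQ {S : Set (FormalRel Q)} {γ : Q.V → ℕ} {K : QRep Q γ} :
    IsProjRep S K ↔ IsProj S (ofQ K) := by
  constructor
  · intro hK M N _ _ hM hN g hg hgs f hf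
    have hMm : toQ M (coord M) ∈ modSet S _ := (isMod_ofQ _).1
      (isMod_of_surjective (toQ_hom M (coord M)) (fun x => (coord M x).surjective) hM)
    have hNm : toQ N (coord N) ∈ modSet S _ := (isMod_ofQ _).1
      (isMod_of_surjective (toQ_hom N (coord N)) (fun x => (coord N x).surjective) hN)
    have hg' := ((toQ_hom N (coord N)).comp hg).comp (toQ_hom M (coord M)).symm
    have hf' := (toQ_hom N (coord N)).comp hf
    obtain ⟨h, hh, hgh⟩ := hK _ _ _ _ hMm hNm _ (toMatrix'_mem_HomS hg') (by
        intro x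
        rw [← Matrix.toLin'_apply', Matrix.toLin'_toMatrix']
        exact ((coord N x).surjective.comp (hgs x)).comp (coord M x).symm.surjective)
      _ (toMatrix'_mem_HomS hf')
    rw [mem_HomS_iff] at hh
    refine ⟨_, (toQ_hom M (coord M)).symm.comp hh, fun x m => ?_⟩
    have h1 := congrArg (fun A => A.mulVecLin m) (hgh x)
    simp only [← Matrix.toLin'_apply', Matrix.toLin'_mul, Matrix.toLin'_toMatrix'] at h1
    exact (coord N x).injective h1
  · intro hK δ ε M N hM hN g hg hgs f hf
    obtain ⟨h, hh, hgh⟩ := hK (ofQ M) (ofQ N) ((isMod_ofQ M).2 hM) ((isMod_ofQ N).2 hN) _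
      ((mem_HomS_iff _ _ _).1 hg) hgs _ ((mem_HomS_iff _ _ _).1 hf)
    refine ⟨_, toMatrix'_mem_HomS hh, fun x => ?_⟩
    apply Matrix.toLin'.injective
    refine LinearMap.ext fun m => ?_
    rw [Matrix.toLin'_mul, Matrix.toLin'_toMatrix']
    exact hgh x m

lemma IsProj.of_iso {S : Set (FormalRel Q)} {K L : LRep Q} (hK : IsProj S K)
    {φ : ∀ x, K.X x ≃ₗ[ℂ] L.X x} (h : IsHom K L (fun x => (φ x).toLinearMap)) :
    IsProj S L := by
  intro M N _ _ hM hN g hg hgs f hf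
  obtain ⟨l, hl, hgl⟩ := hK M N hM hN g hg hgs _ (hf.comp h)
  refine ⟨_, hl.comp h.symm, fun x m => ?_⟩
  simp [hgl]

variable [Fintype Q.A] [hac : Fact (QAcyclic Q)] {S : Set (FormalRel Q)}

lemma isProj_P (κ : Q.V → ℕ) : IsProj S (P S κ) := by
  intro M N _ _ hM hN g hg hgs f hf
  choose s hs using hgs
  refine ⟨_, lft_hom hM (fun x k => s x (f x (gen S κ x k))), fun x m => ?_⟩
  rw [hg.lft, hom_eq_lft hf]
  simp [hs]

/-- The radical of a representation: the sum of the images of the arrows. -/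
def radical (M : LRep Q) (x : Q.V) : Submodule ℂ (M.X x) :=
  ⨆ s : Σ y, (y ⟶ x), LinearMap.range (M.ρ s.2)

lemma P_decomp {κ : Q.V → ℕ} {x : Q.V} (u : PX S κ x) :
    ∃ c : Fin (κ x) → ℂ, u - ∑ k, c k • gen S κ x k ∈ radical (P S κ) x := by
  have hspan : u ∈ Submodule.span ℂ (Set.range (gen S κ x)) ⊔ radical (P S κ) x := by
    rw [← lft_gen_self u, lft_apply]
    refine Submodule.sum_mem _ fun y _ => Submodule.sum_mem _ fun k _ => ?_
    obtain ⟨c, hc⟩ := cls_surj S y x (u y k)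
    rw [← hc, act_cls (isMod_P κ)]
    induction c using Finsupp.induction_linear generalizing u with
    | zero => simp
    | add f g hf hg =>
      rw [map_add, LinearMap.add_apply]
      exact add_mem (hf (fun x' _ => cls S x' _ (if h : x' = y then h ▸ f else 0)) (by simp))
        (hg (fun x' _ => cls S x' _ (if h : x' = y then h ▸ g else 0)) (by simp))
    | single p t =>
      rw [evL_single, LinearMap.smul_apply]
      refine Submodule.smul_mem _ _ ?_
      cases p with
      | nil =>
        rw [ev_nil]
        exact Submodule.mem_sup_left (Submodule.subset_span ⟨k, rfl⟩)
      | cons p e =>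
        rw [ev_cons]
        exact Submodule.mem_sup_right
          (Submodule.mem_iSup_of_mem ⟨_, e⟩ (LinearMap.mem_range_self _ _))
  obtain ⟨a, ha, b, hb, hab⟩ := Submodule.mem_sup.1 hspan
  obtain ⟨c, rfl⟩ := (Submodule.mem_span_range_iff_exists_fun ℂ).1 ha
  exact ⟨c, by rw [← hab]; simpa using hb⟩

lemma IsHom.radical_mem {M N : LRep Q} {φ : ∀ x, M.X x →ₗ[ℂ] N.X x} (h : IsHom M N φ)
    {x : Q.V} {m : M.X x} (hm : m ∈ radical M x) : φ x m ∈ radical N x := by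
  have : radical M x ≤ (radical N x).comap (φ x) := by
    refine iSup_le fun s => ?_
    rintro _ ⟨v, rfl⟩
    exact Submodule.mem_iSup_of_mem s ⟨φ _ v, (h _ _).symm⟩
  exact this hm

theorem IsProj.exists_iso_P {K : LRep Q} [∀ x, Module.Finite ℂ (K.X x)] (hK : IsProj S K)
    (hM : IsMod S K) : ∃ (κ : Q.V → ℕ) (m : Y κ K), ∀ y, Function.Bijective (lft S K m y) := by
  choose C hC using fun x => (radical K x).exists_isCompl
  let κ : Q.V → ℕ := fun x => Module.finrank ℂ (C x)
  let b : ∀ x, Module.Basis (Fin (κ x)) ℂ (C x) := fun x => Module.finBasis ℂ (C x)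
  let m : Y κ K := fun x k => (b x k : K.X x)
  have hhom := lft_hom hM m
  have hsurj : ∀ y, Function.Surjective (lft S K m y) := by
    intro y
    refine below_wf.induction (C := fun y => Function.Surjective (lft S K m y)) y
      fun y ih => ?_
    rw [← LinearMap.range_eq_top, eq_top_iff, ← (hC y).sup_eq_top]
    refine sup_le (iSup_le ?_) ?_
    · rintro ⟨z, e⟩ _ ⟨v, rfl⟩
      obtain ⟨u, rfl⟩ := ih z (below_of_arrow e) v
      exact ⟨_, hhom e u⟩
    · intro v hv
      refine ⟨∑ k, (b y).repr ⟨v, hv⟩ k • gen S κ y k, ?_⟩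
      rw [map_sum]
      simp only [map_smul, lft_gen hM]
      have := congrArg Subtype.val ((b y).sum_repr ⟨v, hv⟩)
      rw [Submodule.coe_sum] at this
      exact this
  obtain ⟨s, hs, hls⟩ := hK (P S κ) K (isMod_P κ) hM _ hhom hsurj _ (IsHom.id K)
  have hker : ∀ x (u : PX S κ x), lft S K m x u = 0 → u ∈ radical (P S κ) x := by
    intro x u hu
    obtain ⟨c, hc⟩ := P_decomp u
    have h1 := hhom.radical_mem hc
    rw [map_sub, hu, zero_sub, neg_mem_iff, map_sum] at h1
    simp only [map_smul, lft_gen hM] at h1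
    have h2 : ∑ k, c k • m x k = ((∑ k, c k • b x k : C x) : K.X x) := by simp [m]
    rw [h2] at h1
    have h3 := Submodule.disjoint_def.1 (hC x).disjoint _ h1 (Subtype.property _)
    have h4 : ∑ k, c k • b x k = 0 := Subtype.ext h3
    have h5 := Fintype.linearIndependent_iff.1 (b x).linearIndependent c h4
    simpa [h5] using hc
  have hss : ∀ y, Function.Surjective (s y) := by
    intro y
    refine below_wf.induction (C := fun y => Function.Surjective (s y)) y fun y ih => ?_
    intro u
    have h1 : u - s y (lft S K m y u) ∈ radical (P S κ) y := by
      apply hker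
      rw [map_sub, hls]
      simp
    have h2 : radical (P S κ) y ≤ LinearMap.range (s y) := by
      refine iSup_le ?_
      rintro ⟨z, e⟩ _ ⟨v, rfl⟩
      obtain ⟨w, rfl⟩ := ih z (below_of_arrow e) v
      exact ⟨_, hs e w⟩
    obtain ⟨w, hw⟩ := h2 h1
    exact ⟨w + lft S K m y u, by rw [map_add, hw]; simp⟩
  refine ⟨κ, m, fun y => ⟨fun u v huv => ?_, hsurj y⟩⟩
  obtain ⟨u, rfl⟩ := hss y u
  obtain ⟨v, rfl⟩ := hss y v
  rw [hls, hls] at huv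
  rw [show u = v from huv]

lemma finrank_PX (κ : Q.V → ℕ) (y : Q.V) :
    Module.finrank ℂ (PX S κ y) = ∑ x, κ x * dA S x y := by
  simp [PX, Module.finrank_pi_fintype]

lemma dA_eq_zero {x y : Q.V} (h : IsEmpty (Quiver.Path x y)) : dA S x y = 0 := by
  haveI : Subsingleton ((Quiver.Path x y →₀ ℂ) ⧸ idealComp S x y) :=
    (Submodule.mkQ_surjective _).subsingleton
  exact Module.finrank_zero_of_subsingleton

lemma dA_self (hS : AdmissibleRels S) (x : Q.V) : dA S x x = 1 := by
  have hnil : ∀ p : Quiver.Path x x, p = Quiver.Path.nil := hac.out x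
  haveI : Unique (Quiver.Path x x) := ⟨⟨Quiver.Path.nil⟩, hnil⟩
  have hbot : idealComp S x x = ⊥ := by
    unfold idealComp
    rw [Submodule.span_eq_bot]
    rintro c ⟨r, hr, p, q, rfl⟩
    have : r.2.2 = 0 := by
      rw [← Finsupp.support_eq_empty, Finset.eq_empty_iff_forall_notMem]
      intro s hs
      have h2 := hS r hr s hs
      have h3 := congrArg Quiver.Path.length (hnil ((p.comp s).comp q))
      simp at h3
      omega
    rw [this, Finsupp.mapDomain_zero]
  rw [dA, hbot, (Submodule.quotEquivOfEqBot ⊥ rfl).finrank_eq]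
  simp

lemma kappa_unique (hS : AdmissibleRels S) {κ κ' : Q.V → ℕ}
    (h : ∀ y, Module.finrank ℂ (PX S κ y) = Module.finrank ℂ (PX S κ' y)) : κ = κ' := by
  funext y
  refine below_wf.induction (C := fun y => κ y = κ' y) y fun y ih => ?_
  have h1 := h y
  rw [finrank_PX, finrank_PX, ← Finset.add_sum_erase _ _ (Finset.mem_univ y),
    ← Finset.add_sum_erase _ _ (Finset.mem_univ y), dA_self hS] at h1
  have h2 : ∑ x ∈ Finset.univ.erase y, κ x * dA S x y =
      ∑ x ∈ Finset.univ.erase y, κ' x * dA S x y := by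
    refine Finset.sum_congr rfl fun x hx => ?_
    by_cases hp : IsEmpty (Quiver.Path x y)
    · simp [dA_eq_zero hp]
    · rw [not_isEmpty_iff] at hp
      obtain ⟨p⟩ := hp
      rw [ih x ⟨p, Nat.pos_of_ne_zero fun h0 =>
        Finset.ne_of_mem_erase hx (Quiver.Path.eq_of_length_zero p h0)⟩]
  omega

end Projective

section Canonical

variable [Fintype Q.A] [hac : Fact (QAcyclic Q)] (S : Set (FormalRel Q))

/-- The span of the generators of `P δ` at a vertex. -/
def std (δ : Q.V → ℕ) (x : Q.V) : (Fin (δ x) → ℂ) →ₗ[ℂ] PX S δ x :=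
  Fintype.linearCombination ℂ (gen S δ x)

variable {S}

lemma std_apply {δ : Q.V → ℕ} {x : Q.V} (w : Fin (δ x) → ℂ) :
    std S δ x w = ∑ k, w k • gen S δ x k := by
  simp [std, Fintype.linearCombination_apply]

lemma lft_std {M : LRep Q} (hM : IsMod S M) {δ : Q.V → ℕ} (φ : Y δ M) {x : Q.V}
    (w : Fin (δ x) → ℂ) : lft S M φ x (std S δ x w) = ∑ k, w k • φ x k := by
  rw [std_apply, map_sum]
  simp only [map_smul, lft_gen hM]

/-- The map `P κ ⊕ ℂ^δ → P δ` given by `f` and the generators. -/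
def Bf {κ δ : Q.V → ℕ} (f : H S κ δ) (x : Q.V) :
    (PX S κ x × (Fin (δ x) → ℂ)) →ₗ[ℂ] PX S δ x :=
  (lft S (P S δ) f x).coprod (std S δ x)

lemma Bf_apply {κ δ : Q.V → ℕ} (f : H S κ δ) (x : Q.V) (u : PX S κ x) (w : Fin (δ x) → ℂ) :
    Bf f x (u, w) = lft S (P S δ) f x u + std S δ x w := by
  simp [Bf]

/-- `f` is injective and the generators of `P δ` induce a basis of its cokernel. -/
def Can {κ δ : Q.V → ℕ} (f : H S κ δ) : Prop := ∀ x, Function.Bijective (Bf f x)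

open Classical in
/-- The projection of `P δ` onto the cokernel of `f`. -/
def rf {κ δ : Q.V → ℕ} (f : H S κ δ) (x : Q.V) : PX S δ x →ₗ[ℂ] (Fin (δ x) → ℂ) :=
  if h : Function.Bijective (Bf f x) then
    LinearMap.snd ℂ _ _ ∘ₗ (LinearEquiv.ofBijective (Bf f x) h).symm.toLinearMap
  else 0

/-- The cokernel of `f`, with the basis induced by the generators of `P δ`. -/
def Vf {κ δ : Q.V → ℕ} (f : H S κ δ) : QRep Q δ := fun a =>
  LinearMap.toMatrix' (rf f (Q.h a) ∘ₗ
    (P S δ).ρ (x := Q.t a) (y := Q.h a) ⟨a, rfl, rfl⟩ ∘ₗ std S δ (Q.t a))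

section

variable {κ δ : Q.V → ℕ} {f : H S κ δ}

lemma Can.exists_eq (hf : Can f) {x : Q.V} (v : PX S δ x) :
    ∃ u w, v = lft S (P S δ) f x u + std S δ x w := by
  obtain ⟨⟨u, w⟩, rfl⟩ := (hf x).2 v
  exact ⟨u, w, Bf_apply f x u w⟩

lemma Can.rf_apply (hf : Can f) {x : Q.V} (u : PX S κ x) (w : Fin (δ x) → ℂ) :
    rf f x (lft S (P S δ) f x u + std S δ x w) = w := by
  rw [← Bf_apply, rf, dif_pos (hf x)]
  change ((LinearEquiv.ofBijective (Bf f x) (hf x)).symm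
    (LinearEquiv.ofBijective (Bf f x) (hf x) (u, w))).2 = w
  rw [LinearEquiv.symm_apply_apply]

lemma Can.rf_lft (hf : Can f) {x : Q.V} (u : PX S κ x) :
    rf f x (lft S (P S δ) f x u) = 0 := by
  simpa using hf.rf_apply u 0

lemma Can.rf_std (hf : Can f) {x : Q.V} (w : Fin (δ x) → ℂ) : rf f x (std S δ x w) = w := by
  simpa using hf.rf_apply 0 w

lemma Can.ker_rf (hf : Can f) (x : Q.V) :
    LinearMap.ker (rf f x) = LinearMap.range (lft S (P S δ) f x) := by
  ext v
  constructor
  · intro hv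
    obtain ⟨u, w, rfl⟩ := hf.exists_eq v
    rw [LinearMap.mem_ker, hf.rf_apply] at hv
    exact ⟨u, by simp [hv]⟩
  · rintro ⟨u, rfl⟩
    exact hf.rf_lft u

lemma Can.lft_injective (hf : Can f) (x : Q.V) :
    Function.Injective (lft S (P S δ) f x) := by
  rw [injective_iff_map_eq_zero]
  intro u hu
  have h : Bf f x (u, 0) = Bf f x 0 := by rw [Bf_apply, hu]; simp
  exact congrArg Prod.fst ((hf x).1 h)

lemma Vf_apply (a : Q.A) (w : Fin (δ (Q.t a)) → ℂ) :
    (Vf f a).mulVecLin w = rf f (Q.h a)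
      ((P S δ).ρ (x := Q.t a) (y := Q.h a) ⟨a, rfl, rfl⟩ (std S δ (Q.t a) w)) := by
  rw [Vf, ← Matrix.toLin'_apply', Matrix.toLin'_toMatrix']
  rfl

lemma Can.rf_hom (hf : Can f) : IsHom (P S δ) (ofQ (Vf f)) (rf f) := by
  rintro x y ⟨a, rfl, rfl⟩ v
  obtain ⟨u, w, rfl⟩ := hf.exists_eq v
  change _ = (Vf f a).mulVecLin _
  rw [hf.rf_apply, Vf_apply, map_add, ← lft_hom (isMod_P δ) f, map_add, hf.rf_lft, zero_add]

lemma Can.rf_surjective (hf : Can f) (x : Q.V) : Function.Surjective (rf f x) :=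
  fun w => ⟨_, hf.rf_std w⟩

lemma Can.isMod (hf : Can f) : IsMod S (ofQ (Vf f)) :=
  isMod_of_surjective hf.rf_hom hf.rf_surjective (isMod_P δ)

/-- A representation presented by `f` is isomorphic to `Vf f`. -/
lemma Can.exists_iso (hf : Can f) {M : LRep Q} (hM : IsMod S M) (φ : Y δ M)
    (hφ : ∀ x, Function.Surjective (lft S M φ x))
    (hker : ∀ x, LinearMap.ker (lft S M φ x) = LinearMap.range (lft S (P S δ) f x)) :
    ∃ u : ∀ x, (Fin (δ x) → ℂ) ≃ₗ[ℂ] M.X x,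
      IsHom (ofQ (Vf f)) M (fun x => (u x).toLinearMap) ∧
      ∀ x w, u x w = lft S M φ x (std S δ x w) := by
  have h0 : ∀ x u, lft S M φ x (lft S (P S δ) f x u) = 0 := fun x u => by
    rw [← LinearMap.mem_ker, hker]
    exact LinearMap.mem_range_self _ _
  have hbij : ∀ x, Function.Bijective (lft S M φ x ∘ₗ std S δ x) := by
    intro x
    constructor
    · rw [injective_iff_map_eq_zero]
      intro w hw
      have : std S δ x w ∈ LinearMap.range (lft S (P S δ) f x) := by
        rw [← hker]; exact hw
      obtain ⟨u, hu⟩ := this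
      have := hf.rf_lft u
      rwa [hu, hf.rf_std] at this
    · intro m
      obtain ⟨v, rfl⟩ := hφ x m
      obtain ⟨u, w, rfl⟩ := hf.exists_eq v
      exact ⟨w, by rw [map_add, h0]; simp⟩
  have hrf : ∀ x v, lft S M φ x (std S δ x (rf f x v)) = lft S M φ x v := by
    intro x v
    obtain ⟨u, w, rfl⟩ := hf.exists_eq v
    rw [hf.rf_apply, map_add, h0, zero_add]
  refine ⟨fun x => LinearEquiv.ofBijective _ (hbij x), ?_, fun x w => rfl⟩
  rintro x y ⟨a, rfl, rfl⟩ w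
  change lft S M φ _ (std S δ _ ((Vf f a).mulVecLin w)) = M.ρ _ (lft S M φ _ (std S δ _ w))
  rw [Vf_apply, hrf, lft_hom hM φ]

lemma can_of_pres {M : LRep Q} (φ : Y δ M)
    (hb : ∀ x, Function.Bijective (lft S M φ x ∘ₗ std S δ x))
    (hker : ∀ x, LinearMap.ker (lft S M φ x) = LinearMap.range (lft S (P S δ) f x))
    (hinj : ∀ x, Function.Injective (lft S (P S δ) f x)) : Can f := by
  have h0 : ∀ x u, lft S M φ x (lft S (P S δ) f x u) = 0 := fun x u => by
    rw [← LinearMap.mem_ker, hker]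
    exact LinearMap.mem_range_self _ _
  intro x
  constructor
  · rw [injective_iff_map_eq_zero]
    rintro ⟨u, w⟩ h
    rw [Bf_apply] at h
    have h1 := congrArg (lft S M φ x) h
    rw [map_add, h0, zero_add, map_zero] at h1
    have hw : w = 0 := (injective_iff_map_eq_zero _).1 (hb x).1 w h1
    subst hw
    rw [map_zero, add_zero] at h
    rw [(injective_iff_map_eq_zero _).1 (hinj x) u h]
    rfl
  · intro v
    obtain ⟨w, hw⟩ := (hb x).2 (lft S M φ x v)
    have : v - std S δ x w ∈ LinearMap.ker (lft S M φ x) := by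
      rw [LinearMap.mem_ker, map_sub, ← hw]
      simp
    rw [hker] at this
    obtain ⟨u, hu⟩ := this
    exact ⟨(u, w), by rw [Bf_apply, hu]; simp⟩

end

/-- The standard basis, as values on generators. -/
def stdY {δ : Q.V → ℕ} (V : QRep Q δ) : Y δ (ofQ V) := fun _ k => Pi.single k 1

lemma lft_stdY {δ : Q.V → ℕ} {V : QRep Q δ} (hV : IsMod S (ofQ V)) {x : Q.V}
    (w : Fin (δ x) → ℂ) : lft S (ofQ V) (stdY V) x (std S δ x w) = w := by
  rw [lft_std hV]
  simp [stdY, ← Pi.single_smul, Finset.univ_sum_single]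

lemma eq_Vf_of_pres {κ δ : Q.V → ℕ} {V : QRep Q δ} (hV : IsMod S (ofQ V)) (f : H S κ δ)
    (hker : ∀ x, LinearMap.ker (lft S (ofQ V) (stdY V) x) =
      LinearMap.range (lft S (P S δ) f x))
    (hinj : ∀ x, Function.Injective (lft S (P S δ) f x)) : Can f ∧ Vf f = V := by
  have hid : ∀ x, lft S (ofQ V) (stdY V) x ∘ₗ std S δ x = LinearMap.id := fun x =>
    LinearMap.ext fun w => lft_stdY hV w
  have hf : Can f := can_of_pres (stdY V) (fun x => by rw [hid]; exact Function.bijective_id)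
    hker hinj
  refine ⟨hf, ?_⟩
  obtain ⟨u, hu, huw⟩ := hf.exists_iso hV (stdY V)
    (fun x w => ⟨_, lft_stdY hV w⟩) hker
  have hu1 : (fun x => (u x).toLinearMap) = fun x => LinearMap.id := by
    funext x
    refine LinearMap.ext fun w => ?_
    exact (huw x w).trans (lft_stdY hV w)
  rw [hu1, isHom_ofQ_iff] at hu
  funext a
  have := hu a
  rw [LinearMap.id_comp, LinearMap.comp_id] at this
  apply Matrix.toLin'.injective
  exact this

/-- The kernel of a family of linear maps out of `M` stable under the arrows. -/
@[reducible] def kerRep {M N : LRep Q} {π : ∀ x, M.X x →ₗ[ℂ] N.X x} (h : IsHom M N π) : LRep Q where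
  X x := LinearMap.ker (π x)
  ρ {x y} e := (M.ρ e).restrict (p := LinearMap.ker (π x)) (q := LinearMap.ker (π y))
    (fun m hm => by
      rw [LinearMap.mem_ker] at hm ⊢
      rw [h e, hm, map_zero])

/-- The direct sum of two representations. -/
@[reducible] def prodRep (M N : LRep Q) : LRep Q where
  X x := M.X x × N.X x
  ρ e := (M.ρ e).prodMap (N.ρ e)

omit [Fintype Q.A] hac in
lemma isMod_prodRep {M N : LRep Q} (hM : IsMod S M) (hN : IsMod S N) :
    IsMod S (prodRep M N) := by
  intro r hr
  have h1 : IsHom (prodRep M N) M (fun x => LinearMap.fst ℂ _ _) := fun _ _ _ _ => rfl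
  have h2 : IsHom (prodRep M N) N (fun x => LinearMap.snd ℂ _ _) := fun _ _ _ _ => rfl
  refine LinearMap.ext fun m => Prod.ext ?_ ?_
  · exact (h1.evL r.2.2 m).trans (by rw [hM r hr]; rfl)
  · exact (h2.evL r.2.2 m).trans (by rw [hN r hr]; rfl)

omit [Fintype Q.A] hac in
/-- The kernel of an epimorphism from a projective onto a module of projective dimension at
most one is projective. -/
lemma isProj_kerRep {F V P₀ P₁ : LRep Q} [∀ x, Module.Finite ℂ (F.X x)]
    [∀ x, Module.Finite ℂ (V.X x)] [∀ x, Module.Finite ℂ (P₀.X x)]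
    [∀ x, Module.Finite ℂ (P₁.X x)]
    (hFm : IsMod S F) (hVm : IsMod S V) (h0m : IsMod S P₀) (h1m : IsMod S P₁)
    (hF : IsProj S F) (h0 : IsProj S P₀) (h1 : IsProj S P₁)
    {π : ∀ x, F.X x →ₗ[ℂ] V.X x} (hπ : IsHom F V π) (hπs : ∀ x, Function.Surjective (π x))
    {i : ∀ x, P₁.X x →ₗ[ℂ] P₀.X x} (hi : IsHom P₁ P₀ i) (hinj : ∀ x, Function.Injective (i x))
    {p : ∀ x, P₀.X x →ₗ[ℂ] V.X x} (hp : IsHom P₀ V p) (hps : ∀ x, Function.Surjective (p x))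
    (hex : ∀ x, LinearMap.range (i x) = LinearMap.ker (p x)) :
    IsProj S (kerRep hπ) := by
  obtain ⟨ψ, hψ, hpψ⟩ := hF P₀ V h0m hVm p hp hps π hπ
  let ξ : ∀ x, (prodRep F P₁).X x →ₗ[ℂ] P₀.X x := fun x => (ψ x).coprod (i x)
  have hξ : IsHom (prodRep F P₁) P₀ ξ := by
    intro x y e m
    simp [ξ, hψ e, hi e]
  have hpi : ∀ x v, p x (i x v) = 0 := fun x v => by
    rw [← LinearMap.mem_ker, ← hex]
    exact LinearMap.mem_range_self _ _
  have hξs : ∀ x, Function.Surjective (ξ x) := by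
    intro x w
    obtain ⟨u, hu⟩ := hπs x (p x w)
    have : w - ψ x u ∈ LinearMap.ker (p x) := by
      rw [LinearMap.mem_ker, map_sub, hpψ, hu, sub_self]
    rw [← hex] at this
    obtain ⟨v, hv⟩ := this
    exact ⟨(u, v), by simp [ξ, hv]⟩
  obtain ⟨σ, hσ, hξσ⟩ := h0 (prodRep F P₁) P₀ (isMod_prodRep hFm h1m) h0m ξ hξ hξs _ (IsHom.id P₀)
  have hσ1 : IsHom P₀ F (fun x => LinearMap.fst ℂ _ _ ∘ₗ σ x) := fun x y e m =>
    congrArg Prod.fst (hσ e m)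
  have hπσ : ∀ x w, π x (σ x w).1 = p x w := by
    intro x w
    have h := congrArg (p x) (hξσ x w)
    simp only [ξ, LinearMap.coprod_apply, map_add, hpi, hpψ] at h
    simpa using h
  intro M N _ _ hM hN g hg hgs f hf
  -- the two components of the retraction
  let r1 : ∀ x, F.X x →ₗ[ℂ] LinearMap.ker (π x) := fun x =>
    (LinearMap.id - LinearMap.fst ℂ _ _ ∘ₗ σ x ∘ₗ ψ x).codRestrict _ (fun u => by
      simp [hπσ, hpψ])
  have hr1 : IsHom F (kerRep hπ) r1 := by
    intro x y e m
    apply Subtype.ext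
    have := hσ1 e (ψ x m)
    simp only [LinearMap.comp_apply, LinearMap.fst_apply] at this
    change F.ρ e m - (σ y (ψ y (F.ρ e m))).1 = F.ρ e (m - (σ x (ψ x m)).1)
    rw [hψ e, this, map_sub]
  let r2 : ∀ x, P₁.X x →ₗ[ℂ] LinearMap.ker (π x) := fun x =>
    (-(LinearMap.fst ℂ _ _ ∘ₗ σ x ∘ₗ i x)).codRestrict _ (fun u => by
      simp [hπσ, hpi])
  have hr2 : IsHom P₁ (kerRep hπ) r2 := by
    intro x y e m
    apply Subtype.ext
    have := hσ1 e (i x m)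
    simp only [LinearMap.comp_apply, LinearMap.fst_apply] at this
    change -(σ y (i y (P₁.ρ e m))).1 = F.ρ e (-(σ x (i x m)).1)
    rw [hi e, this, map_neg]
  obtain ⟨l1, hl1, hgl1⟩ := hF M N hM hN g hg hgs _ (hf.comp hr1)
  obtain ⟨l2, hl2, hgl2⟩ := h1 M N hM hN g hg hgs _ (hf.comp hr2)
  have hj : ∀ x, ∃ j : LinearMap.ker (π x) →ₗ[ℂ] P₁.X x, ∀ u, i x (j u) = ψ x u.1 := by
    intro x
    refine ⟨(LinearEquiv.ofInjective (i x) (hinj x)).symm.toLinearMap ∘ₗ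
      ((ψ x ∘ₗ (LinearMap.ker (π x)).subtype).codRestrict _ (fun u => ?_)), fun u => ?_⟩
    · rw [hex, LinearMap.mem_ker]
      simp [hpψ]
    · simp [← LinearEquiv.ofInjective_apply (h := hinj x)]
  choose j hj using hj
  have hjh : IsHom (kerRep hπ) P₁ j := by
    intro x y e u
    apply hinj
    rw [hj, hi e, hj, ← hψ e]
    rfl
  have hlsub : IsHom (kerRep hπ) F (fun x => (LinearMap.ker (π x)).subtype) := fun _ _ _ _ => rfl
  refine ⟨fun x => l1 x ∘ₗ (LinearMap.ker (π x)).subtype - l2 x ∘ₗ j x, ?_, ?_⟩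
  · intro x y e u
    have e1 := (hl1.comp hlsub) e u
    have e2 := (hl2.comp hjh) e u
    rw [LinearMap.sub_apply, LinearMap.sub_apply, map_sub, e1, e2]
  · intro x u
    rw [LinearMap.sub_apply, map_sub, LinearMap.comp_apply, LinearMap.comp_apply, hgl1, hgl2,
      LinearMap.comp_apply, LinearMap.comp_apply, ← map_sub]
    congr 1
    apply Subtype.ext
    change (u.1 - (σ x (ψ x u.1)).1) - (-(σ x (i x (j x u))).1) = u.1
    rw [hj, sub_neg_eq_add, sub_add_cancel]

/-- A module of projective dimension at most one is the cokernel of a canonical map. -/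
theorem exists_can {δ : Q.V → ℕ} {V : QRep Q δ} (hV : V ∈ PAset S δ) :
    ∃ (κ : Q.V → ℕ) (f : H S κ δ), Can f ∧ Vf f = V := by
  obtain ⟨hVm, γ₀, γ₁, P₀, P₁, h0m, h1m, h0, h1, i, hi, p, hp, hinj, hsurj, hex⟩ := hV
  rw [← isMod_ofQ] at hVm h0m h1m
  have hπ := lft_hom hVm (stdY V)
  have hπs : ∀ x, Function.Surjective (lft S (ofQ V) (stdY V) x) :=
    fun x w => ⟨_, lft_stdY hVm w⟩
  have hK := isProj_kerRep (isMod_P δ) hVm h0m h1m (isProj_P δ) (isProj_ofQ.1 h0)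
    (isProj_ofQ.1 h1) hπ hπs ((mem_HomS_iff _ _ _).1 hi) hinj ((mem_HomS_iff _ _ _).1 hp)
    hsurj hex
  have hlsub : IsHom (kerRep hπ) (P S δ)
    (fun x => (LinearMap.ker (lft S (ofQ V) (stdY V) x)).subtype) := fun _ _ _ _ => rfl
  obtain ⟨κ, m, hm⟩ := hK.exists_iso_P
    (isMod_of_injective hlsub (fun x => Subtype.val_injective) (isMod_P δ))
  let f : H S κ δ := fun x k => (m x k : PX S δ x)
  have hf : ∀ x u, lft S (P S δ) f x u = (lft S (kerRep hπ) m x u).1 :=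
    fun x u => (hlsub.lft m u).symm
  refine ⟨κ, f, eq_Vf_of_pres hVm f (fun x => ?_) (fun x u v huv => ?_)⟩
  · ext v
    constructor
    · intro hv
      obtain ⟨u, hu⟩ := (hm x).2 ⟨v, hv⟩
      exact ⟨u, by rw [hf, hu]⟩
    · rintro ⟨u, rfl⟩
      rw [hf]
      exact Subtype.property _
  · rw [hf, hf] at huv
    exact (hm x).1 (Subtype.ext huv)

lemma Can.finrank_eq {κ δ : Q.V → ℕ} {f : H S κ δ} (hf : Can f) (x : Q.V) :
    Module.finrank ℂ (PX S κ x) + δ x = Module.finrank ℂ (PX S δ x) := by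
  rw [← (LinearEquiv.ofBijective _ (hf x)).finrank_eq, Module.finrank_prod]
  simp

lemma Can.kappa_eq (hS : AdmissibleRels S) {κ κ' δ : Q.V → ℕ} {f : H S κ δ} (hf : Can f)
    {f' : H S κ' δ} (hf' : Can f') : κ = κ' :=
  kappa_unique hS fun x => by
    have h1 := hf.finrank_eq x
    have h2 := hf'.finrank_eq x
    omega

theorem Can.exists_can (hS : AdmissibleRels S) {κ δ : Q.V → ℕ} {f : H S κ δ} (hf : Can f)
    {V : QRep Q δ} (hV : V ∈ PAset S δ) : ∃ g : H S κ δ, Can g ∧ Vf g = V := by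
  obtain ⟨κ', g, hg, hgV⟩ := GenDec.exists_can hV
  obtain rfl := hf.kappa_eq hS hg
  exact ⟨g, hg, hgV⟩

/-- The cokernel of a canonical map has projective dimension at most one. -/
theorem Can.mem_PAset {κ δ : Q.V → ℕ} {f : H S κ δ} (hf : Can f) : Vf f ∈ PAset S δ := by
  have hc0 := toQ_hom (P S δ) (coord (P S δ))
  have hc1 := toQ_hom (P S κ) (coord (P S κ))
  have hi := (hc0.comp (lft_hom (isMod_P δ) f)).comp hc1.symm
  have hp := hf.rf_hom.comp hc0.symm
  refine ⟨(isMod_ofQ _).1 hf.isMod, _, _, toQ (P S δ) (coord (P S δ)),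
    toQ (P S κ) (coord (P S κ)), ?_, ?_, ?_, ?_, _, toMatrix'_mem_HomS hi, _,
    toMatrix'_mem_HomS hp, ?_, ?_, ?_⟩
  · exact (isMod_ofQ _).1 (isMod_of_surjective hc0 (fun x => (coord _ x).surjective) (isMod_P δ))
  · exact (isMod_ofQ _).1 (isMod_of_surjective hc1 (fun x => (coord _ x).surjective) (isMod_P κ))
  · exact isProj_ofQ.2 ((isProj_P δ).of_iso hc0)
  · exact isProj_ofQ.2 ((isProj_P κ).of_iso hc1)
  · intro x
    rw [← Matrix.toLin'_apply', Matrix.toLin'_toMatrix']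
    exact ((coord (P S δ) x).injective.comp (hf.lft_injective x)).comp
      (coord (P S κ) x).symm.injective
  · intro x
    rw [← Matrix.toLin'_apply', Matrix.toLin'_toMatrix']
    exact (hf.rf_surjective x).comp (coord (P S δ) x).symm.surjective
  · intro x
    rw [← Matrix.toLin'_apply', ← Matrix.toLin'_apply', Matrix.toLin'_toMatrix',
      Matrix.toLin'_toMatrix']
    ext v
    constructor
    · rintro ⟨u, rfl⟩
      simp [hf.rf_lft]
    · intro hv
      have : (coord (P S δ) x).symm v ∈ LinearMap.ker (rf f x) := hv
      rw [hf.ker_rf] at this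
      obtain ⟨u, hu⟩ := this
      exact ⟨coord (P S κ) x u, by simp [hu]⟩

end Canonical

section Regular

variable {Z : Type*} [NormedAddCommGroup Z] [NormedSpace ℂ Z]

variable (Z) in
/-- The algebra of continuous functions that are polynomial along every line. -/
def Reg : Subalgebra ℂ (Z → ℂ) where
  carrier := {p | Continuous p ∧
    ∀ g h, ∃ q : Polynomial ℂ, ∀ t : ℂ, p (g + t • h) = q.eval t}
  mul_mem' := by
    rintro p p' ⟨hp, hp'⟩ ⟨hq, hq'⟩
    refine ⟨hp.mul hq, fun g h => ?_⟩
    obtain ⟨q, hq⟩ := hp' g h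
    obtain ⟨q', hq'⟩ := hq' g h
    exact ⟨q * q', fun t => by simp [hq, hq']⟩
  add_mem' := by
    rintro p p' ⟨hp, hp'⟩ ⟨hq, hq'⟩
    refine ⟨hp.add hq, fun g h => ?_⟩
    obtain ⟨q, hq⟩ := hp' g h
    obtain ⟨q', hq'⟩ := hq' g h
    exact ⟨q + q', fun t => by simp [hq, hq']⟩
  algebraMap_mem' r := ⟨continuous_const, fun g h => ⟨Polynomial.C r, fun t => by simp⟩⟩

lemma Reg.const (c : ℂ) : (fun _ => c) ∈ Reg Z := (Reg Z).algebraMap_mem c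

lemma Reg.mul {p q : Z → ℂ} (hp : p ∈ Reg Z) (hq : q ∈ Reg Z) : (fun z => p z * q z) ∈ Reg Z :=
  mul_mem hp hq

lemma Reg.add {p q : Z → ℂ} (hp : p ∈ Reg Z) (hq : q ∈ Reg Z) : (fun z => p z + q z) ∈ Reg Z :=
  add_mem hp hq

lemma Reg.sum {ι : Type*} {s : Finset ι} {p : ι → Z → ℂ} (hp : ∀ i ∈ s, p i ∈ Reg Z) :
    (fun z => ∑ i ∈ s, p i z) ∈ Reg Z := by
  have := sum_mem hp
  rwa [show (fun z => ∑ i ∈ s, p i z) = ∑ i ∈ s, p i by ext; simp]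

lemma Reg.prod {ι : Type*} {s : Finset ι} {p : ι → Z → ℂ} (hp : ∀ i ∈ s, p i ∈ Reg Z) :
    (fun z => ∏ i ∈ s, p i z) ∈ Reg Z := by
  have := prod_mem hp
  rwa [show (fun z => ∏ i ∈ s, p i z) = ∏ i ∈ s, p i by ext; simp]

lemma Reg.linear [FiniteDimensional ℂ Z] (ξ : Z →ₗ[ℂ] ℂ) : (fun z => ξ z) ∈ Reg Z :=
  ⟨ξ.continuous_of_finiteDimensional, fun g h =>
    ⟨Polynomial.C (ξ g) + Polynomial.C (ξ h) * Polynomial.X, fun t => by simp; ring⟩⟩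

lemma Reg.comp {Z' : Type*} [NormedAddCommGroup Z'] [NormedSpace ℂ Z'] [FiniteDimensional ℂ Z]
    {p : Z' → ℂ} (hp : p ∈ Reg Z') (L : Z →ₗ[ℂ] Z') (c : Z') :
    (fun z => p (c + L z)) ∈ Reg Z := by
  refine ⟨hp.1.comp (continuous_const.add L.continuous_of_finiteDimensional), fun g h => ?_⟩
  obtain ⟨q, hq⟩ := hp.2 (c + L g) (L h)
  exact ⟨q, fun t => by simp [← hq, add_assoc]⟩

lemma Reg.comp_linear {Z' : Type*} [NormedAddCommGroup Z'] [NormedSpace ℂ Z']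
    [FiniteDimensional ℂ Z] {p : Z' → ℂ} (hp : p ∈ Reg Z') (L : Z →ₗ[ℂ] Z') :
    (fun z => p (L z)) ∈ Reg Z := by
  simpa using Reg.comp hp L 0

/-- A nonzero regular function does not vanish identically on a nonempty open set. -/
lemma Reg.exists_ne_zero {p : Z → ℂ} (hp : p ∈ Reg Z) {z₁ : Z} (h₁ : p z₁ ≠ 0) {U : Set Z}
    (hU : IsOpen U) {z₀ : Z} (h₀ : z₀ ∈ U) : ∃ z ∈ U, p z ≠ 0 := by
  obtain ⟨q, hq⟩ := hp.2 z₀ (z₁ - z₀)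
  have hq0 : q ≠ 0 := by
    rintro rfl
    have := hq 1
    simp at this
    exact h₁ this
  have hc : Continuous fun t : ℂ => z₀ + t • (z₁ - z₀) := by fun_prop
  have hV : IsOpen ((fun t : ℂ => z₀ + t • (z₁ - z₀)) ⁻¹' U) := hU.preimage hc
  have hinf : ((fun t : ℂ => z₀ + t • (z₁ - z₀)) ⁻¹' U).Infinite :=
    infinite_of_mem_nhds (0 : ℂ) (hV.mem_nhds (by simpa using h₀))
  obtain ⟨t, ht, htr⟩ := hinf.exists_notMem_finset q.roots.toFinset
  refine ⟨_, ht, ?_⟩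
  rw [hq]
  simpa [hq0] using htr

lemma Reg.exists_ne_zero₂ {p q : Z → ℂ} (hp : p ∈ Reg Z) (hq : q ∈ Reg Z)
    (hp0 : ∃ z, p z ≠ 0) (hq0 : ∃ z, q z ≠ 0) : ∃ z, p z ≠ 0 ∧ q z ≠ 0 := by
  obtain ⟨z, hz⟩ := hp0
  obtain ⟨w, hw⟩ := hq0
  obtain ⟨v, hv, hv'⟩ := Reg.exists_ne_zero hq hw (isOpen_ne_fun hp.1 continuous_const) hz
  exact ⟨v, hv, hv'⟩

lemma Reg.exists_forall_ne_zero {ι : Type*} (s : Finset ι) {p : ι → Z → ℂ}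
    (hp : ∀ i ∈ s, p i ∈ Reg Z) (hp0 : ∀ i ∈ s, ∃ z, p i z ≠ 0) :
    ∃ z, ∀ i ∈ s, p i z ≠ 0 := by
  classical
  suffices ∃ z, ∏ i ∈ s, p i z ≠ 0 by
    obtain ⟨z, hz⟩ := this
    exact ⟨z, Finset.prod_ne_zero_iff.1 hz⟩
  induction s using Finset.induction_on with
  | empty => exact ⟨0, by simp⟩
  | insert a s ha ih =>
    have h1 := ih (fun i hi => hp i (Finset.mem_insert_of_mem hi))
      (fun i hi => hp0 i (Finset.mem_insert_of_mem hi))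
    obtain ⟨z, hz, hz'⟩ := Reg.exists_ne_zero₂ (hp a (Finset.mem_insert_self _ _))
      (Reg.prod fun i hi => hp i (Finset.mem_insert_of_mem hi))
      (hp0 a (Finset.mem_insert_self _ _)) h1
    exact ⟨z, by rw [Finset.prod_insert ha]; exact mul_ne_zero hz hz'⟩

/-- A regular function that vanishes on a nonempty open set is zero. -/
lemma Reg.eq_zero {p : Z → ℂ} (hp : p ∈ Reg Z) {z₀ : Z} (h : ∀ᶠ z in nhds z₀, p z = 0) (z : Z) :
    p z = 0 := by
  by_contra hz
  obtain ⟨U, hU, hUo, h0⟩ := mem_nhds_iff.1 h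
  obtain ⟨w, hw, hw'⟩ := Reg.exists_ne_zero hp hz hUo h0
  exact hw' (hU hw)

section Families

variable {E F : Type*} [AddCommGroup E] [Module ℂ E] [AddCommGroup F] [Module ℂ F]

/-- A family of linear maps with matrix coefficients in an algebra of functions. -/
def FamL {Z : Type*} (A : Subalgebra ℂ (Z → ℂ)) (T : Z → E →ₗ[ℂ] F) : Prop :=
  ∀ (v : E) (ξ : F →ₗ[ℂ] ℂ), (fun z => ξ (T z v)) ∈ A

/-- A family of linear maps with regular matrix coefficients. -/
abbrev RegL (T : Z → E →ₗ[ℂ] F) : Prop := FamL (Reg Z) T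

lemma FamL.comp {Z : Type*} {A : Subalgebra ℂ (Z → ℂ)} {T : Z → E →ₗ[ℂ] F} (hT : FamL A T)
    {E' F' : Type*} [AddCommGroup E'] [Module ℂ E']
    [AddCommGroup F'] [Module ℂ F'] (a : E' →ₗ[ℂ] E) (b : F →ₗ[ℂ] F') :
    FamL A fun z => b ∘ₗ T z ∘ₗ a := fun v ξ => hT (a v) (ξ ∘ₗ b)

lemma FamL.det {Z : Type*} {A : Subalgebra ℂ (Z → ℂ)} {T : Z → E →ₗ[ℂ] E} (hT : FamL A T) :
    (fun z => LinearMap.det (T z)) ∈ A := by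
  classical
  by_cases h : ∃ s : Finset E, Nonempty (Module.Basis s ℂ E)
  · obtain ⟨s, ⟨b⟩⟩ := h
    simp only [← LinearMap.det_toMatrix b, Matrix.det_apply, LinearMap.toMatrix_apply]
    have h : ∀ σ : Equiv.Perm s, (∏ i, fun z => b.repr (T z (b i)) (σ i)) ∈ A := fun σ =>
      prod_mem fun i _ => hT (b i) (b.coord (σ i))
    have h' : (∑ σ : Equiv.Perm s, Equiv.Perm.sign σ •
        ∏ i, fun z => b.repr (T z (b i)) (σ i)) ∈ A := sum_mem fun σ _ =>
      A.toSubmodule.smul_of_tower_mem (Equiv.Perm.sign σ) (h σ)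
    convert h' using 1
    ext z
    simp
  · simp only [LinearMap.det, h, dite_false]
    exact A.algebraMap_mem 1

/-- Cramer's rule for regular families. -/
lemma FamL.exists_cramer [FiniteDimensional ℂ E] {T : Z → E →ₗ[ℂ] E} (hT : RegL T)
    (ξ : E →ₗ[ℂ] ℂ) (u : E) :
    ∃ p ∈ Reg Z, ∀ z v, T z v = u → LinearMap.det (T z) * ξ v = p z := by
  classical
  let b := Module.finBasis ℂ E
  let A : Z → Matrix _ _ ℂ := fun z => LinearMap.toMatrix b b (T z)
  refine ⟨fun z => ∑ i, ξ (b i) * ∑ j, (A z).adjugate i j * b.repr u j, ?_, ?_⟩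
  · refine Reg.sum fun i _ => Reg.mul (Reg.const _) (Reg.sum fun j _ => Reg.mul ?_ (Reg.const _))
    simp only [Matrix.adjugate_apply, Matrix.det_apply]
    refine Reg.sum fun σ _ => ?_
    have : (fun z => ∏ k, (A z).updateRow j (Pi.single i 1) (σ k) k) ∈ Reg Z := by
      refine Reg.prod fun k _ => ?_
      by_cases hj : σ k = j
      · simp only [hj, Matrix.updateRow_self]
        exact Reg.const _
      · simp only [Matrix.updateRow_ne hj, A, LinearMap.toMatrix_apply]
        exact hT (b k) (b.coord (σ k))
    exact (Reg Z).toSubmodule.smul_of_tower_mem (Equiv.Perm.sign σ) this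
  · intro z v hv
    have h1 : A z *ᵥ b.repr v = b.repr u := by
      rw [← hv]
      exact LinearMap.toMatrix_mulVec_repr b b (T z) v
    have h2 : (A z).adjugate *ᵥ (b.repr u) = (A z).det • (b.repr v : _ → ℂ) := by
      rw [← h1, Matrix.mulVec_mulVec, Matrix.adjugate_mul, Matrix.smul_mulVec, Matrix.one_mulVec]
    have h3 : ∀ i, ∑ j, (A z).adjugate i j * b.repr u j = (A z).det * b.repr v i :=
      fun i => congrFun h2 i
    simp only [h3]
    conv_lhs => rw [← b.sum_repr v]
    simp only [map_sum, map_smul, smul_eq_mul, A, LinearMap.det_toMatrix, Finset.mul_sum]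
    exact Finset.sum_congr rfl fun i _ => by ring

/-- Rank is lower semicontinuous. -/
lemma FamL.exists_rank {Z : Type*} {A : Subalgebra ℂ (Z → ℂ)} [FiniteDimensional ℂ E]
    [FiniteDimensional ℂ F] {T : Z → E →ₗ[ℂ] F} (hT : FamL A T) (z₀ : Z) :
    ∃ p ∈ A, p z₀ ≠ 0 ∧ ∀ z, p z ≠ 0 →
      Module.finrank ℂ (LinearMap.range (T z₀)) ≤ Module.finrank ℂ (LinearMap.range (T z)) := by
  let R := LinearMap.range (T z₀)
  obtain ⟨a, ha⟩ := (T z₀).rangeRestrict.exists_rightInverse_of_surjective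
    (LinearMap.range_rangeRestrict _)
  obtain ⟨b, hb⟩ := R.subtype.exists_leftInverse_of_injective (Submodule.ker_subtype R)
  refine ⟨fun z => LinearMap.det (b ∘ₗ T z ∘ₗ a), (hT.comp a b).det, ?_, fun z hz => ?_⟩
  · have : b ∘ₗ T z₀ ∘ₗ a = LinearMap.id := by
      ext v
      have h1 := LinearMap.congr_fun ha v
      have h2 := LinearMap.congr_fun hb v
      have h3 : T z₀ (a v) = v := congrArg Subtype.val h1
      simp only [LinearMap.comp_apply, h3]
      exact congrArg Subtype.val h2
    simp [this]
  · have hbij := (LinearMap.equivOfDetNeZero _ hz).surjective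
    have hle : ∀ w : R, ∃ v : LinearMap.range (T z),
        (b ∘ₗ (LinearMap.range (T z)).subtype) v = w := by
      intro w
      obtain ⟨v, hv⟩ := hbij w
      exact ⟨⟨T z (a v), LinearMap.mem_range_self _ _⟩, hv⟩
    exact LinearMap.finrank_le_finrank_of_surjective hle

end Families

/-- The rank jumps in a pencil `L₀ + t L₁` if `L₁` maps some element of the kernel of `L₀` out of
the range of `L₀`. -/
lemma exists_pencil {E F : Type*} [AddCommGroup E] [Module ℂ E] [AddCommGroup F] [Module ℂ F]
    [FiniteDimensional ℂ E] [FiniteDimensional ℂ F] (L₀ L₁ : E →ₗ[ℂ] F) (k : E)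
    (hk : L₀ k = 0) (hk' : L₁ k ∉ LinearMap.range L₀) :
    ∃ p ∈ Reg ℂ, (∃ t, p t ≠ 0) ∧ ∀ t, p t ≠ 0 →
      Module.finrank ℂ (LinearMap.range L₀) <
        Module.finrank ℂ (LinearMap.range (L₀ + t • L₁)) := by
  let T : ℂ → (E × ℂ →ₗ[ℂ] F) := fun t =>
    (L₀ + t • L₁).coprod (LinearMap.toSpanSingleton ℂ F (L₁ k))
  have hT : RegL T := by
    rintro ⟨v, c⟩ ξ
    have h1 : (fun t : ℂ => t) ∈ Reg ℂ := Reg.linear LinearMap.id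
    have : (fun t => ξ (T t (v, c))) = fun t => (ξ (L₀ v) + c * ξ (L₁ k)) + t * ξ (L₁ v) := by
      ext t
      simp [T]
      ring
    rw [this]
    exact Reg.add (Reg.const _) (Reg.mul h1 (Reg.const _))
  obtain ⟨p, hp, hp0, hpr⟩ := hT.exists_rank 0
  have h1 : (fun t : ℂ => t) ∈ Reg ℂ := Reg.linear LinearMap.id
  obtain ⟨t₀, ht₀, ht₀'⟩ := Reg.exists_ne_zero₂ hp h1 ⟨0, hp0⟩ ⟨1, one_ne_zero⟩
  refine ⟨fun t => p t * t, Reg.mul hp h1, ⟨t₀, mul_ne_zero ht₀ ht₀'⟩, fun t ht => ?_⟩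
  have h0 : LinearMap.range L₀ < LinearMap.range (T 0) := by
    refine lt_of_le_of_ne ?_ (fun h => hk' (h ▸ ?_))
    · rintro _ ⟨v, rfl⟩
      exact ⟨(v, 0), by simp [T]⟩
    · exact ⟨(0, 1), by simp [T]⟩
  have h2 : LinearMap.range (T t) ≤ LinearMap.range (L₀ + t • L₁) := by
    rintro _ ⟨⟨v, c⟩, rfl⟩
    refine ⟨v + (c * t⁻¹) • k, ?_⟩
    have htne := right_ne_zero_of_mul ht
    simp [T, hk, smul_smul, mul_left_comm t, htne, add_assoc]
  calc _ < _ := Submodule.finrank_lt_finrank_of_lt h0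
    _ ≤ _ := hpr t (left_ne_zero_of_mul ht)
    _ ≤ _ := Submodule.finrank_mono h2

end Regular

section RegularCokernel

variable [Fintype Q.A] [hac : Fact (QAcyclic Q)] {S : Set (FormalRel Q)} {κ δ : Q.V → ℕ}

/-- `Bf f` relative to a fixed canonical map. -/
def Tf {f₀ : H S κ δ} (h₀ : Can f₀) (x : Q.V) (f : H S κ δ) : PX S δ x →ₗ[ℂ] PX S δ x :=
  Bf f x ∘ₗ (LinearEquiv.ofBijective (Bf f₀ x) (h₀ x)).symm.toLinearMap

lemma regL_Tf {f₀ : H S κ δ} (h₀ : Can f₀) (x : Q.V) : RegL (Tf h₀ x) := by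
  intro v ξ
  set uw := (LinearEquiv.ofBijective (Bf f₀ x) (h₀ x)).symm v with huw
  have : (fun f => ξ (Tf h₀ x f v)) =
      fun f => (ξ ∘ₗ (lftL S (P S δ) κ x).flip uw.1) f + ξ (std S δ x uw.2) := by
    funext f
    simp only [Tf, LinearMap.comp_apply, LinearEquiv.coe_coe, ← huw]
    rw [← Prod.mk.eta (p := uw), Bf_apply, map_add]
    rfl
  rw [this]
  exact Reg.add (Reg.linear _) (Reg.const _)

lemma det_Tf_ne_zero {f₀ : H S κ δ} (h₀ : Can f₀) (x : Q.V) (f : H S κ δ) :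
    LinearMap.det (Tf h₀ x f) ≠ 0 ↔ Function.Bijective (Bf f x) := by
  have hb : Function.Bijective (Bf f x) ↔ Function.Bijective (Tf h₀ x f) :=
    (Function.Bijective.of_comp_iff (Bf f x)
      (LinearEquiv.ofBijective (Bf f₀ x) (h₀ x)).symm.bijective).symm
  rw [hb]
  constructor
  · intro h
    exact (LinearMap.equivOfDetNeZero _ h).bijective
  · intro h
    exact (LinearEquiv.isUnit_det' (LinearEquiv.ofBijective _ h)).ne_zero

/-- The coordinates of the cokernel are quotients of regular functions. -/
lemma exists_reg_coord {f₀ : H S κ δ} (h₀ : Can f₀) (c : RepCoord (Q := Q) δ) :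
    ∃ p ∈ Reg (H S κ δ), ∀ f, Can f →
      LinearMap.det (Tf h₀ (Q.h c.1) f) * repCoords (Vf f) c = p f := by
  obtain ⟨a, i, j⟩ := c
  let v : PX S δ (Q.h a) := (P S δ).ρ (x := Q.t a) (y := Q.h a) ⟨a, rfl, rfl⟩
    (std S δ (Q.t a) (Pi.single j 1))
  let e := LinearEquiv.ofBijective (Bf f₀ (Q.h a)) (h₀ (Q.h a))
  obtain ⟨p, hp, h⟩ := (regL_Tf h₀ (Q.h a)).exists_cramer
    (LinearMap.proj i ∘ₗ LinearMap.snd ℂ _ _ ∘ₗ e.symm.toLinearMap) v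
  refine ⟨p, hp, fun f hf => ?_⟩
  obtain ⟨u, w, huw⟩ := hf.exists_eq v
  rw [← h f (e (u, w))]
  · congr 1
    have : repCoords (Vf f) ⟨a, i, j⟩ = (Vf f a).mulVecLin (Pi.single j 1) i := by
      simp [repCoords]
    rw [this, Vf_apply]
    change rf f _ v i = _
    rw [huw, hf.rf_apply]
    simp
  · simp only [Tf, LinearMap.comp_apply, LinearEquiv.coe_coe, e, LinearEquiv.symm_apply_apply]
    rw [Bf_apply, ← huw]

/-- The nonvanishing of a polynomial on canonical cokernels is the nonvanishing of a regular
function. -/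
theorem exists_reg (S : Set (FormalRel Q)) (κ : Q.V → ℕ)
    (p : MvPolynomial (RepCoord (Q := Q) δ) ℂ) :
    ∃ P ∈ Reg (H S κ δ), ∀ f, P f ≠ 0 ↔
      Can f ∧ MvPolynomial.eval (repCoords (Vf f)) p ≠ 0 := by
  by_cases h : ∃ f₀ : H S κ δ, Can f₀
  swap
  · exact ⟨_, Reg.const 0, fun f => by
      simp only [ne_eq, not_true_eq_false, false_iff, not_and]
      exact fun hf => (h ⟨f, hf⟩).elim⟩
  obtain ⟨f₀, h₀⟩ := h
  let D : H S κ δ → ℂ := fun f => ∏ x, LinearMap.det (Tf h₀ x f)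
  have hD : D ∈ Reg (H S κ δ) := Reg.prod fun x _ => (regL_Tf h₀ x).det
  have hDC : ∀ f, D f ≠ 0 ↔ Can f := fun f => by
    simp only [D, Finset.prod_ne_zero_iff, Finset.mem_univ, true_imp_iff, det_Tf_ne_zero]
    rfl
  have key : ∃ (N : ℕ) (P : H S κ δ → ℂ), P ∈ Reg (H S κ δ) ∧ ∀ f, Can f →
      D f ^ N * MvPolynomial.eval (repCoords (Vf f)) p = P f := by
    induction p using MvPolynomial.induction_on with
    | C c => exact ⟨0, _, Reg.const c, by simp⟩
    | add p q hp hq =>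
      obtain ⟨N, P, hP, h⟩ := hp
      obtain ⟨N', P', hP', h'⟩ := hq
      refine ⟨N + N', _, Reg.add (Reg.mul (pow_mem hD N') hP) (Reg.mul (pow_mem hD N) hP'),
        fun f hf => ?_⟩
      rw [← h f hf, ← h' f hf, map_add, pow_add, Pi.pow_apply, Pi.pow_apply]
      ring
    | mul_X p c hp =>
      obtain ⟨N, P, hP, h⟩ := hp
      obtain ⟨P', hP', h'⟩ := exists_reg_coord h₀ c
      refine ⟨N + 1, _, Reg.mul hP (Reg.mul hP' (Reg.prod (s := Finset.univ.erase (Q.h c.1))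
        fun x _ => (regL_Tf h₀ x).det)), fun f hf => ?_⟩
      rw [← h f hf, ← h' f hf, map_mul, MvPolynomial.eval_X, pow_succ]
      nth_rewrite 2 [show D f = ∏ x, LinearMap.det (Tf h₀ x f) from rfl]
      rw [← Finset.mul_prod_erase _ _ (Finset.mem_univ (Q.h c.1))]
      ring
  obtain ⟨N, P, hP, h⟩ := key
  refine ⟨_, Reg.mul hD hP, fun f => ?_⟩
  rw [mul_ne_zero_iff, hDC, and_congr_right_iff]
  intro hf
  rw [← h f hf, mul_ne_zero_iff, and_iff_right (pow_ne_zero _ ((hDC f).2 hf))]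

lemma exists_reg_can (S : Set (FormalRel Q)) (κ δ : Q.V → ℕ) :
    ∃ P ∈ Reg (H S κ δ), ∀ f, P f ≠ 0 ↔ Can f := by
  obtain ⟨P, hP, h⟩ := exists_reg (δ := δ) S κ 1
  exact ⟨P, hP, fun f => by simp [h]⟩

end RegularCokernel

section Ext

variable [Fintype Q.A] [hac : Fact (QAcyclic Q)] {S : Set (FormalRel Q)}
  {κ₁ δ₁ κ₂ δ₂ : Q.V → ℕ}

/-- The map `(X, Y) ↦ X ∘ f + g ∘ Y`. -/
def Lm (f : H S κ₁ δ₁) (g : H S κ₂ δ₂) : (H S δ₁ δ₂ × H S κ₁ κ₂) →ₗ[ℂ] H S κ₁ δ₂ :=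
  (cmpL S (P S δ₂) κ₁ δ₁ f).coprod ((cmpL S (P S δ₂) κ₁ κ₂).flip g)

lemma Lm_apply (f : H S κ₁ δ₁) (g : H S κ₂ δ₂) (X : H S δ₁ δ₂) (Y : H S κ₁ κ₂) :
    Lm f g (X, Y) = cmp S (P S δ₂) f X + cmp S (P S δ₂) Y g := rfl

lemma finrank_map_add {A B : Type*} [AddCommGroup A] [Module ℂ A] [AddCommGroup B] [Module ℂ B]
    [FiniteDimensional ℂ A] (π : A →ₗ[ℂ] B) (hπ : Function.Surjective π) (R : Submodule ℂ A)
    (hR : LinearMap.ker π ≤ R) :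
    Module.finrank ℂ R + Module.finrank ℂ B =
      Module.finrank ℂ (R.map π) + Module.finrank ℂ A := by
  have h1 := (π ∘ₗ R.subtype).finrank_range_add_finrank_ker
  have h2 := π.finrank_range_add_finrank_ker
  rw [LinearMap.range_eq_top.2 hπ, finrank_top] at h2
  rw [LinearMap.range_comp, Submodule.range_subtype, LinearMap.ker_comp,
    (Submodule.comapSubtypeEquivOfLe hR).finrank_eq] at h1
  omega

/-- The rank of `X ∘ f + g ∘ Y` in terms of the cokernel of `g`. -/
lemma Can.finrank_range_Lm {g : H S κ₂ δ₂} (hg : Can g) (f : H S κ₁ δ₁) :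
    Module.finrank ℂ (LinearMap.range (Lm f g)) + Module.finrank ℂ (Y κ₁ (ofQ (Vf g))) =
      Module.finrank ℂ (LinearMap.range (cmpL S (ofQ (Vf g)) κ₁ δ₁ f)) +
        Module.finrank ℂ (H S κ₁ δ₂) := by
  let π : ∀ κ : Q.V → ℕ, H S κ δ₂ →ₗ[ℂ] Y κ (ofQ (Vf g)) := fun κ =>
    LinearMap.pi fun x => LinearMap.pi fun k => rf g x ∘ₗ LinearMap.proj k ∘ₗ LinearMap.proj x
  have hπ : ∀ κ h x k, π κ h x k = rf g x (h x k) := fun _ _ _ _ => rfl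
  have hsurj : ∀ κ, Function.Surjective (π κ) := by
    intro κ m
    exact ⟨fun x k => std S δ₂ x (m x k), by funext x k; exact hg.rf_std _⟩
  have hker : LinearMap.ker (π κ₁) ≤ LinearMap.range (Lm f g) := by
    intro h hh
    have h1 : ∀ x k, ∃ u, lft S (P S δ₂) g x u = h x k := by
      intro x k
      have : h x k ∈ LinearMap.ker (rf g x) := congrFun (congrFun hh x) k
      rwa [hg.ker_rf] at this
    choose u hu using h1
    refine ⟨(0, u), ?_⟩
    rw [Lm_apply, ← cmpL_apply, map_zero, zero_add]
    funext x k
    exact hu x k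
  have hnat : ∀ X : H S δ₁ δ₂, π κ₁ (cmp S (P S δ₂) f X) = cmp S (ofQ (Vf g)) f (π δ₁ X) := by
    intro X
    funext x k
    exact hg.rf_hom.lft X (f x k)
  have hz : ∀ W : H S κ₁ κ₂, π κ₁ (cmp S (P S δ₂) W g) = 0 := by
    intro W
    funext x k
    exact hg.rf_lft (W x k)
  have hmap : (LinearMap.range (Lm f g)).map (π κ₁) =
      LinearMap.range (cmpL S (ofQ (Vf g)) κ₁ δ₁ f) := by
    ext m
    constructor
    · rintro ⟨_, ⟨⟨X, W⟩, rfl⟩, rfl⟩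
      exact ⟨π δ₁ X, by rw [Lm_apply, map_add, hnat, hz, add_zero]; rfl⟩
    · rintro ⟨m, rfl⟩
      obtain ⟨X, rfl⟩ := hsurj δ₁ m
      exact ⟨_, ⟨(X, 0), rfl⟩, by rw [Lm_apply, map_add, hnat, hz, add_zero]; rfl⟩
  rw [finrank_map_add (π κ₁) (hsurj κ₁) _ hker, hmap]

/-- Homomorphisms out of a cokernel. -/
lemma Can.dimHom_add {f : H S κ₁ δ₁} (hf : Can f) {β : Q.V → ℕ} {V : QRep Q β}
    (hV : IsMod S (ofQ V)) :
    dimHom (Vf f) V + Module.finrank ℂ (LinearMap.range (cmpL S (ofQ V) κ₁ δ₁ f)) =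
      Module.finrank ℂ (Y δ₁ (ofQ V)) := by
  let c : HomS (Vf f) V →ₗ[ℂ] Y δ₁ (ofQ V) :=
    { toFun := fun h x k i => h.1 x i k
      map_add' := fun _ _ => rfl
      map_smul' := fun _ _ => rfl }
  have hcinj : Function.Injective c := by
    intro h h' hh
    apply Subtype.ext
    funext x
    ext i k
    exact congrFun (congrFun (congrFun hh x) k) i
  have hrange : LinearMap.range c = LinearMap.ker (cmpL S (ofQ V) κ₁ δ₁ f) := by
    ext m
    constructor
    · rintro ⟨⟨h, hh⟩, rfl⟩
      rw [mem_HomS_iff] at hh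
      have h1 := hh.comp hf.rf_hom
      have h2 : ∀ x k, c ⟨h, (mem_HomS_iff _ _ _).2 hh⟩ x k =
          ((h x).mulVecLin ∘ₗ rf f x) (gen S δ₁ x k) := by
        intro x k
        have : gen S δ₁ x k = std S δ₁ x (Pi.single k 1) := by
          simp [std_apply, Pi.single_apply]
        rw [this, LinearMap.comp_apply, hf.rf_std]
        funext i
        change h x i k = _
        simp
      rw [LinearMap.mem_ker, cmpL_apply]
      have h3 : c ⟨h, (mem_HomS_iff _ _ _).2 hh⟩ =
          fun x k => ((h x).mulVecLin ∘ₗ rf f x) (gen S δ₁ x k) := by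
        funext x k
        exact h2 x k
      rw [h3]
      funext x k
      rw [cmp, ← hom_eq_lft h1, LinearMap.comp_apply]
      have := hf.rf_lft (gen S κ₁ x k)
      rw [lft_gen (isMod_P δ₁)] at this
      rw [this, map_zero]
      rfl
    · intro hm
      rw [LinearMap.mem_ker, cmpL_apply] at hm
      have hz : ∀ x u, lft S (ofQ V) m x (lft S (P S δ₁) f x u) = 0 := by
        intro x u
        rw [← lft_cmp hV, hm]
        simp [lft]
      have hfac : ∀ x v, lft S (ofQ V) m x v =
          (LinearMap.toMatrix' (lft S (ofQ V) m x ∘ₗ std S δ₁ x)).mulVecLin (rf f x v) := by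
        intro x v
        obtain ⟨u, w, rfl⟩ := hf.exists_eq v
        rw [hf.rf_apply, map_add, hz, zero_add, ← Matrix.toLin'_apply', Matrix.toLin'_toMatrix']
        rfl
      have hh : (fun x => LinearMap.toMatrix' (lft S (ofQ V) m x ∘ₗ std S δ₁ x)) ∈
          HomS (Vf f) V := by
        rw [mem_HomS_iff]
        intro x y e w
        obtain ⟨v, rfl⟩ := hf.rf_surjective x w
        rw [← hf.rf_hom e, ← hfac, ← hfac]
        exact lft_hom hV m e v
      refine ⟨⟨_, hh⟩, ?_⟩
      funext x k i
      change LinearMap.toMatrix' (lft S (ofQ V) m x ∘ₗ std S δ₁ x) i k = _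
      rw [LinearMap.toMatrix'_apply, LinearMap.comp_apply, lft_std hV]
      simp [Pi.single_apply]
  have h1 := LinearMap.finrank_range_of_inj hcinj
  have h2 := (cmpL S (ofQ V) κ₁ δ₁ f).finrank_range_add_finrank_ker
  rw [← hrange, h1] at h2
  rw [dimHom, ← h2, add_comm]

lemma finrank_Y_ofQ (κ : Q.V → ℕ) {β : Q.V → ℕ} (V : QRep Q β) :
    Module.finrank ℂ (Y κ (ofQ V)) = ∑ x, κ x * β x := by
  rw [Module.finrank_pi_fintype]
  refine Finset.sum_congr rfl fun x _ => ?_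
  change Module.finrank ℂ (Fin (κ x) → Fin (β x) → ℂ) = _
  rw [Module.finrank_pi_fintype]
  simp

/-- The dimension of the space of homomorphisms between two cokernels. -/
lemma Can.dimHom_Lm {f : H S κ₁ δ₁} (hf : Can f) {g : H S κ₂ δ₂} (hg : Can g) :
    dimHom (Vf f) (Vf g) + Module.finrank ℂ (LinearMap.range (Lm f g)) + ∑ x, κ₁ x * δ₂ x =
      ∑ x, δ₁ x * δ₂ x + Module.finrank ℂ (H S κ₁ δ₂) := by
  have h1 := hg.finrank_range_Lm f
  have h2 := hf.dimHom_add hg.isMod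
  rw [finrank_Y_ofQ] at h1 h2
  omega

end Ext

section Dimension

open Topology in
/-- The set of zeros of a map at which its derivative is surjective has the expected dimension. -/
lemma dimH_zeros_le {E F : Type*} [NormedAddCommGroup E] [NormedSpace ℂ E] [FiniteDimensional ℂ E]
    [NormedAddCommGroup F] [NormedSpace ℂ F] [FiniteDimensional ℂ F] {G : E → F}
    (hG : ContDiff ℂ 1 G) :
    dimH {z | G z = 0 ∧ Function.Surjective (fderiv ℂ G z)} ≤
      ((2 * (Module.finrank ℂ E - Module.finrank ℂ F) : ℕ) : ENNReal) := by
  have : CompleteSpace E := FiniteDimensional.complete ℂ E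
  by_contra! h
  obtain ⟨x, ⟨hx0, hxs⟩, hx⟩ := exists_mem_nhdsWithin_lt_dimH_of_lt_dimH h
  have hf : HasStrictFDerivAt G (fderiv ℂ G x) x := hG.contDiffAt.hasStrictFDerivAt (by simp)
  have hr : (fderiv ℂ G x).range = ⊤ := LinearMap.range_eq_top.2 hxs
  obtain ⟨K, s, hs, hL⟩ := (hf.to_implicitFunction hr).exists_lipschitzOnWith
  have hev := hf.eq_implicitFunction hr
  have hc : Filter.Tendsto (fun z => (hf.implicitToOpenPartialHomeomorph _ _ hr z).2) (𝓝 x)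
      (𝓝 0) := by
    have h1 := (hf.implicitToOpenPartialHomeomorph _ _ hr).continuousAt
      (hf.mem_implicitToOpenPartialHomeomorph_source hr)
    have h2 := (continuous_snd.tendsto _).comp h1
    rw [hf.implicitToOpenPartialHomeomorph_self hr] at h2
    exact h2
  have hW := hev.and (hc.eventually hs)
  have hlt := hx _ (Filter.inter_mem (mem_nhdsWithin_of_mem_nhds hW) self_mem_nhdsWithin)
  refine absurd hlt (not_lt.2 ?_)
  have hsub : {z | hf.implicitFunction G _ hr (G z)
      (hf.implicitToOpenPartialHomeomorph _ _ hr z).2 = z ∧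
      s (hf.implicitToOpenPartialHomeomorph _ _ hr z).2} ∩
      {z | G z = 0 ∧ Function.Surjective (fderiv ℂ G z)} ⊆
      hf.implicitFunction G _ hr (G x) '' s := by
    rintro z ⟨⟨h1, h2⟩, h3, -⟩
    refine ⟨_, h2, ?_⟩
    rw [hx0, ← h3]
    exact h1
  calc _ ≤ dimH (hf.implicitFunction G _ hr (G x) '' s) := dimH_mono hsub
    _ ≤ dimH s := hL.dimH_image_le
    _ ≤ dimH (Set.univ : Set (fderiv ℂ G x).ker) := dimH_mono (Set.subset_univ _)
    _ = _ := by
      rw [Real.dimH_univ_eq_finrank, finrank_real_of_complex]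
      have h1 := (fderiv ℂ G x).toLinearMap.finrank_range_add_finrank_ker
      have h2 : (fderiv ℂ G x).toLinearMap.range = ⊤ := hr
      rw [h2, finrank_top] at h1
      norm_cast
      congr 1
      exact Nat.eq_sub_of_add_eq' h1

/-- A subspace has a complement spanned by elements of a given basis. -/
lemma exists_complement {V ι : Type*} [AddCommGroup V] [Module ℂ V] [FiniteDimensional ℂ V]
    (b : Module.Basis ι ℂ V) (K : Submodule ℂ V) :
    ∃ J : Finset ι, J.card + Module.finrank ℂ K = Module.finrank ℂ V ∧
      ∀ v, ∃ k ∈ K, ∃ y : J → ℂ, v = k + ∑ j, y j • b j := by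
  classical
  obtain ⟨κ, a, ha, hsp, hli⟩ := exists_linearIndependent' ℂ (fun i => K.mkQ (b i))
  have hfin : Finite κ := hli.finite
  have := Fintype.ofFinite κ
  have htop : Submodule.span ℂ (Set.range fun i => K.mkQ (b i)) = ⊤ := by
    have : (Set.range fun i => K.mkQ (b i)) = K.mkQ '' Set.range b := by
      rw [← Set.range_comp]
      rfl
    rw [this, Submodule.span_image, b.span_eq, Submodule.map_top, Submodule.range_mkQ]
  rw [htop] at hsp
  have hcard : Fintype.card κ = Module.finrank ℂ (V ⧸ K) :=
    (Module.finrank_eq_card_basis (Module.Basis.mk hli hsp.ge)).symm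
  let e : κ ≃ (Finset.univ.image a : Finset ι) := Equiv.ofBijective
    (fun k => ⟨a k, Finset.mem_image_of_mem _ (Finset.mem_univ k)⟩)
    ⟨fun i j hij => ha (congrArg Subtype.val hij), fun ⟨j, hj⟩ => by
      obtain ⟨k, -, rfl⟩ := Finset.mem_image.1 hj
      exact ⟨k, rfl⟩⟩
  refine ⟨Finset.univ.image a, ?_, fun v => ?_⟩
  · rw [Finset.card_image_of_injective _ ha, Finset.card_univ, hcard,
      Submodule.finrank_quotient_add_finrank]
  · have hv : K.mkQ v ∈ Submodule.span ℂ (Set.range ((fun i => K.mkQ (b i)) ∘ a)) := by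
      rw [hsp]
      trivial
    obtain ⟨c, hc⟩ := (Submodule.mem_span_range_iff_exists_fun ℂ).1 hv
    refine ⟨v - ∑ k, c k • b (a k), ?_, fun j => c (e.symm j), ?_⟩
    · rw [← Submodule.Quotient.mk_eq_zero, ← Submodule.mkQ_apply, map_sub, ← hc]
      simp
    · rw [← e.sum_comp]
      simp only [Equiv.symm_apply_apply]
      exact (sub_add_cancel v (∑ k, c k • b (a k))).symm

end Dimension

section Transversality

variable {E Y₀ Y₁ : Type*} [NormedAddCommGroup E] [NormedSpace ℂ E] [FiniteDimensional ℂ E]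
  [NormedAddCommGroup Y₀] [NormedSpace ℂ Y₀] [FiniteDimensional ℂ Y₀]
  [NormedAddCommGroup Y₁] [NormedSpace ℂ Y₁] [FiniteDimensional ℂ Y₁]

/-- A kernel containing a transversal element meets a translate from a dense family. -/
lemma exists_slice (B : E →ₗ[ℂ] Y₀ →ₗ[ℂ] Y₁) {ι : Type*} (b : Module.Basis ι ℂ Y₀)
    (d : ℕ → Y₀) (hd : DenseRange d) (f : E) (φ : Y₀) (h0 : B f φ = 0)
    (hφ : Function.Surjective fun h => B h φ)
    (hr : Module.finrank ℂ (LinearMap.range (B f)) + 2 ≤ Module.finrank ℂ Y₁) :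
    ∃ (n : ℕ) (J : Finset ι) (y : J → ℂ), J.card + 2 ≤ Module.finrank ℂ Y₁ ∧
      B f (d n + ∑ j, y j • b j) = 0 ∧
      Function.Surjective fun h => B h (d n + ∑ j, y j • b j) := by
  obtain ⟨J, hJ, hdec⟩ := exists_complement b (LinearMap.ker (B f))
  have h1 := (B f).finrank_range_add_finrank_ker
  let s : (LinearMap.ker (B f) × (J → ℂ)) →ₗ[ℂ] Y₀ :=
    (LinearMap.ker (B f)).subtype.coprod (Fintype.linearCombination ℂ fun j : J => b j)
  have hs : Function.Surjective s := by
    intro v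
    obtain ⟨k, hk, y, rfl⟩ := hdec v
    exact ⟨(⟨k, hk⟩, y), by simp [s, Fintype.linearCombination_apply]⟩
  obtain ⟨σ, hσ⟩ := s.exists_rightInverse_of_surjective (LinearMap.range_eq_top.2 hs)
  have hσ' : ∀ v, v = (σ v).1.1 + ∑ j, (σ v).2 j • b j := fun v => by
    have := LinearMap.congr_fun hσ v
    simpa [s, Fintype.linearCombination_apply] using this.symm
  have hreg : RegL fun ψ : Y₀ => B.flip ψ := fun v ξ => Reg.linear (ξ ∘ₗ B v)
  obtain ⟨p, hp, hp0, hpr⟩ := hreg.exists_rank φ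
  let k : Y₀ →ₗ[ℂ] Y₀ := (LinearMap.ker (B f)).subtype ∘ₗ LinearMap.fst ℂ _ _ ∘ₗ σ
  have hq : Continuous fun w => p (φ + k (w - φ)) :=
    hp.1.comp (continuous_const.add (k.continuous_of_finiteDimensional.comp
      (continuous_id.sub continuous_const)))
  obtain ⟨n, hn⟩ := hd.exists_mem_open (isOpen_ne_fun hq continuous_const)
    ⟨φ, by simpa using hp0⟩
  have hz : d n + ∑ j, (-(σ (d n - φ)).2 j) • b j = φ + k (d n - φ) := by
    have h2 := hσ' (d n - φ)
    have h3 : k (d n - φ) = (σ (d n - φ)).1.1 := rfl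
    rw [← h3] at h2
    simp only [neg_smul, Finset.sum_neg_distrib]
    rw [← sub_eq_add_neg, sub_eq_iff_eq_add, add_assoc, ← h2]
    abel
  refine ⟨n, J, fun j => -(σ (d n - φ)).2 j, by omega, ?_, ?_⟩
  · rw [hz, map_add, h0, zero_add]
    exact (σ (d n - φ)).1.2
  · rw [hz]
    have h2 := hpr _ hn
    have h3 : LinearMap.range (B.flip φ) = ⊤ := LinearMap.range_eq_top.2 hφ
    rw [h3, finrank_top] at h2
    exact LinearMap.range_eq_top.1 (Submodule.eq_top_of_finrank_eq
      (le_antisymm (Submodule.finrank_le _) h2))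

/-- One-parameter families with kernels of too small codimension cannot cover an open set. -/
lemma not_covered {I : Type*} [Countable I] (B : I → ℂ → E →ₗ[ℂ] Y₀ →ₗ[ℂ] Y₁)
    (hB : ∀ i, ContDiff ℂ 1 fun z : ℂ × E × Y₀ => B i z.1 z.2.1 z.2.2)
    {O : Set E} (hO : IsOpen O) (hne : O.Nonempty)
    (h : ∀ f ∈ O, ∃ i t φ, B i t f φ = 0 ∧ (Function.Surjective fun h => B i t h φ) ∧
      Module.finrank ℂ (LinearMap.range (B i t f)) + 2 ≤ Module.finrank ℂ Y₁) : False := by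
  classical
  let b := Module.finBasis ℂ Y₀
  have : CompleteSpace Y₀ := FiniteDimensional.complete ℂ Y₀
  have : ProperSpace Y₀ := FiniteDimensional.proper ℂ Y₀
  obtain ⟨d, hd⟩ := TopologicalSpace.exists_dense_seq Y₀
  let G : ∀ (i : I) (n : ℕ) (J : Finset (Fin (Module.finrank ℂ Y₀))),
      E × ℂ × (J → ℂ) → Y₁ := fun i n J z => B i z.2.1 z.1 (d n + ∑ j, z.2.2 j • b j)
  have hG : ∀ i n J, ContDiff ℂ 1 (G i n J) := fun i n J => by
    have : ContDiff ℂ 1 fun z : E × ℂ × (J → ℂ) =>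
        ((z.2.1, z.1, d n + ∑ j, z.2.2 j • b j) : ℂ × E × Y₀) := by fun_prop
    exact (hB i).comp this
  let Z : ∀ (p : I × ℕ × {J : Finset (Fin (Module.finrank ℂ Y₀)) //
      J.card + 2 ≤ Module.finrank ℂ Y₁}), Set (E × ℂ × (p.2.2.1 → ℂ)) := fun p =>
    {z | G p.1 p.2.1 p.2.2.1 z = 0 ∧
      Function.Surjective (fderiv ℂ (G p.1 p.2.1 p.2.2.1) z)}
  have hcov : O ⊆ ⋃ p, Prod.fst '' Z p := by
    intro f hf
    obtain ⟨i, t, φ, h0, hφ, hr⟩ := h f hf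
    obtain ⟨n, J, y, hJ, hz, hs⟩ := exists_slice (B i t) b d hd f φ h0 hφ hr
    refine Set.mem_iUnion.2 ⟨(i, n, ⟨J, hJ⟩), (f, t, y), ⟨hz, fun w => ?_⟩, rfl⟩
    obtain ⟨e, he⟩ := hs w
    refine ⟨(e, 0, 0), ?_⟩
    have h1 := ((hG i n J).differentiable one_ne_zero (f, t, y)).hasFDerivAt.hasLineDerivAt
      (e, 0, 0)
    have h2 : HasDerivAt (fun c : ℂ => G i n J ((f, t, y) + c • (e, 0, 0))) w 0 := by
      have : (fun c : ℂ => G i n J ((f, t, y) + c • (e, 0, 0))) = fun c => c • w := by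
        funext c
        have hz' : B i t f (d n + ∑ j, y j • b j) = 0 := hz
        have he' : B i t e (d n + ∑ j, y j • b j) = w := he
        have h3 : (f, t, y) + c • ((e, 0, 0) : E × ℂ × (J → ℂ)) = (f + c • e, t, y) := by
          simp
        rw [h3]
        change B i t (f + c • e) (d n + ∑ j, y j • b j) = c • w
        rw [map_add (B i t) f, map_smul (B i t), LinearMap.add_apply, LinearMap.smul_apply, hz',
          he', zero_add]
      rw [this]
      simpa using (hasDerivAt_id (0 : ℂ)).smul_const w
    exact HasDerivAt.unique h1 h2
  obtain ⟨f₀, hf₀⟩ := hne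
  obtain ⟨i, t, φ, -, hφ, hr⟩ := h f₀ hf₀
  have hN : Module.finrank ℂ Y₁ ≤ Module.finrank ℂ E :=
    LinearMap.finrank_le_finrank_of_surjective (f := (B i t).flip φ) hφ
  have hdimO : dimH O = Module.finrank ℝ E :=
    Real.dimH_of_nonempty_interior (by rw [hO.interior_eq]; exact ⟨f₀, hf₀⟩)
  have hle : dimH O ≤ ((2 * (Module.finrank ℂ E - 1) : ℕ) : ENNReal) := by
    refine (dimH_mono hcov).trans ?_
    rw [dimH_iUnion]
    refine iSup_le fun p => ?_
    refine (LipschitzWith.prod_fst.dimH_image_le _).trans ?_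
    refine (dimH_zeros_le (hG _ _ _)).trans ?_
    norm_cast
    have := p.2.2.2
    simp only [Module.finrank_prod, Module.finrank_self, Module.finrank_fintype_fun_eq_card,
      Fintype.card_coe]
    omega
  rw [hdimO, finrank_real_of_complex] at hle
  norm_cast at hle
  omega

end Transversality

section Families

open Polynomial

lemma evalPath_polyEvalAt {γ : Q.V → ℕ} (M : RepR Q ℂ[X] γ) (t : ℂ) {x y : Q.V}
    (p : Quiver.Path x y) :
    evalPath (polyEvalAt M t) p = (evalPath M p).map (Polynomial.eval t) := by
  induction p with
  | nil => ext i j; by_cases h : i = j <;> simp [evalPath, Matrix.one_apply, h]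
  | cons p e ih =>
    have h := Matrix.map_mul (f := Polynomial.evalRingHom t)
      (L := castM (congrArg γ e.2.2) (congrArg γ e.2.1) (M e.1)) (M := evalPath M p)
    simp only [evalPath, ih]
    exact h.symm

lemma riso_dim_eq {β γ : Q.V → ℕ} {V : QRep Q β} {W : QRep Q γ} (h : RIso V W) : β = γ := by
  obtain ⟨u, -⟩ := h
  funext x
  simpa using (u x).finrank_eq

/-- Over a tame algebra, the indecomposable modules of a given dimension vector belong to
finitely many one-parameter families. -/
lemma exists_families {S : Set (FormalRel Q)} (h : IsTame S) (δ : Q.V → ℕ) :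
    ∃ (I : Type) (_ : Finite I) (M : I → RepR Q ℂ[X] δ), ∀ V ∈ modSet S δ, IsIndecRep V →
      ∃ i t, RIso (polyEvalAt (M i) t) V := by
  obtain ⟨s, γs, M, -, n, βs, E, hE⟩ := h (∑ x, δ x)
  let d : Fin s ⊕ Fin n → Q.V → ℕ := Sum.elim γs βs
  let N : ∀ i, RepR Q ℂ[X] (d i) := fun i => match i with
    | Sum.inl i => M i
    | Sum.inr k => fun a => (E k a).map Polynomial.C
  have key : ∀ i t (V : QRep Q δ), RIso (polyEvalAt (N i) t) V →
      ∃ (j : {j // d j = δ}), RIso (polyEvalAt (j.2 ▸ N j.1 : RepR Q ℂ[X] δ) t) V := by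
    intro i t V hV
    refine ⟨⟨i, riso_dim_eq hV⟩, ?_⟩
    have : ∀ (γ δ : Q.V → ℕ) (e : γ = δ) (L : RepR Q ℂ[X] γ) (V : QRep Q δ),
        RIso (polyEvalAt L t) V → RIso (polyEvalAt (e ▸ L : RepR Q ℂ[X] δ) t) V := by
      rintro γ _ rfl L V h
      exact h
    exact this _ _ _ _ _ hV
  refine ⟨{j // d j = δ}, inferInstance, fun j => j.2 ▸ N j.1, fun V hV hi => ?_⟩
  rcases hE δ V hV rfl hi with ⟨k, hk⟩ | ⟨i, t, hi⟩
  · have : polyEvalAt (N (Sum.inr k)) 0 = E k := by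
      funext a
      ext i j
      exact Polynomial.eval_C
    obtain ⟨j, hj⟩ := key (Sum.inr k) 0 V (this ▸ hk)
    exact ⟨j, 0, hj⟩
  · obtain ⟨j, hj⟩ := key (Sum.inl i) t V hi
    exact ⟨j, t, hj⟩

variable [Fintype Q.A] [hac : Fact (QAcyclic Q)] (S : Set (FormalRel Q))

lemma contDiff_cmpL_polyEvalAt {κ δ : Q.V → ℕ} (M : RepR Q ℂ[X] δ) :
    ContDiff ℂ 1 (F := ∀ x, Fin (κ x) → Fin (δ x) → ℂ)
      fun z : ℂ × H S κ δ × (∀ x, Fin (δ x) → Fin (δ x) → ℂ) =>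
        cmpL S (ofQ (polyEvalAt M z.1)) κ δ z.2.1 z.2.2 := by
  have hfin (x y : Q.V) : Fintype (Quiver.Path x y) := Fintype.ofFinite _
  refine contDiff_pi.2 fun x => contDiff_pi.2 fun k => contDiff_pi.2 fun i => ?_
  have h : ∀ z : ℂ × H S κ δ × (∀ x, Fin (δ x) → Fin (δ x) → ℂ),
      cmpL S (ofQ (polyEvalAt M z.1)) κ δ z.2.1 z.2.2 x k i =
      ∑ y, ∑ l, ∑ p : Quiver.Path y x, sec S y x (z.2.1 x k y l) p *
        ∑ j, (evalPath M p i j).eval z.1 * z.2.2 y l j := by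
    intro z
    change lft S (ofQ (polyEvalAt M z.1)) z.2.2 x (z.2.1 x k) i = _
    rw [lft_apply, Finset.sum_apply]
    refine Finset.sum_congr rfl fun y _ => ?_
    rw [Finset.sum_apply]
    refine Finset.sum_congr rfl fun l _ => ?_
    rw [act, LinearMap.comp_apply, evL_ofQ, evalLin, Finsupp.sum_fintype _ _ (by simp)]
    simp only [evalPath_polyEvalAt, Matrix.mulVecLin_apply, Matrix.mulVec, dotProduct,
      Matrix.sum_apply, Matrix.smul_apply, Matrix.map_apply, smul_eq_mul, Finset.sum_mul,
      Finset.mul_sum]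
    rw [Finset.sum_comm]
    simp only [mul_assoc]
  simp only [h]
  refine ContDiff.sum fun y _ => ContDiff.sum fun l _ => ContDiff.sum fun p _ =>
    ContDiff.mul ?_ (ContDiff.sum fun j _ => ContDiff.mul ?_ ?_)
  · let L : H S κ δ →ₗ[ℂ] ℂ := Finsupp.lapply p ∘ₗ sec S y x ∘ₗ LinearMap.proj l ∘ₗ
      LinearMap.proj y ∘ₗ LinearMap.proj k ∘ₗ LinearMap.proj x
    exact (LinearMap.toContinuousLinearMap L).contDiff.comp (contDiff_fst.comp contDiff_snd)
  · exact (Polynomial.contDiff_aeval (𝕜 := ℂ) (evalPath M p i j) 1).comp contDiff_fst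
  · let L : (∀ x, Fin (δ x) → Fin (δ x) → ℂ) →ₗ[ℂ] ℂ :=
      LinearMap.proj j ∘ₗ LinearMap.proj l ∘ₗ LinearMap.proj y
    exact (LinearMap.toContinuousLinearMap L).contDiff.comp (contDiff_snd.comp contDiff_snd)

end Families

section Zariski

lemma exists_basic {β : Q.V → ℕ} {U : Set (QRep Q β)} (hU : zIsOpen U) {w : QRep Q β}
    (hw : w ∈ U) : ∃ p, MvPolynomial.eval (repCoords w) p ≠ 0 ∧
      ∀ v : QRep Q β, MvPolynomial.eval (repCoords v) p ≠ 0 → v ∈ U := by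
  obtain ⟨U, hU, rfl⟩ := hU
  suffices h : ∀ z ∈ U, ∃ p, MvPolynomial.eval z p ≠ 0 ∧
      ∀ v : RepCoord (Q := Q) β → ℂ, MvPolynomial.eval v p ≠ 0 → v ∈ U by
    obtain ⟨p, hp, h⟩ := h _ hw
    exact ⟨p, hp, fun v hv => h _ hv⟩
  clear hw
  induction hU with
  | basic U hU =>
    obtain ⟨p, rfl⟩ := hU
    exact fun z hz => ⟨p, hz, fun _ h => h⟩
  | univ => exact fun z _ => ⟨1, by simp⟩
  | inter U V _ _ hU hV =>
    rintro z ⟨h1, h2⟩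
    obtain ⟨p, hp, hpU⟩ := hU z h1
    obtain ⟨q, hq, hqV⟩ := hV z h2
    refine ⟨p * q, by simp [hp, hq], fun v hv => ?_⟩
    rw [map_mul] at hv
    exact ⟨hpU v (left_ne_zero_of_mul hv), hqV v (right_ne_zero_of_mul hv)⟩
  | sUnion T _ ih =>
    rintro z ⟨U, hU, hz⟩
    obtain ⟨p, hp, h⟩ := ih U hU z hz
    exact ⟨p, hp, fun v hv => ⟨U, hU, h v hv⟩⟩

lemma mem_zclosure_iff {β : Q.V → ℕ} {s : Set (QRep Q β)} {V : QRep Q β} :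
    V ∈ zclosure s ↔ ∀ p, MvPolynomial.eval (repCoords V) p ≠ 0 →
      ∃ w ∈ s, MvPolynomial.eval (repCoords w) p ≠ 0 := by
  unfold zclosure
  rw [@mem_closure_iff _ (zarTop β)]
  constructor
  · intro h p hp
    have ho : zIsOpen {v : QRep Q β | MvPolynomial.eval (repCoords v) p ≠ 0} :=
      ⟨{z | MvPolynomial.eval z p ≠ 0}, TopologicalSpace.GenerateOpen.basic _ ⟨p, rfl⟩, rfl⟩
    obtain ⟨w, hw, hs⟩ := h _ ho hp
    exact ⟨w, hs, hw⟩
  · intro h U hU hV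
    obtain ⟨p, hp, hpU⟩ := exists_basic hU hV
    obtain ⟨w, hs, hw⟩ := h p hp
    exact ⟨w, hpU w hw, hs⟩

lemma subset_zclosure {β : Q.V → ℕ} (s : Set (QRep Q β)) : s ⊆ zclosure s := fun V hV =>
  mem_zclosure_iff.2 fun _ hp => ⟨V, hV, hp⟩

lemma zclosure_subset_iff {β : Q.V → ℕ} {s t : Set (QRep Q β)} :
    zclosure s ⊆ zclosure t ↔ s ⊆ zclosure t := by
  refine ⟨(subset_zclosure s).trans, fun h V hV => mem_zclosure_iff.2 fun p hp => ?_⟩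
  obtain ⟨w, hw, hwp⟩ := mem_zclosure_iff.1 hV p hp
  exact mem_zclosure_iff.1 (h hw) p hwp

end Zariski

section SmallCodimension

variable [Fintype Q.A] [hac : Fact (QAcyclic Q)] {S : Set (FormalRel Q)}

lemma Can.lft_stdY_eq {κ δ : Q.V → ℕ} {f : H S κ δ} (hf : Can f) {x : Q.V} (u : PX S δ x) :
    lft S (ofQ (Vf f)) (stdY (Vf f)) x u = rf f x u := by
  rw [hom_eq_lft hf.rf_hom]
  congr 2
  funext y k
  have h := hf.rf_std (x := y) (Pi.single k 1)
  rw [std_apply, Finset.sum_eq_single k (by intros; simp_all) (by simp)] at h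
  simpa [stdY] using h.symm

/-- A module isomorphic to `Vf f` gives a transversal element of the kernel of `cmpL _ f`. -/
lemma Can.exists_transversal {κ δ : Q.V → ℕ} {f : H S κ δ} (hf : Can f) {N : QRep Q δ}
    (hN : RIso N (Vf f)) : ∃ φ : Y δ (ofQ N), cmpL S (ofQ N) κ δ f φ = 0 ∧
      (Function.Surjective fun h => cmpL S (ofQ N) κ δ h φ) ∧
      Module.finrank ℂ (LinearMap.range (cmpL S (ofQ N) κ δ f)) ≤
        Module.finrank ℂ (LinearMap.range (cmpL S (ofQ (Vf f)) κ δ f)) := by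
  obtain ⟨u, hu⟩ := hN
  have hu := (isHom_ofQ_iff N (Vf f) fun x => (u x).toLinearMap).2 hu
  have hφ : ∀ x (v : PX S δ x), lft S (ofQ N) (fun x k => (u x).symm (stdY (Vf f) x k)) x v =
      (u x).symm (rf f x v) := fun x v => by
    rw [← hf.lft_stdY_eq]
    exact (hu.symm.lft (stdY (Vf f)) v).symm
  refine ⟨fun x k => (u x).symm (stdY (Vf f) x k), ?_, fun y => ?_, ?_⟩
  · funext x k
    rw [cmpL_apply]
    change lft S (ofQ N) _ x (f x k) = 0
    have h := hf.rf_lft (gen S κ x k)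
    rw [lft_gen (isMod_P δ)] at h
    rw [hφ, h, map_zero]
  · choose h hh using fun x k => hf.rf_surjective x (u x (y x k))
    refine ⟨h, funext fun x => funext fun k => ?_⟩
    change lft S (ofQ N) _ x (h x k) = _
    rw [hφ, hh]
    exact (u x).symm_apply_apply _
  · let e : Y κ (ofQ N) ≃ₗ[ℂ] Y κ (ofQ (Vf f)) :=
      LinearEquiv.piCongrRight fun x => LinearEquiv.piCongrRight fun _ => u x
    rw [← LinearEquiv.finrank_map_eq e]
    refine Submodule.finrank_mono ?_
    rintro _ ⟨_, ⟨m, rfl⟩, rfl⟩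
    refine ⟨fun x k => u x (m x k), ?_⟩
    funext x k
    exact (hu.lft m (f x k)).symm

/-- A generically indecomposable component over a tame algebra contains a point of codimension
at most one. -/
theorem exists_small_codim (htame : IsTame S) (hS : AdmissibleRels S) {δ κ : Q.V → ℕ}
    {f₁ : H S κ δ} (hf₁ : Can f₁) (h : IsIndecComp (Cset S δ) (modSet S δ)) :
    ∃ f : H S κ δ, Can f ∧
      Module.finrank ℂ (H S κ δ) ≤ Module.finrank ℂ (LinearMap.range (Lm f f)) + 1 := by
  by_contra! hcon
  obtain ⟨-, U, hU, hCU, hind⟩ := h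
  obtain ⟨w, hw, -⟩ := mem_zclosure_iff.1 (hCU (subset_zclosure _ hf₁.mem_PAset)) 1 (by simp)
  obtain ⟨p, hp, hpU⟩ := exists_basic hU hw.2
  obtain ⟨V₀, hV₀, hpV₀⟩ := mem_zclosure_iff.1 hw.1 p hp
  obtain ⟨g, hg, rfl⟩ := hf₁.exists_can hS hV₀
  obtain ⟨P, hP, hPp⟩ := exists_reg S κ p
  obtain ⟨I, hI, M, hM⟩ := exists_families htame δ
  refine not_covered (E := H S κ δ) (Y₀ := ∀ x, Fin (δ x) → Fin (δ x) → ℂ)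
    (Y₁ := ∀ x, Fin (κ x) → Fin (δ x) → ℂ)
    (fun i t => cmpL S (ofQ (polyEvalAt (M i) t)) κ δ)
    (fun i => contDiff_cmpL_polyEvalAt S (M i))
    (isOpen_ne_fun hP.1 continuous_const) ⟨g, (hPp g).2 ⟨hg, hpV₀⟩⟩ fun f hf => ?_
  obtain ⟨hf, hpf⟩ := (hPp f).1 hf
  obtain ⟨i, t, hit⟩ := hM (Vf f) ((isMod_ofQ _).1 hf.isMod)
    (hind _ ⟨subset_zclosure _ hf.mem_PAset, hpU _ hpf⟩)
  obtain ⟨φ, h1, h2, h3⟩ := hf.exists_transversal hit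
  refine ⟨i, t, φ, h1, h2, ?_⟩
  have h4 := hf.finrank_range_Lm f
  have h5 := hcon f hf
  change _ ≤ Module.finrank ℂ (Y κ (ofQ (Vf f)))
  refine (Nat.add_le_add_right h3 2).trans ?_
  omega

end SmallCodimension

section PolynomialFunctions

/-- The algebra of polynomial functions on a representation space. -/
def polyFun (β : Q.V → ℕ) : Subalgebra ℂ (QRep Q β → ℂ) where
  carrier := {F | IsPolyFun F}
  mul_mem' := by
    rintro F G ⟨p, hp⟩ ⟨q, hq⟩
    exact ⟨p * q, fun W => by simp [hp, hq]⟩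
  add_mem' := by
    rintro F G ⟨p, hp⟩ ⟨q, hq⟩
    exact ⟨p + q, fun W => by simp [hp, hq]⟩
  algebraMap_mem' c := ⟨MvPolynomial.C c, fun W => by simp⟩

lemma repCoords_mem_polyFun {β : Q.V → ℕ} (c : RepCoord (Q := Q) β) :
    (fun W : QRep Q β => repCoords W c) ∈ polyFun β :=
  ⟨MvPolynomial.X c, fun W => (MvPolynomial.eval_X (f := repCoords W) c).symm⟩

lemma coord_mem_polyFun {β : Q.V → ℕ} (a : Q.A) (i : Fin (β (Q.h a))) (j : Fin (β (Q.t a))) :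
    (fun W : QRep Q β => W a i j) ∈ polyFun β :=
  repCoords_mem_polyFun ⟨a, i, j⟩

instance [Fintype Q.A] (β : Q.V → ℕ) : Fintype (RepCoord (Q := Q) β) :=
  inferInstanceAs (Fintype (Σ a : Q.A, Fin (β (Q.h a)) × Fin (β (Q.t a))))

/-- The linear map with kernel `Hom(W, W)`. -/
def commMap {β : Q.V → ℕ} (W : QRep Q β) :
    (∀ x, Matrix (Fin (β x)) (Fin (β x)) ℂ) →ₗ[ℂ] (RepCoord (Q := Q) β → ℂ) where
  toFun φ c := (φ (Q.h c.1) * W c.1 - W c.1 * φ (Q.t c.1)) c.2.1 c.2.2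
  map_add' φ ψ := by
    funext c
    simp [Matrix.add_mul, Matrix.mul_add]
    ring
  map_smul' k φ := by
    funext c
    simp
    ring

lemma ker_commMap {β : Q.V → ℕ} (W : QRep Q β) : LinearMap.ker (commMap W) = HomS W W := by
  ext φ
  constructor
  · intro h a
    ext i j
    exact sub_eq_zero.1 (congrFun h ⟨a, i, j⟩)
  · intro h
    funext c
    change (_ - _ : Matrix _ _ ℂ) _ _ = 0
    rw [h c.1, sub_self]
    rfl

variable [Fintype Q.A]

lemma famL_commMap (β : Q.V → ℕ) : FamL (polyFun β) (commMap (Q := Q) (β := β)) := by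
  classical
  intro φ ξ
  have h : (fun W => ξ (commMap W φ)) = ∑ c : RepCoord (Q := Q) β,
      ((∑ k, algebraMap ℂ _ (φ (Q.h c.1) c.2.1 k) * fun W : QRep Q β => W c.1 k c.2.2) -
        ∑ k, (fun W : QRep Q β => W c.1 c.2.1 k) * algebraMap ℂ _ (φ (Q.t c.1) k c.2.2)) *
        algebraMap ℂ _ (ξ fun j => if c = j then 1 else 0) := by
    funext W
    rw [LinearMap.pi_apply_eq_sum_univ, Finset.sum_apply]
    refine Finset.sum_congr rfl fun c _ => ?_
    simp [commMap, Matrix.mul_apply]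
  rw [h]
  exact sum_mem fun c _ => mul_mem (sub_mem
    (sum_mem fun k _ => mul_mem (Subalgebra.algebraMap_mem _ _) (coord_mem_polyFun _ _ _))
    (sum_mem fun k _ => mul_mem (coord_mem_polyFun _ _ _) (Subalgebra.algebraMap_mem _ _)))
    (Subalgebra.algebraMap_mem _ _)

/-- The dimension of `Hom(W, W)` is upper semicontinuous in `W`. -/
lemma exists_poly_dimHom {β : Q.V → ℕ} (V : QRep Q β) :
    ∃ p, MvPolynomial.eval (repCoords V) p ≠ 0 ∧ ∀ W : QRep Q β,
      MvPolynomial.eval (repCoords W) p ≠ 0 → dimHom W W ≤ dimHom V V := by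
  obtain ⟨F, ⟨p, hp⟩, hV, hW⟩ := (famL_commMap β).exists_rank V
  refine ⟨p, by rwa [← hp], fun W h => ?_⟩
  have h1 := hW W (by rwa [hp])
  have h2 := (commMap V).finrank_range_add_finrank_ker
  have h3 := (commMap W).finrank_range_add_finrank_ker
  rw [ker_commMap] at h2 h3
  unfold dimHom
  omega

end PolynomialFunctions

lemma dimHom_le_of_iso {β γ : Q.V → ℕ} {V : QRep Q β} {W : QRep Q γ} (h : RIso V W) :
    dimHom V V ≤ dimHom W W := by
  obtain ⟨u, hu⟩ := h
  have hu := (isHom_ofQ_iff V W fun x => (u x).toLinearMap).2 hu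
  let c : HomS V V →ₗ[ℂ] HomS W W :=
    { toFun := fun φ => ⟨_, toMatrix'_mem_HomS ((hu.comp ((mem_HomS_iff V V φ.1).1 φ.2)).comp
        hu.symm)⟩
      map_add' := fun φ ψ => by
        refine Subtype.ext (funext fun x => ?_)
        simp only [Submodule.coe_add, Pi.add_apply, Matrix.mulVecLin_add, LinearMap.comp_add,
          LinearMap.add_comp, map_add]
      map_smul' := fun k φ => by
        refine Subtype.ext (funext fun x => ?_)
        simp only [Submodule.coe_smul, Pi.smul_apply, ← Matrix.toLin'_apply', LinearMap.comp_smul,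
          LinearMap.smul_comp, map_smul, RingHom.id_apply] }
  refine LinearMap.finrank_le_finrank_of_injective (f := c) ?_
  rw [injective_iff_map_eq_zero]
  intro φ h0
  refine Subtype.ext (funext fun x => ?_)
  have h1 := congrFun (congrArg Subtype.val h0) x
  have h2 : (u x).toLinearMap ∘ₗ (φ.1 x).mulVecLin ∘ₗ (u x).symm.toLinearMap = 0 :=
    LinearMap.toMatrix'.injective (h1.trans (map_zero _).symm)
  refine Matrix.toLin'.injective (LinearMap.ext fun v => ?_)
  simpa using congrArg (u x).symm (LinearMap.congr_fun h2 (u x v))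

section Pencil

variable [Fintype Q.A] [hac : Fact (QAcyclic Q)] {S : Set (FormalRel Q)}

/-- If a point has codimension at most one, then some pair of points has no extensions. -/
lemma Can.exists_range_Lm_eq_top {κ δ : Q.V → ℕ} {f : H S κ δ} (hf : Can f)
    (h : Module.finrank ℂ (H S κ δ) ≤ Module.finrank ℂ (LinearMap.range (Lm f f)) + 1) :
    ∃ g : H S κ δ, Can g ∧ LinearMap.range (Lm f g) = ⊤ := by
  by_cases htop : LinearMap.range (Lm f f) = ⊤
  · exact ⟨f, hf, htop⟩
  obtain ⟨a, -, ha⟩ := SetLike.exists_of_lt (lt_top_iff_ne_top.2 htop)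
  have hL : ∀ t : ℂ, Lm f (f + t • a) = Lm f f + t • Lm (0 : H S κ δ) a := fun t => by
    refine LinearMap.ext fun ⟨X, Y⟩ => ?_
    simp only [Lm_apply, LinearMap.add_apply, LinearMap.smul_apply, ← cmpL_apply, map_add,
      map_smul, map_zero, LinearMap.zero_apply, zero_add, add_assoc]
  obtain ⟨p, hp, hp0, hpr⟩ := exists_pencil (Lm f f) (Lm (0 : H S κ δ) a)
    (gen S δ, -gen S κ) (by
      rw [Lm_apply, cmp_gen_right, ← cmpL_apply, map_neg, LinearMap.neg_apply, cmpL_apply,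
        cmp_gen_left (isMod_P δ), add_neg_cancel]) (by
      rw [Lm_apply, ← cmpL_apply, map_zero, LinearMap.zero_apply, zero_add, ← cmpL_apply,
        map_neg, LinearMap.neg_apply, cmpL_apply, cmp_gen_left (isMod_P δ)]
      simpa using ha)
  obtain ⟨P, hP, hPc⟩ := exists_reg_can S κ δ
  obtain ⟨t, ht, ht'⟩ := Reg.exists_ne_zero₂ hp
    (Reg.comp hP (LinearMap.toSpanSingleton ℂ _ a) f) hp0 ⟨0, by simpa [hPc] using hf⟩
  refine ⟨f + t • a, (hPc _).1 ht', Submodule.eq_top_of_finrank_eq ?_⟩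
  have h1 := hpr t ht
  rw [← hL] at h1
  have h2 := Submodule.finrank_le (LinearMap.range (Lm f (f + t • a)))
  omega

end Pencil

section Composition

variable [Fintype Q.A] [hac : Fact (QAcyclic Q)] {S : Set (FormalRel Q)}

/-- Composition of homomorphisms between projectives, in diagrammatic order. -/
local infixl:70 "⊚" => cmp _ (P _ _)

variable {κ γ δ ε : Q.V → ℕ}

lemma cmp_add_left (f f' : H S κ γ) (g : H S γ δ) : (f + f') ⊚ g = f ⊚ g + f' ⊚ g := by
  simp only [← cmpL_apply, map_add, LinearMap.add_apply]

lemma cmp_add_right (f : H S κ γ) (g g' : H S γ δ) : f ⊚ (g + g') = f ⊚ g + f ⊚ g' := by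
  simp only [← cmpL_apply, map_add]

lemma cmp_zero_left (g : H S γ δ) : (0 : H S κ γ) ⊚ g = 0 := by
  simp only [← cmpL_apply, map_zero, LinearMap.zero_apply]

lemma cmp_zero_right (f : H S κ γ) : f ⊚ (0 : H S γ δ) = 0 := by
  simp only [← cmpL_apply, map_zero]

lemma cmp_neg_left (f : H S κ γ) (g : H S γ δ) : (-f) ⊚ g = -(f ⊚ g) := by
  simp only [← cmpL_apply, map_neg, LinearMap.neg_apply]

lemma cmp_sum_left {ι : Type*} (s : Finset ι) (f : ι → H S κ γ) (g : H S γ δ) :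
    (∑ i ∈ s, f i) ⊚ g = ∑ i ∈ s, f i ⊚ g := by
  simp only [← cmpL_apply, map_sum, LinearMap.sum_apply]

lemma cmp_sum_right {ι : Type*} (s : Finset ι) (f : H S κ γ) (g : ι → H S γ δ) :
    f ⊚ (∑ i ∈ s, g i) = ∑ i ∈ s, f ⊚ g i := by
  simp only [← cmpL_apply, map_sum]

lemma cmp_cmp (f : H S κ γ) (g : H S γ δ) (h : H S δ ε) : f ⊚ g ⊚ h = f ⊚ (g ⊚ h) :=
  cmp_assoc (isMod_P ε) f g h

lemma gen_cmp (f : H S κ γ) : gen S κ ⊚ f = f := cmp_gen_left (isMod_P γ) f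

section Sum

variable {ι : Type} [Fintype ι] [DecidableEq ι] {κs γs δs : ι → Q.V → ℕ}
  (hκ : ∀ x, κ x = ∑ i, κs i x) (hδ : ∀ x, δ x = ∑ i, δs i x)

/-- The index set of a direct sum of coordinate spaces. -/
def sumEquiv (x : Q.V) : Fin (δ x) ≃ Σ i, Fin (δs i x) :=
  Fintype.equivOfCardEq (by simp [hδ])

omit [DecidableEq ι] in
variable (S) in
/-- The projection of `P δ = ⊕ P δᵢ` onto a summand, at a vertex. -/
def prV (i : ι) (y : Q.V) : PX S δ y →ₗ[ℂ] PX S (δs i) y :=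
  LinearMap.pi fun x => LinearMap.pi fun k =>
    LinearMap.proj (φ := fun _ : Fin (δ x) => Fin (dA S x y) → ℂ) ((sumEquiv hδ x).symm ⟨i, k⟩) ∘ₗ
      LinearMap.proj x

omit [DecidableEq ι] in
lemma prV_apply (i : ι) {y : Q.V} (u : PX S δ y) (x : Q.V) (k : Fin (δs i x)) :
    prV S hδ i y u x k = u x ((sumEquiv hδ x).symm ⟨i, k⟩) := rfl

omit [DecidableEq ι] in
lemma prV_hom (i : ι) : IsHom (P S δ) (P S (δs i)) (prV S hδ i) := fun _ _ _ _ => rfl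

omit [DecidableEq ι] in
lemma prV_ext {y : Q.V} {u v : PX S δ y} (h : ∀ i, prV S hδ i y u = prV S hδ i y v) : u = v := by
  funext x k
  have := congrFun (congrFun (h (sumEquiv hδ x k).1) x) (sumEquiv hδ x k).2
  simpa [prV_apply] using this

omit [DecidableEq ι] in
lemma exists_prV {y : Q.V} (v : ∀ i, PX S (δs i) y) : ∃ u, ∀ i, prV S hδ i y u = v i := by
  refine ⟨fun x k => v (sumEquiv hδ x k).1 x (sumEquiv hδ x k).2, fun i => ?_⟩
  funext x k
  change (fun s : Σ i, Fin (δs i x) => v s.1 x s.2)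
    (sumEquiv hδ x ((sumEquiv hδ x).symm ⟨i, k⟩)) = _
  rw [Equiv.apply_symm_apply]

variable (S) in
/-- The projection of `P δ = ⊕ P δᵢ` onto a summand. -/
def pr (i : ι) : H S δ (δs i) := fun x k => prV S hδ i x (gen S δ x k)

variable (S) in
/-- The inclusion of a summand into `P δ = ⊕ P δᵢ`. -/
def inc (i : ι) : H S (δs i) δ := fun x k => gen S δ x ((sumEquiv hδ x).symm ⟨i, k⟩)

omit [DecidableEq ι] in
lemma lft_pr (i : ι) {y : Q.V} (u : PX S δ y) :
    lft S (P S (δs i)) (pr S hδ i) y u = prV S hδ i y u :=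
  (hom_eq_lft (prV_hom hδ i) u).symm

lemma prV_gen_self (i : ι) (x : Q.V) (k : Fin (δs i x)) :
    prV S hδ i x (gen S δ x ((sumEquiv hδ x).symm ⟨i, k⟩)) = gen S (δs i) x k := by
  funext y m
  rw [prV_apply]
  by_cases h : y = x
  · subst h
    by_cases h' : m = k
    · subst h'
      simp [gen]
    · simp [gen, h']
  · simp [gen, h]

lemma prV_gen_ne {i j : ι} (hij : i ≠ j) (x : Q.V) (k : Fin (δs i x)) :
    prV S hδ j x (gen S δ x ((sumEquiv hδ x).symm ⟨i, k⟩)) = 0 := by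
  funext y m
  rw [prV_apply]
  by_cases h : y = x
  · subst h
    simp [gen, hij.symm]
  · simp [gen, h]

lemma inc_pr_self (i : ι) : inc S hδ i ⊚ pr S hδ i = gen S (δs i) := by
  funext x k
  exact (lft_pr hδ i _).trans (prV_gen_self hδ i x k)

lemma inc_pr_ne {i j : ι} (hij : i ≠ j) : inc S hδ i ⊚ pr S hδ j = 0 := by
  funext x k
  exact (lft_pr hδ j _).trans (prV_gen_ne hδ hij x k)

omit [DecidableEq ι] in
/-- Homomorphisms between direct sums agree if their blocks do. -/
lemma block_ext {a b : H S κ δ}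
    (h : ∀ i j, inc S hκ i ⊚ a ⊚ pr S hδ j = inc S hκ i ⊚ b ⊚ pr S hδ j) : a = b := by
  funext x k
  refine prV_ext hδ fun j => ?_
  have h1 := congrFun (congrFun (h (sumEquiv hκ x k).1 j) x) (sumEquiv hκ x k).2
  have h2 : ∀ c : H S κ δ, (inc S hκ (sumEquiv hκ x k).1 ⊚ c ⊚ pr S hδ j) x (sumEquiv hκ x k).2 =
      prV S hδ j x (c x k) := fun c => by
    refine (lft_pr hδ j _).trans (congrArg _ ?_)
    refine (lft_gen (isMod_P δ) c x _).trans ?_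
    rw [Sigma.eta, Equiv.symm_apply_apply]
  rwa [h2, h2] at h1

/-- Homomorphisms between direct sums may be prescribed blockwise. -/
lemma exists_block (X : ∀ i j, H S (κs i) (δs j)) :
    ∃ a : H S κ δ, ∀ i j, inc S hκ i ⊚ a ⊚ pr S hδ j = X i j := by
  refine ⟨∑ i, ∑ j, pr S hκ i ⊚ X i j ⊚ inc S hδ j, fun i j => ?_⟩
  simp only [cmp_sum_left, cmp_sum_right]
  rw [Finset.sum_eq_single i, Finset.sum_eq_single j]
  · rw [cmp_cmp, cmp_cmp, cmp_cmp, inc_pr_self, cmp_gen_right, ← cmp_cmp, inc_pr_self, gen_cmp]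
  · intro j' _ hj
    rw [cmp_cmp, cmp_cmp, inc_pr_ne hδ hj, cmp_zero_right, cmp_zero_right]
  · simp
  · intro i' _ hi
    refine Finset.sum_eq_zero fun j' _ => ?_
    rw [cmp_cmp (pr S hκ i'), ← cmp_cmp, inc_pr_ne hκ hi.symm, cmp_zero_left, cmp_zero_left]
  · simp

variable (S) in
/-- The direct sum of homomorphisms between projectives. -/
def dsum : (∀ i, H S (κs i) (δs i)) →ₗ[ℂ] H S κ δ :=
  ∑ i, (cmpL S (P S δ) κ (δs i)).flip (inc S hδ i) ∘ₗ cmpL S (P S (δs i)) κ (κs i) (pr S hκ i) ∘ₗ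
    LinearMap.proj i

omit [DecidableEq ι] in
lemma dsum_apply (f : ∀ i, H S (κs i) (δs i)) :
    dsum S hκ hδ f = ∑ i, pr S hκ i ⊚ f i ⊚ inc S hδ i := by
  simp only [dsum, LinearMap.sum_apply]
  rfl

lemma inc_dsum (f : ∀ i, H S (κs i) (δs i)) (i : ι) :
    inc S hκ i ⊚ dsum S hκ hδ f = f i ⊚ inc S hδ i := by
  rw [dsum_apply, cmp_sum_right, Finset.sum_eq_single i]
  · rw [cmp_cmp, ← cmp_cmp, inc_pr_self, gen_cmp]
  · intro j _ hj
    rw [cmp_cmp, ← cmp_cmp, inc_pr_ne hκ hj.symm, cmp_zero_left]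
  · simp

lemma dsum_pr (f : ∀ i, H S (κs i) (δs i)) (j : ι) :
    dsum S hκ hδ f ⊚ pr S hδ j = pr S hκ j ⊚ f j := by
  rw [dsum_apply, cmp_sum_left, Finset.sum_eq_single j]
  · rw [cmp_cmp, inc_pr_self, cmp_gen_right]
  · intro i _ hi
    rw [cmp_cmp, inc_pr_ne hδ hi, cmp_zero_right]
  · simp

lemma prV_lft_dsum (f : ∀ i, H S (κs i) (δs i)) (j : ι) {y : Q.V} (u : PX S κ y) :
    prV S hδ j y (lft S (P S δ) (dsum S hκ hδ f) y u) =
      lft S (P S (δs j)) (f j) y (prV S hκ j y u) := by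
  rw [← lft_pr, ← lft_cmp (isMod_P _), dsum_pr, lft_cmp (isMod_P _), lft_pr]

lemma prV_std (i : ι) {y : Q.V} (w : Fin (δ y) → ℂ) :
    prV S hδ i y (std S δ y w) = std S (δs i) y fun k => w ((sumEquiv hδ y).symm ⟨i, k⟩) := by
  rw [std_apply, std_apply, map_sum]
  simp only [map_smul]
  rw [← (sumEquiv hδ y).symm.sum_comp, Fintype.sum_sigma, Finset.sum_eq_single i]
  · simp only [prV_gen_self]
  · intro j _ hj
    simp only [prV_gen_ne hδ hj, smul_zero, Finset.sum_const_zero]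
  · simp

/-- The direct sum of a family of representations. -/
@[reducible] def sumRep (V : ι → LRep Q) : LRep Q where
  X x := ∀ i, (V i).X x
  ρ e := LinearMap.pi fun i => (V i).ρ e ∘ₗ LinearMap.proj i

omit [Fintype Q.A] hac [Fintype ι] [DecidableEq ι] in
lemma isMod_sumRep {V : ι → LRep Q} (hV : ∀ i, IsMod S (V i)) : IsMod S (sumRep V) := by
  intro r hr
  refine LinearMap.ext fun m => funext fun i => ?_
  have h : IsHom (sumRep V) (V i) (fun x => LinearMap.proj i) := fun _ _ _ _ => rfl
  exact (h.evL r.2.2 m).trans (by rw [hV i r hr]; rfl)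

omit [Fintype Q.A] hac in
lemma isSumOf_iff {W : QRep Q δ} {V : ∀ i, QRep Q (δs i)} :
    IsSumOf W V ↔ ∃ u : ∀ x, (Fin (δ x) → ℂ) ≃ₗ[ℂ] ∀ i, Fin (δs i x) → ℂ,
      IsHom (ofQ W) (sumRep fun i => ofQ (V i)) fun x => (u x).toLinearMap := by
  let c : ∀ x, ((Σ i, Fin (δs i x)) → ℂ) ≃ₗ[ℂ] ∀ i, Fin (δs i x) → ℂ := fun x =>
    LinearEquiv.piCurry ℂ fun i (_ : Fin (δs i x)) => ℂ
  have hc : ∀ (a : Q.A) v, c (Q.h a) ((Matrix.blockDiagonal' fun i => V i a).mulVecLin v) =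
      fun i => (V i a).mulVecLin (c (Q.t a) v i) := fun a v => by
    funext i k
    change (Matrix.blockDiagonal' (fun i => V i a) *ᵥ v) ⟨i, k⟩ = _
    rw [Matrix.mulVec, dotProduct, Fintype.sum_sigma, Finset.sum_eq_single i]
    · simp only [Matrix.blockDiagonal'_apply_eq]
      rfl
    · intro j _ hj
      refine Finset.sum_eq_zero fun m _ => ?_
      rw [Matrix.blockDiagonal'_apply_ne _ _ _ hj.symm, zero_mul]
    · simp
  constructor
  · rintro ⟨u, hu⟩
    refine ⟨fun x => (u x).trans (c x), ?_⟩
    rintro x y ⟨a, rfl, rfl⟩ m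
    exact (congrArg (c _) (LinearMap.congr_fun (hu a) m)).trans (hc a _)
  · rintro ⟨u, hu⟩
    refine ⟨fun x => (u x).trans (c x).symm, fun a => LinearMap.ext fun m => ?_⟩
    apply (c (Q.h a)).injective
    have h := hu (x := Q.t a) (y := Q.h a) ⟨a, rfl, rfl⟩ m
    have h' := hc a ((c (Q.t a)).symm (u (Q.t a) m))
    simp only [LinearEquiv.apply_symm_apply] at h'
    refine Eq.trans ?_ (h.trans h'.symm)
    exact (c (Q.h a)).apply_symm_apply _

/-- The direct sum of canonical maps is canonical and presents the direct sum. -/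
lemma can_dsum {f : ∀ i, H S (κs i) (δs i)} (hf : ∀ i, Can (f i)) :
    Can (dsum S hκ hδ f) ∧ IsSumOf (Vf (dsum S hκ hδ f)) fun i => Vf (f i) := by
  let M := sumRep fun i => ofQ (Vf (f i))
  have hM : IsMod S M := isMod_sumRep fun i => (hf i).isMod
  let ψ : ∀ x, PX S δ x →ₗ[ℂ] M.X x := fun x =>
    LinearMap.pi fun i => rf (f i) x ∘ₗ prV S hδ i x
  have hψ : IsHom (P S δ) M ψ := fun x y e u => funext fun i =>
    (congrArg _ (prV_hom hδ i e u)).trans ((hf i).rf_hom e _)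
  let φ : Y δ M := fun x k => ψ x (gen S δ x k)
  have hφ : ∀ x u, lft S M φ x u = ψ x u := fun x u => (hom_eq_lft hψ u).symm
  have hsurj : ∀ x, Function.Surjective (lft S M φ x) := fun x w => by
    obtain ⟨u, hu⟩ := exists_prV hδ (S := S) fun i => std S (δs i) x (w i)
    refine ⟨u, (hφ x u).trans (funext fun i => ?_)⟩
    change rf (f i) x (prV S hδ i x u) = _
    rw [hu, (hf i).rf_std]
  have hker : ∀ x, LinearMap.ker (lft S M φ x) =
      LinearMap.range (lft S (P S δ) (dsum S hκ hδ f) x) := fun x => by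
    ext u
    rw [LinearMap.mem_ker, hφ]
    constructor
    · intro h
      have h1 : ∀ i, ∃ v, lft S (P S (δs i)) (f i) x v = prV S hδ i x u := fun i => by
        rw [← LinearMap.mem_range, ← (hf i).ker_rf]
        exact congrFun h i
      choose v hv using h1
      obtain ⟨w, hw⟩ := exists_prV hκ (S := S) v
      exact ⟨w, prV_ext hδ fun i => by rw [prV_lft_dsum, hw, hv]⟩
    · rintro ⟨v, rfl⟩
      funext i
      change rf (f i) x (prV S hδ i x _) = 0
      rw [prV_lft_dsum, (hf i).rf_lft]
  have hcan : Can (dsum S hκ hδ f) := by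
    refine can_of_pres φ (fun x => ?_) hker fun x => ?_
    · have h : ∀ w i, (lft S M φ x ∘ₗ std S δ x) w i =
          fun k => w ((sumEquiv hδ x).symm ⟨i, k⟩) := fun w i => by
        rw [LinearMap.comp_apply, hφ]
        change rf (f i) x (prV S hδ i x _) = _
        rw [prV_std, (hf i).rf_std]
      constructor
      · intro w w' hw
        funext k
        have h1 := congrFun (congrFun hw (sumEquiv hδ x k).1) (sumEquiv hδ x k).2
        rw [h, h] at h1
        simpa using h1
      · intro v
        refine ⟨fun k => v (sumEquiv hδ x k).1 (sumEquiv hδ x k).2, funext fun i => ?_⟩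
        rw [h]
        funext k
        change (fun s : Σ i, Fin (δs i x) => v s.1 s.2) (sumEquiv hδ x _) = _
        rw [Equiv.apply_symm_apply]
    · rw [injective_iff_map_eq_zero]
      intro u hu
      refine prV_ext hκ fun i => ?_
      apply (hf i).lft_injective x
      rw [← prV_lft_dsum hκ hδ, hu, map_zero, map_zero, map_zero]
  refine ⟨hcan, isSumOf_iff.2 ?_⟩
  obtain ⟨u, hu, -⟩ := hcan.exists_iso hM φ hsurj hker
  exact ⟨u, hu⟩

end Sum

end Composition

section SumClosure

variable {ι : Type} [Fintype ι] [DecidableEq ι] {δ : Q.V → ℕ} {δs : ι → Q.V → ℕ}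

lemma isSumOf_of_iso {W W' : QRep Q δ} {V : ∀ i, QRep Q (δs i)} (h : RIso W' W)
    (hW : IsSumOf W V) : IsSumOf W' V := by
  obtain ⟨u, hu⟩ := h
  obtain ⟨v, hv⟩ := hW
  refine ⟨fun x => (u x).trans (v x), fun a => LinearMap.ext fun m => ?_⟩
  have h1 := LinearMap.congr_fun (hu a) m
  have h2 := LinearMap.congr_fun (hv a) (u _ m)
  exact (congrArg (v _) h1).trans h2

lemma riso_of_isSumOf {W W' : QRep Q δ} {V : ∀ i, QRep Q (δs i)} (hW : IsSumOf W V)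
    (hW' : IsSumOf W' V) : RIso W W' := by
  obtain ⟨u, hu⟩ := hW
  obtain ⟨v, hv⟩ := hW'
  refine ⟨fun x => (u x).trans (v x).symm, fun a => LinearMap.ext fun m => ?_⟩
  have h1 := LinearMap.congr_fun (hu a) m
  have h2 := LinearMap.congr_fun (hv a) ((v _).symm (u _ m))
  apply (v (Q.h a)).injective
  refine Eq.trans ?_ (h1.trans (Eq.trans ?_ h2.symm))
  · exact (v (Q.h a)).apply_symm_apply _
  · exact congrArg (Matrix.blockDiagonal' fun i => V i a).mulVecLin
      ((v (Q.t a)).apply_symm_apply _).symm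

lemma isPolyFun_eval {β γ : Q.V → ℕ} {F : QRep Q β → QRep Q γ}
    (hF : ∀ c, (fun X => repCoords (F X) c) ∈ polyFun β)
    (p : MvPolynomial (RepCoord (Q := Q) γ) ℂ) :
    (fun X => MvPolynomial.eval (repCoords (F X)) p) ∈ polyFun β := by
  induction p using MvPolynomial.induction_on with
  | C a =>
    simp only [MvPolynomial.eval_C]
    exact (polyFun β).algebraMap_mem a
  | add p q hp hq =>
    simp only [map_add]
    exact add_mem hp hq
  | mul_X p c hp =>
    simp only [map_mul, MvPolynomial.eval_X]
    exact mul_mem hp (hF c)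

/-- Direct sums of Zariski closures lie in the closure of the direct sum. -/
lemma sumSet_zclosure_subset (Cs : ∀ i, Set (QRep Q (δs i))) :
    sumSet δs (fun i => zclosure (Cs i)) δ ⊆ zclosure (sumSet δs Cs δ) := by
  rintro W ⟨V, hV, u, hu⟩
  rw [mem_zclosure_iff]
  intro p hp
  let T : (∀ i, QRep Q (δs i)) → QRep Q δ := fun V' a => LinearMap.toMatrix'
    ((u (Q.h a)).symm.toLinearMap ∘ₗ (Matrix.blockDiagonal' fun i => V' i a).mulVecLin ∘ₗ
      (u (Q.t a)).toLinearMap)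
  have hTV : T V = W := by
    funext a
    apply Matrix.toLin'.injective
    rw [Matrix.toLin'_toMatrix', ← hu, ← LinearMap.comp_assoc, Matrix.toLin'_apply']
    ext1 m
    simp
  have hTs : ∀ V', IsSumOf (T V') V' := fun V' => by
    refine ⟨u, fun a => ?_⟩
    rw [← Matrix.toLin'_apply' (T V' a), Matrix.toLin'_toMatrix', ← LinearMap.comp_assoc]
    ext1 m
    simp
  suffices h : ∀ s : Finset ι, ∃ V', (∀ i ∈ s, V' i ∈ Cs i) ∧ (∀ i, i ∉ s → V' i = V i) ∧
      MvPolynomial.eval (repCoords (T V')) p ≠ 0 by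
    obtain ⟨V', h1, -, h2⟩ := h Finset.univ
    exact ⟨T V', ⟨V', fun i => h1 i (Finset.mem_univ i), hTs V'⟩, h2⟩
  intro s
  induction s using Finset.induction_on with
  | empty => exact ⟨V, by simp, by simp, by rwa [hTV]⟩
  | insert i s hi ih =>
    obtain ⟨V', h1, h2, h3⟩ := ih
    obtain ⟨q, hq⟩ := isPolyFun_eval (F := fun X => T (Function.update V' i X)) (by
      rintro ⟨a, j, k⟩
      have : (fun X => repCoords (T (Function.update V' i X)) ⟨a, j, k⟩) =
          ∑ s, ∑ t, algebraMap ℂ _ (u (Q.t a) (Pi.single k 1) t *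
            (u (Q.h a)).symm (fun s' => if s = s' then 1 else 0) j) *
            fun X => (Matrix.blockDiagonal' fun i' => Function.update V' i X i' a) s t := by
        funext X
        simp only [Finset.sum_apply, Pi.mul_apply, Pi.algebraMap_apply, Algebra.algebraMap_self,
          RingHom.id_apply]
        change LinearMap.toMatrix' _ j k = _
        rw [LinearMap.toMatrix'_apply]
        rw [LinearMap.comp_apply, LinearMap.pi_apply_eq_sum_univ, Finset.sum_apply]
        refine Finset.sum_congr rfl fun s _ => ?_
        simp only [Pi.smul_apply, smul_eq_mul, LinearMap.comp_apply, LinearEquiv.coe_coe,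
          Matrix.mulVecLin_apply, Matrix.mulVec, dotProduct, Finset.sum_mul]
        exact Finset.sum_congr rfl fun t _ => by ring
      rw [this]
      refine sum_mem fun s _ => sum_mem fun t _ => mul_mem (Subalgebra.algebraMap_mem _ _) ?_
      obtain ⟨i₁, m₁⟩ := s
      obtain ⟨i₂, m₂⟩ := t
      by_cases h : i₁ = i₂
      · subst h
        simp only [Matrix.blockDiagonal'_apply_eq]
        by_cases h' : i₁ = i
        · subst h'
          simp only [Function.update_self]
          exact coord_mem_polyFun _ _ _
        · simp only [Function.update_of_ne h']
          exact (polyFun _).algebraMap_mem (V' i₁ a m₁ m₂)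
      · simp only [Matrix.blockDiagonal'_apply_ne _ _ _ h]
        exact (polyFun _).algebraMap_mem 0) p
    have h4 : MvPolynomial.eval (repCoords (V i)) q ≠ 0 := by
      rw [← hq, ← h2 i hi]
      simpa using h3
    obtain ⟨X, hX, hXq⟩ := mem_zclosure_iff.1 (hV i) q h4
    refine ⟨Function.update V' i X, fun j hj => ?_, fun j hj => ?_, ?_⟩
    · by_cases hji : j = i
      · subst hji
        simpa using hX
      · rw [Function.update_of_ne hji]
        exact h1 j (Finset.mem_of_mem_insert_of_ne hj hji)
    · have hji : j ≠ i := fun h => hj (h ▸ Finset.mem_insert_self _ _)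
      rw [Function.update_of_ne hji]
      exact h2 j fun h => hj (Finset.mem_insert_of_mem h)
    · rw [← hq] at hXq
      exact hXq

end SumClosure

section Generic

variable [Fintype Q.A] [hac : Fact (QAcyclic Q)] {S : Set (FormalRel Q)}

lemma mem_PAset_of_iso {δ : Q.V → ℕ} {V W : QRep Q δ} (h : RIso V W) (hV : V ∈ PAset S δ) :
    W ∈ PAset S δ := by
  obtain ⟨u, hu⟩ := h
  have hu' := (isHom_ofQ_iff V W fun x => (u x).toLinearMap).2 hu
  obtain ⟨hVm, γ₀, γ₁, P₀, P₁, h0m, h1m, h0, h1, i, hi, p, hp, hinj, hsurj, hex⟩ := hV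
  have hq : ∀ x, (LinearMap.toMatrix' ((u x).toLinearMap ∘ₗ (p x).mulVecLin)).mulVecLin =
      (u x).toLinearMap ∘ₗ (p x).mulVecLin := fun x => by
    rw [← Matrix.toLin'_apply', Matrix.toLin'_toMatrix']
  refine ⟨(isMod_ofQ W).1 (isMod_of_surjective hu' (fun x => (u x).surjective)
    ((isMod_ofQ V).2 hVm)), γ₀, γ₁, P₀, P₁, h0m, h1m, h0, h1, i, hi, _,
    toMatrix'_mem_HomS (hu'.comp ((mem_HomS_iff P₀ V p).1 hp)), hinj, fun x => ?_, fun x => ?_⟩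
  · rw [hq]
    exact (u x).surjective.comp (hsurj x)
  · rw [hq, hex, LinearEquiv.ker_comp]

local infixl:70 "⊚" => cmp _ (P _ _)

variable {ι : Type} [Fintype ι] [DecidableEq ι] {κ δ : Q.V → ℕ} {κs δs : ι → Q.V → ℕ}
  (hκ : ∀ x, κ x = ∑ i, κs i x) (hδ : ∀ x, δ x = ∑ i, δs i x)

/-- If there are extensions between different summands, then the direct sum does not have the
smallest possible endomorphism algebra. -/
lemma exists_dimHom_lt {f : ∀ i, H S (κs i) (δs i)} (hf : ∀ i, Can (f i)) {i j : ι}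
    (hij : i ≠ j) (h : LinearMap.range (Lm (f i) (f j)) ≠ ⊤) :
    ∃ g : H S κ δ, Can g ∧
      dimHom (Vf g) (Vf g) < dimHom (Vf (dsum S hκ hδ f)) (Vf (dsum S hκ hδ f)) := by
  set F := dsum S hκ hδ f with hF
  have hFc : Can F := (can_dsum hκ hδ hf).1
  obtain ⟨b, -, hb⟩ := SetLike.exists_of_lt (lt_top_iff_ne_top.2 h)
  let a : H S κ δ := pr S hκ i ⊚ b ⊚ inc S hδ j
  have hL : ∀ t : ℂ, Lm (F + t • a) (F + t • a) = Lm F F + t • Lm a a := fun t => by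
    refine LinearMap.ext fun ⟨X, Y⟩ => ?_
    simp only [Lm_apply, LinearMap.add_apply, LinearMap.smul_apply, ← cmpL_apply, map_add,
      map_smul, smul_add]
    abel
  have ha : a ∉ LinearMap.range (Lm F F) := by
    rintro ⟨⟨X, Y⟩, hXY⟩
    refine hb ⟨(inc S hδ i ⊚ X ⊚ pr S hδ j, inc S hκ i ⊚ Y ⊚ pr S hκ j), ?_⟩
    rw [Lm_apply] at hXY ⊢
    have h1 := congrArg (fun c => inc S hκ i ⊚ c ⊚ pr S hδ j) hXY
    simp only [cmp_add_left, cmp_add_right] at h1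
    rw [← cmp_cmp (inc S hκ i) F X, inc_dsum, ← cmp_cmp (inc S hκ i) Y F,
      cmp_cmp _ F (pr S hδ j), dsum_pr] at h1
    simp only [a, cmp_cmp] at h1 ⊢
    rw [h1, inc_pr_self, cmp_gen_right, ← cmp_cmp, inc_pr_self, gen_cmp]
  obtain ⟨p, hp, hp0, hpr⟩ := exists_pencil (Lm F F) (Lm a a)
    (pr S hδ j ⊚ inc S hδ j, -(pr S hκ j ⊚ inc S hκ j)) (by
      rw [Lm_apply, cmp_neg_left, ← cmp_cmp, dsum_pr, cmp_cmp (pr S hκ j) (inc S hκ j), inc_dsum,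
        cmp_cmp, add_neg_cancel]) (by
      rw [Lm_apply, cmp_neg_left]
      simp only [a, cmp_cmp]
      rw [← cmp_cmp (inc S hδ j), inc_pr_self, gen_cmp, ← cmp_cmp (inc S hκ j) (pr S hκ i),
        inc_pr_ne hκ hij.symm, cmp_zero_left, cmp_zero_right, neg_zero, add_zero]
      simpa only [a, cmp_cmp] using ha)
  obtain ⟨P, hP, hPc⟩ := exists_reg_can S κ δ
  obtain ⟨t, ht, ht'⟩ := Reg.exists_ne_zero₂ hp
    (Reg.comp hP (LinearMap.toSpanSingleton ℂ _ a) F) hp0 ⟨0, by simpa [hPc] using hFc⟩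
  have hg : Can (F + t • a) := (hPc _).1 ht'
  refine ⟨F + t • a, hg, ?_⟩
  have h1 := hpr t ht
  rw [← hL] at h1
  have h2 := hFc.dimHom_Lm hFc
  have h3 := hg.dimHom_Lm hg
  omega

/-- If a component is generically a direct sum, then there are no extensions between the
generic summands. -/
theorem exists_pairwise_Lm_eq_top (hδ : ∀ x, δ x = ∑ i, δs i x) (hne : (PAset S δ).Nonempty)
    (hdec : Cset S δ ⊆ zclosure (sumSet δs (fun i => Cset S (δs i)) δ)) :
    ∃ (κs : ι → Q.V → ℕ) (f : ∀ i, H S (κs i) (δs i)), (∀ i, Can (f i)) ∧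
      ∀ i j, i ≠ j → LinearMap.range (Lm (f i) (f j)) = ⊤ := by
  obtain ⟨_, ⟨V, hV, rfl⟩, hmin⟩ := (wellFounded_lt (α := ℕ)).has_min
    ((fun V : QRep Q δ => dimHom V V) '' PAset S δ) (hne.image _)
  obtain ⟨p, hpV, hp⟩ := exists_poly_dimHom V
  have h1 : zclosure (sumSet δs (fun i => Cset S (δs i)) δ) ⊆
      zclosure (sumSet δs (fun i => PAset S (δs i)) δ) :=
    zclosure_subset_iff.2 (sumSet_zclosure_subset _)
  obtain ⟨W, ⟨Vs, hVs, hW⟩, hpW⟩ := mem_zclosure_iff.1 (h1 (hdec (subset_zclosure _ hV))) p hpV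
  choose κs f hf hfV using fun i => exists_can (hVs i)
  refine ⟨κs, f, hf, fun i j hij => ?_⟩
  by_contra h
  have hκ : ∀ x, (fun x => ∑ i, κs i x) x = ∑ i, κs i x := fun _ => rfl
  obtain ⟨g, hg, hlt⟩ := exists_dimHom_lt hκ hδ hf hij h
  have hs := (can_dsum hκ hδ hf).2
  simp only [hfV] at hs
  have h2 := dimHom_le_of_iso (riso_of_isSumOf hs hW)
  have h3 := hp W hpW
  exact hmin _ ⟨_, hg.mem_PAset, rfl⟩ (hlt.trans_le (h2.trans h3))

end Generic

/-- The derivative of a product of three factors, two of which are at the identity. -/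
lemma map_nhds_trilinear {E X Y W : Type*} [NormedAddCommGroup E] [NormedSpace ℂ E]
    [NormedAddCommGroup X] [NormedSpace ℂ X] [NormedAddCommGroup Y] [NormedSpace ℂ Y]
    [NormedAddCommGroup W] [NormedSpace ℂ W] [FiniteDimensional ℂ E] [FiniteDimensional ℂ X]
    [FiniteDimensional ℂ Y] [FiniteDimensional ℂ W] (B : E →ₗ[ℂ] X →ₗ[ℂ] E)
    (C : Y →ₗ[ℂ] E →ₗ[ℂ] E) (D : W →ₗ[ℂ] E) (x : X) (y : Y) (w : W)
    (h : ∀ e, ∃ x' y' w', B (C y (D w)) x' + B (C y' (D w) + C y (D w')) x = e) :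
    Filter.map (fun z : X × Y × W => B (C z.2.1 (D z.2.2)) z.1) (nhds (x, y, w)) =
      nhds (B (C y (D w)) x) := by
  have : CompleteSpace X := FiniteDimensional.complete ℂ X
  have : CompleteSpace Y := FiniteDimensional.complete ℂ Y
  have : CompleteSpace W := FiniteDimensional.complete ℂ W
  have : CompleteSpace E := FiniteDimensional.complete ℂ E
  have h1 : HasStrictFDerivAt (fun z : X × Y × W => z.2.1)
      ((ContinuousLinearMap.fst ℂ Y W).comp (ContinuousLinearMap.snd ℂ X (Y × W))) (x, y, w) :=
    ((ContinuousLinearMap.fst ℂ Y W).comp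
      (ContinuousLinearMap.snd ℂ X (Y × W))).hasStrictFDerivAt
  have h2 : HasStrictFDerivAt (fun z : X × Y × W => LinearMap.toContinuousLinearMap D z.2.2)
      ((LinearMap.toContinuousLinearMap D).comp
        ((ContinuousLinearMap.snd ℂ Y W).comp (ContinuousLinearMap.snd ℂ X (Y × W)))) (x, y, w) :=
    ((LinearMap.toContinuousLinearMap D).comp
      ((ContinuousLinearMap.snd ℂ Y W).comp
        (ContinuousLinearMap.snd ℂ X (Y × W)))).hasStrictFDerivAt
  have h3 := C.toContinuousBilinearMap.hasStrictFDerivAt_of_bilinear h1 h2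
  have h4 : HasStrictFDerivAt (fun z : X × Y × W => z.1)
      (ContinuousLinearMap.fst ℂ X (Y × W)) (x, y, w) :=
    (ContinuousLinearMap.fst ℂ X (Y × W)).hasStrictFDerivAt
  have h5 := B.toContinuousBilinearMap.hasStrictFDerivAt_of_bilinear h3 h4
  refine h5.map_nhds_eq_of_surj (LinearMap.range_eq_top.2 fun e => ?_)
  obtain ⟨x', y', w', rfl⟩ := h e
  refine ⟨(x', y', w'), ?_⟩
  simp [add_comm]

section Generic

variable [Fintype Q.A] [hac : Fact (QAcyclic Q)] {S : Set (FormalRel Q)}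

local infixl:70 "⊚" => cmp _ (P _ _)

lemma eventually_bijective_lft (δ : Q.V → ℕ) :
    ∀ᶠ X : H S δ δ in nhds (gen S δ), ∀ x, Function.Bijective (lft S (P S δ) X x) := by
  rw [Filter.eventually_all]
  intro x
  have hT : RegL fun X : H S δ δ => lft S (P S δ) X x := fun v ξ =>
    Reg.linear (ξ ∘ₗ (lftL S (P S δ) δ x).flip v)
  have h0 : LinearMap.det (lft S (P S δ) (gen S δ) x) ≠ 0 := by
    have : lft S (P S δ) (gen S δ) x = LinearMap.id := LinearMap.ext fun u => lft_gen_self u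
    rw [this, LinearMap.det_id]
    exact one_ne_zero
  filter_upwards [hT.det.1.continuousAt.eventually_ne h0] with X hX
  exact (LinearMap.equivOfDetNeZero _ hX).bijective

lemma Can.eventually {κ δ : Q.V → ℕ} {f : H S κ δ} (hf : Can f) : ∀ᶠ g in nhds f, Can g := by
  obtain ⟨P, hP, h⟩ := exists_reg_can S κ δ
  filter_upwards [hP.1.continuousAt.eventually_ne ((h f).2 hf)] with g hg
  exact (h g).1 hg

/-- Equivalent canonical maps present isomorphic modules. -/
lemma Can.riso {κ δ : Q.V → ℕ} {f : H S κ δ} (hf : Can f) {X : H S δ δ} {Y : H S κ κ}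
    (hX : ∀ x, Function.Bijective (lft S (P S δ) X x))
    (hY : ∀ x, Function.Bijective (lft S (P S κ) Y x)) (hg : Can (Y ⊚ f ⊚ X)) :
    RIso (Vf (Y ⊚ f ⊚ X)) (Vf f) := by
  let e : ∀ x, PX S δ x ≃ₗ[ℂ] PX S δ x := fun x => LinearEquiv.ofBijective _ (hX x)
  have he : IsHom (P S δ) (P S δ) fun x => (e x).toLinearMap := lft_hom (isMod_P δ) X
  have hψ := hf.rf_hom.comp he.symm
  have hφ : ∀ x, lft S (ofQ (Vf f)) (fun x k => rf f x ((e x).symm (gen S δ x k))) x =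
      rf f x ∘ₗ (e x).symm.toLinearMap := fun x => LinearMap.ext fun u => (hom_eq_lft hψ u).symm
  obtain ⟨u, hu, -⟩ := hg.exists_iso hf.isMod
    (fun x k => rf f x ((e x).symm (gen S δ x k)))
    (fun x => by rw [hφ]; exact (hf.rf_surjective x).comp (e x).symm.surjective) fun x => by
      rw [hφ]
      ext v
      rw [LinearMap.mem_ker, LinearMap.comp_apply, ← LinearMap.mem_ker, hf.ker_rf]
      have h : ∀ w, lft S (P S δ) (Y ⊚ f ⊚ X) x w =
          e x (lft S (P S δ) f x (lft S (P S κ) Y x w)) := fun w => by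
        rw [lft_cmp (isMod_P δ), lft_cmp (isMod_P δ)]
        rfl
      constructor
      · rintro ⟨w, hw⟩
        obtain ⟨w, rfl⟩ := (hY x).2 w
        refine ⟨w, ?_⟩
        rw [h, hw]
        exact (e x).apply_symm_apply v
      · rintro ⟨w, rfl⟩
        refine ⟨lft S (P S κ) Y x w, ?_⟩
        rw [h]
        exact ((e x).symm_apply_apply _).symm
  exact ⟨u, (isHom_ofQ_iff _ _ _).1 hu⟩

variable {ι : Type} [Fintype ι] [DecidableEq ι] {κ δ : Q.V → ℕ} {κs δs : ι → Q.V → ℕ}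

/-- If there are no extensions between the summands of a point, then the generic point is
a direct sum. -/
theorem PAset_subset_zclosure (hS : AdmissibleRels S) (hδ : ∀ x, δ x = ∑ i, δs i x)
    {f : ∀ i, H S (κs i) (δs i)} (hf : ∀ i, Can (f i))
    (hfL : ∀ i j, i ≠ j → LinearMap.range (Lm (f i) (f j)) = ⊤) :
    PAset S δ ⊆ zclosure (sumSet δs (fun i => PAset S (δs i)) δ) := by
  have hκ : ∀ x, (fun x => ∑ i, κs i x) x = ∑ i, κs i x := fun _ => rfl
  set κ : Q.V → ℕ := fun x => ∑ i, κs i x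
  set F := dsum S hκ hδ f
  have hF : Can F := (can_dsum hκ hδ hf).1
  intro V hV
  obtain ⟨g, hg, rfl⟩ := hF.exists_can hS hV
  rw [mem_zclosure_iff]
  intro p hp
  by_contra! hcon
  obtain ⟨P', hP', hPp⟩ := exists_reg S κ p
  refine (hPp g).2 ⟨hg, hp⟩ (Reg.eq_zero hP' (z₀ := F) ?_ g)
  have hmap := map_nhds_trilinear (cmpL S (P S δ) κ δ) (cmpL S (P S δ) κ κ) (dsum S hκ hδ)
    (gen S δ) (gen S κ) f (by
      intro a
      have h1 : ∀ i j, ∃ z : H S (δs i) (δs j) × H S (κs i) (κs j), i ≠ j →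
          f i ⊚ z.1 + z.2 ⊚ f j = inc S hκ i ⊚ a ⊚ pr S hδ j := fun i j => by
        by_cases hij : i = j
        · exact ⟨0, fun h => (h hij).elim⟩
        · obtain ⟨z, hz⟩ := LinearMap.range_eq_top.1 (hfL i j hij) (inc S hκ i ⊚ a ⊚ pr S hδ j)
          exact ⟨z, fun _ => (Lm_apply _ _ _ _).symm.trans hz⟩
      choose z hz using h1
      obtain ⟨X, hX⟩ := exists_block (S := S) hδ hδ fun i j => if i = j then 0 else (z i j).1
      obtain ⟨Y, hY⟩ := exists_block (S := S) hκ hκ fun i j => if i = j then 0 else (z i j).2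
      refine ⟨X, Y, fun i => inc S hκ i ⊚ a ⊚ pr S hδ i, block_ext hκ hδ fun i j => ?_⟩
      simp only [cmpL_apply, gen_cmp, cmp_gen_right, cmp_add_left, cmp_add_right]
      have h1 : inc S hκ i ⊚ (F ⊚ X) ⊚ pr S hδ j = f i ⊚ (if i = j then 0 else (z i j).1) := by
        rw [← hX, ← cmp_cmp (inc S hκ i), inc_dsum]
        simp only [cmp_cmp]
      have h2 : inc S hκ i ⊚ (Y ⊚ F) ⊚ pr S hδ j = (if i = j then 0 else (z i j).2) ⊚ f j := by
        rw [← hY, cmp_cmp (inc S hκ i), cmp_cmp Y, dsum_pr]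
        simp only [cmp_cmp]
      rw [h1, h2, inc_dsum, cmp_cmp _ (inc S hδ i)]
      by_cases hij : i = j
      · subst hij
        rw [if_pos rfl, if_pos rfl, cmp_zero_right, cmp_zero_left, inc_pr_self, cmp_gen_right,
          zero_add, zero_add]
      · rw [if_neg hij, if_neg hij, inc_pr_ne hδ hij, cmp_zero_right, add_zero, hz i j hij])
  rw [cmpL_apply, cmpL_apply, gen_cmp, cmp_gen_right] at hmap
  rw [← hmap, Filter.eventually_map]
  have e₁ := (eventually_bijective_lft (S := S) δ).prod_inl_nhds (gen S κ, f)
  have e₂ := ((eventually_bijective_lft (S := S) κ).prod_inl_nhds f).prod_inr_nhds (gen S δ)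
  have e₃ : ∀ᶠ f' in nhds f, ∀ i, Can (f' i) :=
    Filter.eventually_all.2 fun i => (continuous_apply i).continuousAt.eventually (hf i).eventually
  filter_upwards [e₁, e₂, (e₃.prod_inr_nhds (gen S κ)).prod_inr_nhds (gen S δ)] with z hX hY hf'
  by_contra hz
  obtain ⟨hz₁, hz₂⟩ := (hPp _).1 hz
  obtain ⟨hc, hs⟩ := can_dsum hκ hδ hf'
  exact hz₂ (hcon _ ⟨_, fun i => (hf' i).mem_PAset, isSumOf_of_iso (hc.riso hX hY hz₁) hs⟩)

/-- Finitely many conditions on pairs can be satisfied simultaneously. -/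
theorem exists_simultaneous {J : Type} [Fintype J] [DecidableEq J] {κs δs : J → Q.V → ℕ}
    (hc : ∀ i, ∃ f : H S (κs i) (δs i), Can f)
    (h : ∀ i j, i ≠ j → ∃ f : ∀ i, H S (κs i) (δs i), LinearMap.range (Lm (f i) (f j)) = ⊤) :
    ∃ f : ∀ i, H S (κs i) (δs i), (∀ i, Can (f i)) ∧
      ∀ i j, i ≠ j → LinearMap.range (Lm (f i) (f j)) = ⊤ := by
  have key : ∀ q : J × J, ∃ p ∈ Reg (∀ i, H S (κs i) (δs i)), (∃ z, p z ≠ 0) ∧ ∀ z, p z ≠ 0 →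
      Can (z q.1) ∧ (q.1 ≠ q.2 → LinearMap.range (Lm (z q.1) (z q.2)) = ⊤) := by
    rintro ⟨i, j⟩
    obtain ⟨P', hP', hPc⟩ := exists_reg_can S (κs i) (δs i)
    have hP := Reg.comp_linear hP' (LinearMap.proj (φ := fun i => H S (κs i) (δs i)) i)
    have hP0 : ∃ z : ∀ i, H S (κs i) (δs i), P' (z i) ≠ 0 := by
      choose f hf using hc
      exact ⟨f, (hPc _).2 (hf i)⟩
    by_cases hij : i = j
    · exact ⟨_, hP, hP0, fun z hz => ⟨(hPc _).1 hz, fun h => (h hij).elim⟩⟩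
    obtain ⟨f, hf⟩ := h i j hij
    have hT : RegL fun z : ∀ i, H S (κs i) (δs i) => Lm (z i) (z j) := fun v ξ => by
      have : (fun z : ∀ i, H S (κs i) (δs i) => ξ (Lm (z i) (z j) v)) =
          (ξ ∘ₗ ((cmpL S (P S (δs j)) (κs i) (δs i)).flip v.1 ∘ₗ LinearMap.proj i +
            cmpL S (P S (δs j)) (κs i) (κs j) v.2 ∘ₗ LinearMap.proj j)) := rfl
      rw [this]
      exact Reg.linear _
    obtain ⟨p, hp, hpf, hpr⟩ := hT.exists_rank f
    obtain ⟨z, hz, hz'⟩ := Reg.exists_ne_zero₂ hP hp hP0 ⟨f, hpf⟩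
    refine ⟨_, Reg.mul hP hp, ⟨z, mul_ne_zero hz hz'⟩, fun z hz =>
      ⟨(hPc _).1 (left_ne_zero_of_mul hz),
      fun _ => Submodule.eq_top_of_finrank_eq (le_antisymm (Submodule.finrank_le _) ?_)⟩⟩
    have := hpr z (right_ne_zero_of_mul hz)
    rwa [hf, finrank_top] at this
  choose p hp hp0 hpz using key
  obtain ⟨z, hz⟩ := Reg.exists_forall_ne_zero Finset.univ (fun q _ => hp q) fun q _ => hp0 q
  exact ⟨z, fun i => (hpz (i, i) z (hz _ (Finset.mem_univ _))).1,
    fun i j => (hpz (i, j) z (hz _ (Finset.mem_univ _))).2⟩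

lemma sumSet_PAset_subset (hδ : ∀ x, δ x = ∑ i, δs i x) :
    sumSet δs (fun i => PAset S (δs i)) δ ⊆ PAset S δ := by
  rintro W ⟨V, hV, hW⟩
  choose κs f hf hfV using fun i => exists_can (hV i)
  obtain ⟨hc, hs⟩ := can_dsum (κ := fun x => ∑ i, κs i x) (fun _ => rfl) hδ hf
  simp only [hfV] at hs
  exact mem_PAset_of_iso (riso_of_isSumOf hs hW) hc.mem_PAset

end Generic

end GenDec

/-- Let `A = ℂQ/⟨R⟩` be a connected, acyclic, tame bound quiver algebra
and `α` with `P_A(α) ≠ ∅`.  If `C(α) = closure(C(α₁) ⊕ ⋯ ⊕ C(α_l))` is the generic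
decomposition of `C(α)` (each `C(α_i)` an indecomposable irreducible component), then for
every integer `n > 0` the generic decomposition of `C(nα)` is
`C(nα) = closure(C(α₁)^{⊕n} ⊕ ⋯ ⊕ C(α_l)^{⊕n})`. -/
theorem statement4 (Q : Quiv) [Fintype Q.A] (hconn : QConnected Q) (hacyc : QAcyclic Q)
    (R : Set (FormalRel Q)) (hRfin : R.Finite) (hRadm : AdmissibleRels R)
    (htame : IsTame R)
    (α : Q.V → ℕ) (hne : (PAset R α).Nonempty)
    (l : ℕ) (αs : Fin l → (Q.V → ℕ))
    (hsum : ∀ x, α x = ∑ i, αs i x)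
    (hnei : ∀ i, (PAset R (αs i)).Nonempty)
    (hindec : ∀ i, IsIndecComp (Cset R (αs i)) (modSet R (αs i)))
    (hdec : Cset R α = zclosure (sumSet αs (fun i => Cset R (αs i)) α))
    (n : ℕ) (hn : 0 < n) :
    Cset R (fun x => n * α x) =
      zclosure (sumSet (fun p : Fin l × Fin n => αs p.1)
        (fun p => Cset R (αs p.1)) (fun x => n * α x)) := by
  have := Fact.mk hacyc
  have hδ : ∀ x, n * α x = ∑ p : Fin l × Fin n, αs p.1 x := fun x => by
    simp [Fintype.sum_prod_type, hsum, Finset.mul_sum]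
  obtain ⟨κs, f, hf, hfL⟩ := GenDec.exists_pairwise_Lm_eq_top hsum hne hdec.subset
  choose f' hf' hcodim using fun i => GenDec.exists_small_codim htame hRadm (hf i) (hindec i)
  choose g _ hgL using fun i => (hf' i).exists_range_Lm_eq_top (hcodim i)
  obtain ⟨F, hF, hFL⟩ := GenDec.exists_simultaneous (S := R) (κs := fun p : Fin l × Fin n => κs p.1)
    (δs := fun p => αs p.1) (fun p => ⟨f p.1, hf p.1⟩) fun p q hpq => by
      by_cases h : p.1 = q.1
      · refine ⟨fun r => if r = p then f' r.1 else g r.1, ?_⟩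
        obtain ⟨i, a⟩ := p
        obtain ⟨j, b⟩ := q
        obtain rfl : i = j := h
        beta_reduce
        rw [if_pos rfl, if_neg hpq.symm]
        exact hgL i
      · exact ⟨fun r => f r.1, hfL _ _ h⟩
  refine Set.Subset.antisymm (GenDec.zclosure_subset_iff.2 ?_) (GenDec.zclosure_subset_iff.2 ?_)
  · refine (GenDec.PAset_subset_zclosure hRadm hδ hF hFL).trans
      (GenDec.zclosure_subset_iff.2 (Set.Subset.trans ?_ (GenDec.subset_zclosure _)))
    rintro W ⟨V, hV, hW⟩
    exact ⟨V, fun p => GenDec.subset_zclosure _ (hV p), hW⟩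
  · exact (GenDec.sumSet_zclosure_subset _).trans
      (GenDec.zclosure_subset_iff.2 ((GenDec.sumSet_PAset_subset hδ).trans
        (GenDec.subset_zclosure _)))
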